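/- Let (v,p) be a suitable weak solution of the Navier–Stokes equations in Q_T = Ω×(0,T), and let S ⊆ Q_T denote the set of singular points of v. Then the one-dimensional parabolic Hausdorff measure of S is zero; that is, the 1-dimensional Hausdorff measure of S, computed with respect to the parabolic metric d((x,t),(x',t')) = max(|x−x'|, |t−t'|^{1/2}) on ℝ³×ℝ, vanishes. -/

import Mathlib

open MeasureTheory Set Filter ENNReal

noncomputable section

/-- Euclidean 3-space. -/
abbrev E3 := EuclideanSpace ℝ (Fin 3)

/-- The parabolic cylinder `Q_{z,r} = B_{x,r} × (t - r², t)`. -/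
def pcyl (z : E3 × ℝ) (r : ℝ) : Set (E3 × ℝ) :=
  (Metric.ball z.1 r) ×ˢ (Ioo (z.2 - r ^ 2) z.2)

/-- The mixed space-time norm `‖f‖_{L^{γ,α}_{x,t}(B × (a,b))}`,
with the essential-supremum modification when an exponent is `∞`. -/
def mixedNorm {F : Type*} [NormedAddCommGroup F]
    (f : E3 × ℝ → F) (B : Set E3) (a b : ℝ) (γ α : ℝ≥0∞) : ℝ≥0∞ :=
  if α = ∞ then
    essSup (fun t => eLpNorm (fun x => f (x, t)) γ (volume.restrict B))
      (volume.restrict (Ioo a b))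
  else
    (∫⁻ t in Ioo a b,
      (eLpNorm (fun x => f (x, t)) γ (volume.restrict B)) ^ α.toReal) ^ (1 / α.toReal)

/-- `f ∈ L^{γ,α}_{x,t}(B × (a,b))`. -/
def MemMixed {F : Type*} [NormedAddCommGroup F]
    (f : E3 × ℝ → F) (B : Set E3) (a b : ℝ) (γ α : ℝ≥0∞) : Prop :=
  mixedNorm f B a b γ α < ∞

/-- Vector in `ℝ³` from coordinates. -/
def vec3 (a b c : ℝ) : E3 := (WithLp.equiv 2 (Fin 3 → ℝ)).symm ![a, b, c]

/-- Cross product in `ℝ³`. -/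
def cross3 (u w : E3) : E3 :=
  vec3 (u 1 * w 2 - u 2 * w 1) (u 2 * w 0 - u 0 * w 2) (u 0 * w 1 - u 1 * w 0)

/-- The unit direction `w/|w|`, interpreted as `0` when `w = 0`. -/
def unitd (w : E3) : E3 := ‖w‖⁻¹ • w

/-- Spatial partial derivative (in direction `i`) of a function on space-time. -/
def sdz {F : Type*} [NormedAddCommGroup F] [NormedSpace ℝ F]
    (φ : E3 × ℝ → F) (i : Fin 3) (z : E3 × ℝ) : F :=
  fderiv ℝ φ z (EuclideanSpace.single i 1, 0)

/-- Time derivative of a function on space-time. -/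
def tdz {F : Type*} [NormedAddCommGroup F] [NormedSpace ℝ F]
    (φ : E3 × ℝ → F) (z : E3 × ℝ) : F :=
  fderiv ℝ φ z (0, 1)

/-- The vorticity `ω = curl v` built from the (weak) velocity gradient
`Dv`, where `Dv z j i` represents `∂_j v_i (z)`. -/
def curlOf (Dv : E3 × ℝ → Fin 3 → Fin 3 → ℝ) (z : E3 × ℝ) : E3 :=
  vec3 (Dv z 1 2 - Dv z 2 1) (Dv z 2 0 - Dv z 0 2) (Dv z 0 1 - Dv z 1 0)

/-- A `3×3` matrix regarded as a Euclidean vector (so that its norm is the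
Frobenius norm). -/
def frob (M : Fin 3 → Fin 3 → ℝ) : EuclideanSpace ℝ (Fin 3 × Fin 3) :=
  (WithLp.equiv 2 (Fin 3 × Fin 3 → ℝ)).symm fun q => M q.1 q.2

/-- `(v, p)` is a suitable weak solution of the Navier–Stokes equations on
`Q_T = Ω × (0,T)`, with weak spatial gradient `Dv` (`Dv z j i = ∂_j v_i (z)`)
and initial data `v₀`. -/
structure IsSuitableWeakSolution (Ω : Set E3) (T : ℝ) (v : E3 × ℝ → E3)
    (Dv : E3 × ℝ → Fin 3 → Fin 3 → ℝ) (p : E3 × ℝ → ℝ) (v₀ : E3 → E3) : Prop where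
  meas_v : Measurable v
  meas_Dv : Measurable Dv
  meas_p : Measurable p
  /-- `Dv` is the weak spatial gradient of `v`. -/
  weak_grad : ∀ ψ : E3 → ℝ, ContDiff ℝ (⊤ : ℕ∞) ψ → HasCompactSupport ψ → tsupport ψ ⊆ Ω →
    ∀ᵐ t ∂(volume.restrict (Ioo 0 T)), ∀ i j : Fin 3,
      ∫ x in Ω, v (x, t) j * fderiv ℝ ψ x (EuclideanSpace.single i 1) =
        - ∫ x in Ω, Dv (x, t) i j * ψ x
  /-- `v ∈ L^∞(0,T;L²(Ω))`. -/
  v_linf_l2 : MemMixed v Ω 0 T 2 ∞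
  /-- `v ∈ L²(0,T;W^{1,2}(Ω))`. -/
  v_l2_w12 : IntegrableOn (fun z => ‖v z‖ ^ 2 + ∑ i, ∑ j, (Dv z i j) ^ 2) (Ω ×ˢ Ioo 0 T)
  /-- `p ∈ L^{3/2}(Q_T)`. -/
  p_l32 : IntegrableOn (fun z => |p z| ^ (3 / 2 : ℝ)) (Ω ×ˢ Ioo 0 T)
  /-- The weak form of the Navier–Stokes equations. -/
  weak_nse : ∀ φ : E3 × ℝ → E3, ContDiff ℝ (⊤ : ℕ∞) φ → HasCompactSupport φ →
    tsupport φ ⊆ Ω ×ˢ Iio T →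
    ∫ z in Ω ×ˢ Ioo 0 T,
        (-(∑ i, v z i * tdz φ z i) + (∑ i, ∑ j, v z j * Dv z j i * φ z i)
          + (∑ i, ∑ j, Dv z j i * sdz φ j z i) - p z * ∑ i, sdz φ i z i)
      = ∫ x in Ω, ∑ i, v₀ x i * φ (x, 0) i
  /-- `div v = 0` weakly. -/
  div_free : ∀ ψ : E3 × ℝ → ℝ, ContDiff ℝ (⊤ : ℕ∞) ψ → HasCompactSupport ψ →
    tsupport ψ ⊆ Ω ×ˢ Ioo 0 T →
    ∫ z in Ω ×ˢ Ioo 0 T, ∑ i, v z i * sdz ψ i z = 0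
  /-- The local energy inequality. -/
  local_energy : ∀ᵐ t ∂(volume.restrict (Ioo 0 T)), ∀ φ : E3 × ℝ → ℝ,
    ContDiff ℝ (⊤ : ℕ∞) φ → HasCompactSupport φ → tsupport φ ⊆ Ω ×ˢ Ioo 0 T → (∀ z, 0 ≤ φ z) →
    (∫ x in Ω, ‖v (x, t)‖ ^ 2 * φ (x, t))
        + 2 * ∫ z in Ω ×ˢ Ioo 0 t, (∑ i, ∑ j, (Dv z i j) ^ 2) * φ z
      ≤ ∫ z in Ω ×ˢ Ioo 0 t,
          (‖v z‖ ^ 2 * (tdz φ z + ∑ i, sdz (fun w => sdz φ i w) i z)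
            + (‖v z‖ ^ 2 + 2 * p z) * ∑ i, v z i * sdz φ i z)

/-- `z` is a regular point of `v`: `v` is essentially bounded on some parabolic
cylinder `Q_{z,r} ⊆ Q_T`. -/
def RegularPoint (Ω : Set E3) (T : ℝ) (v : E3 × ℝ → E3) (z : E3 × ℝ) : Prop :=
  ∃ r > 0, pcyl z r ⊆ Ω ×ˢ Ioo 0 T ∧
    ∃ M : ℝ, ∀ᵐ w ∂(volume.restrict (pcyl z r)), ‖v w‖ ≤ M

/-- `z` is a singular point of `v` in `Q_T`. -/
def SingularPoint (Ω : Set E3) (T : ℝ) (v : E3 × ℝ → E3) (z : E3 × ℝ) : Prop :=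
  z ∈ Ω ×ˢ Ioo 0 T ∧ ¬ RegularPoint Ω T v z

lemma sqrt_add_le' (x y : ℝ) (hx : 0 ≤ x) (hy : 0 ≤ y) :
    Real.sqrt (x + y) ≤ Real.sqrt x + Real.sqrt y := by
  have h1 := Real.sq_sqrt hx
  have h2 := Real.sq_sqrt hy
  have h3 := Real.sqrt_nonneg x
  have h4 := Real.sqrt_nonneg y
  have hle : x + y ≤ (Real.sqrt x + Real.sqrt y) ^ 2 := by nlinarith
  calc Real.sqrt (x + y) ≤ Real.sqrt ((Real.sqrt x + Real.sqrt y) ^ 2) :=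
        Real.sqrt_le_sqrt hle
    _ = Real.sqrt x + Real.sqrt y := Real.sqrt_sq (by positivity)

/-- Space-time `ℝ³ × ℝ` equipped with the parabolic metric
`d((x,t),(x',t')) = max |x-x'| (|t-t'|^{1/2})`. -/
def ParabolicSpace : Type := E3 × ℝ

/-- The canonical identification of space-time with `ParabolicSpace`. -/
def toParabolic (z : E3 × ℝ) : ParabolicSpace := z

/-- The underlying point of space-time. -/
def ParabolicSpace.un (z : ParabolicSpace) : E3 × ℝ := z

instance : MetricSpace ParabolicSpace where
  dist z w := max (dist z.un.1 w.un.1) (Real.sqrt (dist z.un.2 w.un.2))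
  dist_self z := by simp
  dist_comm z w := by simp [dist_comm]
  dist_triangle x y z := by
    apply max_le
    · calc dist x.un.1 z.un.1 ≤ dist x.un.1 y.un.1 + dist y.un.1 z.un.1 :=
            dist_triangle _ _ _
        _ ≤ _ := add_le_add (le_max_left _ _) (le_max_left _ _)
    · calc Real.sqrt (dist x.un.2 z.un.2)
          ≤ Real.sqrt (dist x.un.2 y.un.2 + dist y.un.2 z.un.2) :=
            Real.sqrt_le_sqrt (dist_triangle _ _ _)
        _ ≤ Real.sqrt (dist x.un.2 y.un.2) + Real.sqrt (dist y.un.2 z.un.2) :=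
            sqrt_add_le' _ _ dist_nonneg dist_nonneg
        _ ≤ _ := add_le_add (le_max_right _ _) (le_max_right _ _)
  eq_of_dist_eq_zero := by
    intro x y hxy
    have h1 : dist x.un.1 y.un.1 = 0 :=
      le_antisymm (le_of_max_le_left (le_of_eq hxy)) dist_nonneg
    have h2 : Real.sqrt (dist x.un.2 y.un.2) = 0 :=
      le_antisymm (le_of_max_le_right (le_of_eq hxy)) (Real.sqrt_nonneg _)
    have h2' : dist x.un.2 y.un.2 = 0 := by
      have := (Real.sqrt_eq_zero dist_nonneg).mp h2
      exact this
    have : x.un = y.un := Prod.ext (eq_of_dist_eq_zero h1) (eq_of_dist_eq_zero h2')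
    exact this

instance : MeasurableSpace ParabolicSpace := borel ParabolicSpace
instance : BorelSpace ParabolicSpace := ⟨rfl⟩

open Metric
local notation "oR" => ENNReal.ofReal
local notation "hlf" => (1 / 2 : ℝ)
local notation "r16" => (16 / 11 : ℝ)
local notation "smo" => (⊤ : ℕ∞)
local notation "ST" => (E3 × ℝ)

section
lemma vol_pcyl_le : ∃ C : ℝ≥0∞, C ≠ ∞ ∧ ∀ (z : ST) (r : ℝ), 0 < r →
    volume (pcyl z r) ≤ C * oR (r ^ 5) := by
  refine ⟨volume (ball (0 : E3) 1), (measure_ball_lt_top).ne, fun z r hr => ?_⟩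
  rw [pcyl, Measure.volume_eq_prod, Measure.prod_prod, Measure.addHaar_ball _ _ hr.le]
  rw [Real.volume_Ioo]
  have : r ^ 5 = r ^ 3 * (z.2 - (z.2 - r ^ 2)) := by ring
  rw [this, ofReal_mul (by positivity)]
  simp only [finrank_euclideanSpace, Fintype.card_fin]
  apply le_of_eq
  ring

lemma isOpen_pcyl (z : ST) (r : ℝ) : IsOpen (pcyl z r) :=
  isOpen_ball.prod isOpen_Ioo

lemma pcyl_nonempty (z : ST) {r : ℝ} (hr : 0 < r) : (pcyl z r).Nonempty :=
  ⟨(z.1, z.2 - r ^ 2 / 2), by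
    refine ⟨mem_ball_self hr, ?_, ?_⟩ <;> simp <;> nlinarith⟩

lemma pcyl_sub_closedBall (z : ST) {r : ℝ} (hr : 0 < r) :
    toParabolic '' (pcyl z r) ⊆ closedBall (toParabolic z) r := by
  rintro _ ⟨w, ⟨hw1, hw2⟩, rfl⟩
  change max (dist w.1 z.1) (Real.sqrt (dist w.2 z.2)) ≤ r
  apply max_le (le_of_lt hw1)
  rw [Real.sqrt_le_left hr.le, Real.dist_eq, abs_le]
  exact ⟨by linarith [hw2.1], by linarith [hw2.2, sq_nonneg r]⟩

lemma covering (f : ST → ℝ≥0∞) (U : Set (ST))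
    (hf : ∫⁻ z in U, f z ≠ ∞) (S : Set (ST)) (ε : ℝ) (hε : 0 < ε)
    (h : ∀ z ∈ S, ∀ δ > 0, ∃ r, 0 < r ∧ r < δ ∧ pcyl z r ⊆ U ∧
      oR (ε * r) ≤ ∫⁻ w in pcyl z r, f w) :
    μH[(1 : ℝ)] (toParabolic '' S) = 0 := by
  obtain ⟨C, hC, hvol⟩ := vol_pcyl_le
  have hδ : ∀ n : ℕ, (0 : ℝ) < 1 / ((n : ℝ) + 1) := fun n => by positivity
  have key : ∀ n : ℕ, ∃ (u : Set (ST)) (r : ST → ℝ), u.Countable ∧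
      (∀ z ∈ u, 0 < r z ∧ r z < 1 / ((n : ℝ) + 1) ∧ pcyl z (r z) ⊆ U ∧
        oR (ε * r z) ≤ ∫⁻ w in pcyl z (r z), f w) ∧
      u.PairwiseDisjoint (fun z => pcyl z (r z)) ∧
      toParabolic '' S ⊆ ⋃ z : u, closedBall (toParabolic z) (4 * r z) := by
    intro n
    choose! r hr using fun z (hz : z ∈ S) => h z hz _ (hδ n)
    obtain ⟨u, huS, hdisj, hcov⟩ := Vitali.exists_disjoint_subfamily_covering_enlargement_closedBall
      S toParabolic r _ (fun a ha => (hr a ha).2.1.le) 4 (by norm_num)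
    have hd : u.PairwiseDisjoint (fun z => pcyl z (r z)) := by
      intro a ha b hb hab
      have := hdisj ha hb hab
      rw [Function.onFun, disjoint_left] at this ⊢
      intro w hwa hwb
      exact this (pcyl_sub_closedBall a (hr a (huS ha)).1 ⟨w, hwa, rfl⟩)
        (pcyl_sub_closedBall b (hr b (huS hb)).1 ⟨w, hwb, rfl⟩)
    refine ⟨u, r, ?_, fun z hz => hr z (huS hz), hd, ?_⟩
    · exact hd.countable_of_isOpen (fun z _ => isOpen_pcyl _ _)
        (fun z hz => pcyl_nonempty z (hr z (huS hz)).1)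
    · rintro _ ⟨z, hz, rfl⟩
      obtain ⟨b, hb, hsub⟩ := hcov z hz
      exact mem_iUnion.2 ⟨⟨b, hb⟩, hsub (mem_closedBall_self (hr z hz).1.le)⟩
  choose u r hcount hprop hdisj hcov using key
  let V : ℕ → Set (ST) := fun n => ⋃ z ∈ u n, pcyl z (r n z)
  have hVU : ∀ n, V n ⊆ U := fun n => iUnion₂_subset fun z hz => (hprop n z hz).2.2.1
  have hsum : ∀ n, ∑' z : u n, oR (ε * r n z) ≤ ∫⁻ w in V n, f w := by
    intro n
    rw [lintegral_biUnion (hcount n) (fun z _ => (isOpen_pcyl _ _).measurableSet) (hdisj n)]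
    exact ENNReal.tsum_le_tsum fun z => (hprop n z z.2).2.2.2
  have hε' : oR ε ≠ 0 := by simpa using hε
  have hvolV : ∀ n, volume (V n) ≤ (C * (oR ε)⁻¹ * ∫⁻ z in U, f z) *
      oR (1 / ((n : ℝ) + 1)) := by
    intro n
    have h1 : volume (V n) ≤ ∑' z : u n, volume (pcyl z (r n z)) := by
      rw [measure_biUnion (hcount n) (hdisj n) (fun z _ => (isOpen_pcyl _ _).measurableSet)]
    have h2 : ∑' z : u n, volume (pcyl z (r n z)) ≤
        ∑' z : u n, (C * (oR ε)⁻¹ * oR (1 / ((n : ℝ) + 1))) *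
          oR (ε * r n z) := by
      refine ENNReal.tsum_le_tsum fun z => ?_
      obtain ⟨hr0, hr1, -, -⟩ := hprop n z z.2
      refine (hvol _ _ hr0).trans ?_
      have hle1 : (1 : ℝ) / ((n : ℝ) + 1) ≤ 1 := by
        rw [div_le_one (by positivity)]; linarith [(Nat.cast_nonneg n : (0:ℝ) ≤ n)]
      have h3 : (r n z) ^ 5 ≤ (1 / ((n : ℝ) + 1)) * r n z := by
        have hr2 : r n z ≤ 1 := hr1.le.trans hle1
        calc (r n z) ^ 5 = (r n z)^3 * (r n z * r n z) := by ring
          _ ≤ 1 * (1 / ((n : ℝ) + 1) * r n z) := by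
            apply mul_le_mul (pow_le_one₀ hr0.le hr2) _ (by positivity) zero_le_one
            exact mul_le_mul_of_nonneg_right hr1.le hr0.le
          _ = _ := by ring
      calc C * oR (r n z ^ 5) ≤ C * oR (1 / ((n : ℝ) + 1) * r n z) := by
            gcongr
        _ = (C * ((oR ε)⁻¹ * oR ε) * oR (1 / ((n : ℝ) + 1))) *
          oR (r n z) := by
            rw [ENNReal.inv_mul_cancel hε' ofReal_ne_top,
              ofReal_mul (hδ n).le]; ring
        _ = _ := by rw [ofReal_mul hε.le]; ring
    refine (h1.trans h2).trans ?_
    rw [ENNReal.tsum_mul_left]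
    calc _ ≤ (C * (oR ε)⁻¹ * oR (1 / ((n : ℝ) + 1))) * ∫⁻ z in U, f z := by
          gcongr
          exact (hsum n).trans (lintegral_mono_set (hVU n))
      _ = _ := by ring
  have hδ0 : Tendsto (fun n : ℕ => oR (1 / ((n : ℝ) + 1))) atTop (nhds 0) := by
    have := tendsto_ofReal (tendsto_one_div_add_atTop_nhds_zero_nat (𝕜 := ℝ))
    simpa using this
  have hvol0 : Tendsto (fun n => volume (V n)) atTop (nhds 0) := by
    refine tendsto_of_tendsto_of_tendsto_of_le_of_le tendsto_const_nhds ?_ (fun n => zero_le)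
      hvolV
    have := ENNReal.Tendsto.const_mul (a := C * (oR ε)⁻¹ * ∫⁻ z in U, f z) hδ0
      (Or.inr (mul_ne_top (mul_ne_top hC (inv_ne_top.2 hε')) hf))
    simpa using this
  have hint0 : Tendsto (fun n => ∫⁻ w in V n, f w) atTop (nhds 0) := by
    have h1 : Tendsto (fun n => ∫⁻ w in V n, f w ∂(volume.restrict U)) atTop (nhds 0) := by
      apply tendsto_setLIntegral_zero hf
      exact tendsto_of_tendsto_of_tendsto_of_le_of_le tendsto_const_nhds hvol0 (fun n => zero_le)
        (fun n => Measure.restrict_apply_le _ _)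
    refine h1.congr fun n => ?_
    rw [Measure.restrict_restrict_of_subset (hVU n)]
  haveI : ∀ n, Countable (u n) := fun n => (hcount n).to_subtype
  have hr0 : Tendsto (fun n : ℕ => 8 * oR (1 / ((n : ℝ) + 1))) atTop (nhds 0) := by
    have := ENNReal.Tendsto.const_mul (a := 8) hδ0 (Or.inr (by norm_num))
    simpa using this
  have hdiam : ∀ n (z : u n), ediam (closedBall (toParabolic z) (4 * r n z)) ≤
      8 * oR (r n z) := by
    intro n z
    rw [← emetric_closedBall (mul_nonneg (by norm_num) (hprop n z z.2).1.le)]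
    refine ediam_closedEBall_le.trans ?_
    rw [ofReal_mul (by norm_num), ← mul_assoc]
    apply le_of_eq; congr 1
    norm_num
  have := Measure.hausdorffMeasure_le_liminf_tsum (1 : ℝ) (toParabolic '' S) (l := atTop)
    (fun n : ℕ => 8 * oR (1 / ((n : ℝ) + 1))) hr0
    (fun n (z : u n) => closedBall (toParabolic z) (4 * r n z))
    (Eventually.of_forall fun n z => (hdiam n z).trans (by
      gcongr; exact (hprop n z z.2).2.1.le))
    (Eventually.of_forall fun n => hcov n)
  refine le_antisymm (this.trans ?_) zero_le
  have h5 : Tendsto (fun n => (8 * (oR ε)⁻¹) * ∫⁻ w in V n, f w) atTop (nhds 0) := by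
    have := ENNReal.Tendsto.const_mul (a := 8 * (oR ε)⁻¹) hint0
      (Or.inr (mul_ne_top (by norm_num) (inv_ne_top.2 hε')))
    simpa using this
  rw [← h5.liminf_eq]
  refine liminf_le_liminf (Eventually.of_forall fun n => ?_)
  calc _ ≤ ∑' z : u n, (8 * (oR ε)⁻¹) * oR (ε * r n z) := by
        refine ENNReal.tsum_le_tsum fun z => ?_
        rw [rpow_one]
        refine (hdiam n z).trans (le_of_eq ?_)
        rw [ofReal_mul hε.le, mul_assoc, ← mul_assoc _ (oR ε),
          ENNReal.inv_mul_cancel hε' ofReal_ne_top, one_mul]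
    _ ≤ _ := by
        rw [ENNReal.tsum_mul_left]
        gcongr
        exact hsum n
end

section
/-- partial derivative -/
def pd (i : Fin 3) (f : E3 → ℝ) (x : E3) : ℝ := fderiv ℝ f x (EuclideanSpace.single i 1)

lemma contDiff_pd {i : Fin 3} {f : E3 → ℝ} (hf : ContDiff ℝ smo f) :
    ContDiff ℝ smo (pd i f) :=
  (hf.fderiv_right (m := smo) (by simp)).clm_apply contDiff_const

lemma hasDerivAt_of_smooth {h : ℝ → ℝ} (hh : ContDiff ℝ smo h) (s : ℝ) :
    HasDerivAt h (deriv h s) s :=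
  (hh.differentiable (by simp)).differentiableAt.hasDerivAt

lemma contDiff_deriv' {h : ℝ → ℝ} (hh : ContDiff ℝ smo h) :
    ContDiff ℝ smo (deriv h) :=
  ((contDiff_infty_iff_deriv).1 hh).2

lemma hasFDerivAt_sq (x y : E3) : HasFDerivAt (fun y : E3 => ‖y - x‖ ^ 2)
    (2 • (innerSL ℝ (y - x))) y := by
  have := (hasStrictFDerivAt_norm_sq (y - x)).hasFDerivAt
  exact this.comp y ((hasFDerivAt_id y).sub_const x)

lemma contDiff_radial {h : ℝ → ℝ} (hh : ContDiff ℝ smo h) (x : E3) :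
    ContDiff ℝ smo (fun y : E3 => h (‖y - x‖ ^ 2)) :=
  hh.comp ((contDiff_id.sub contDiff_const).norm_sq ℝ)

lemma pd_radial {h : ℝ → ℝ} (hh : ContDiff ℝ smo h) (x : E3) (i : Fin 3) :
    pd i (fun y : E3 => h (‖y - x‖ ^ 2)) =
      fun y => 2 * (y - x) i * deriv h (‖y - x‖ ^ 2) := by
  funext y
  have := (hasDerivAt_of_smooth hh (‖y - x‖ ^ 2)).comp_hasFDerivAt y (hasFDerivAt_sq x y)
  rw [pd, HasFDerivAt.fderiv (f := fun y : E3 => h (‖y - x‖ ^ 2)) this]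
  simp [EuclideanSpace.inner_single_right]
  ring

lemma hasFDerivAt_coord (x y : E3) (i : Fin 3) : HasFDerivAt (fun y : E3 => (y - x) i)
    (EuclideanSpace.proj i : E3 →L[ℝ] ℝ) y := by
  have := (EuclideanSpace.proj i : E3 →L[ℝ] ℝ).hasFDerivAt.comp y ((hasFDerivAt_id y).sub_const x)
  exact this

lemma pd_pd_radial {h : ℝ → ℝ} (hh : ContDiff ℝ smo h) (x : E3) (i : Fin 3) (y : E3) :
    pd i (pd i (fun y : E3 => h (‖y - x‖ ^ 2))) y =
      2 * deriv h (‖y - x‖ ^ 2) + 4 * ((y - x) i) ^ 2 * deriv (deriv h) (‖y - x‖ ^ 2) := by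
  rw [pd_radial hh]
  have h1 := (hasDerivAt_of_smooth (contDiff_deriv' hh) (‖y - x‖ ^ 2)).comp_hasFDerivAt y
    (hasFDerivAt_sq x y)
  have h2 := ((hasFDerivAt_coord x y i).const_mul 2).mul h1
  rw [pd, HasFDerivAt.fderiv (f := fun y : E3 => 2 * (y - x) i * deriv h (‖y - x‖ ^ 2)) h2]
  simp [EuclideanSpace.inner_single_right]
  ring

lemma lap_radial {h : ℝ → ℝ} (hh : ContDiff ℝ smo h) (x : E3) (y : E3) :
    ∑ i, pd i (pd i (fun y : E3 => h (‖y - x‖ ^ 2))) y =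
      6 * deriv h (‖y - x‖ ^ 2) + 4 * ‖y - x‖ ^ 2 * deriv (deriv h) (‖y - x‖ ^ 2) := by
  simp_rw [pd_pd_radial hh]
  rw [EuclideanSpace.norm_sq_eq]
  simp only [Fin.sum_univ_three, Real.norm_eq_abs, sq_abs]
  ring

/-- smooth positive function equal to `1` for `s ≤ 0` and `s` for `s ≥ 1`. -/
def ll (s : ℝ) : ℝ := s * Real.smoothTransition s + (1 - Real.smoothTransition s)

lemma ll_contDiff : ContDiff ℝ smo ll :=
  (contDiff_id.mul Real.smoothTransition.contDiff).add
    (contDiff_const.sub Real.smoothTransition.contDiff)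

lemma ll_pos (s : ℝ) : 0 < ll s := by
  unfold ll
  rcases le_or_gt s 0 with h | h
  · simp [Real.smoothTransition.zero_of_nonpos h]
  · have h0 := Real.smoothTransition.nonneg s
    have h1 := Real.smoothTransition.le_one s
    rcases h1.lt_or_eq with h2 | h2
    · nlinarith
    · rw [h2]; linarith

lemma ll_of_one_le {s : ℝ} (h : 1 ≤ s) : ll s = s := by
  simp [ll, Real.smoothTransition.one_of_one_le h]

/-- regularised `s^(-1/2)`. -/
def nn (s : ℝ) : ℝ := (Real.sqrt (ll s))⁻¹

lemma nn_contDiff : ContDiff ℝ smo nn :=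
  (ll_contDiff.sqrt (fun s => (ll_pos s).ne')).inv
    (fun s => (Real.sqrt_pos.2 (ll_pos s)).ne')

lemma nn_eq {s : ℝ} (h : 1 ≤ s) : nn s = s ^ (-(1/2) : ℝ) := by
  rw [nn, ll_of_one_le h, Real.sqrt_eq_rpow, Real.rpow_neg (by linarith)]

lemma deriv_nn_gt {s : ℝ} (h : 1 < s) : deriv nn s = -(1/2) * s ^ (-(3/2) : ℝ) := by
  have h1 : nn =ᶠ[nhds s] fun s => s ^ (-(1/2) : ℝ) := by
    filter_upwards [lt_mem_nhds h] with t ht using nn_eq ht.le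
  rw [h1.deriv_eq, Real.deriv_rpow_const]
  norm_num

lemma deriv_nn {s : ℝ} (h : 1 ≤ s) : deriv nn s = -(1/2) * s ^ (-(3/2) : ℝ) := by
  rcases h.lt_or_eq with h | rfl
  · exact deriv_nn_gt h
  have h1 : Tendsto (deriv nn) (nhdsWithin 1 (Ioi 1)) (nhds (deriv nn 1)) :=
    ((contDiff_deriv' nn_contDiff).continuous.tendsto _).mono_left nhdsWithin_le_nhds
  have h2 : Tendsto (fun s : ℝ => -(1/2) * s ^ (-(3/2) : ℝ)) (nhdsWithin 1 (Ioi 1))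
      (nhds (-(1/2) * (1:ℝ) ^ (-(3/2) : ℝ))) := by
    apply Tendsto.mono_left _ nhdsWithin_le_nhds
    exact ((Real.continuousAt_rpow_const _ _ (Or.inl one_ne_zero)).tendsto).const_mul _
  refine tendsto_nhds_unique h1 (h2.congr' ?_)
  filter_upwards [self_mem_nhdsWithin] with t ht using (deriv_nn_gt ht).symm

lemma deriv2_nn_gt {s : ℝ} (h : 1 < s) : deriv (deriv nn) s = (3/4) * s ^ (-(5/2) : ℝ) := by
  have h1 : deriv nn =ᶠ[nhds s] fun s => -(1/2) * s ^ (-(3/2) : ℝ) := by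
    filter_upwards [lt_mem_nhds h] with t ht using deriv_nn_gt ht
  rw [h1.deriv_eq, deriv_const_mul _ (Real.differentiableAt_rpow_const_of_ne _ (by linarith)),
    Real.deriv_rpow_const]
  norm_num
  ring

/-- `k = Δ n` -/
def kk (s : ℝ) : ℝ := 6 * deriv nn s + 4 * s * deriv (deriv nn) s

lemma kk_contDiff : ContDiff ℝ smo kk :=
  (contDiff_const.mul (contDiff_deriv' nn_contDiff)).add
   ((contDiff_const.mul contDiff_id).mul (contDiff_deriv' (contDiff_deriv' nn_contDiff)))

lemma kk_zero_gt {s : ℝ} (h : 1 < s) : kk s = 0 := by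
  rw [kk, deriv_nn_gt h, deriv2_nn_gt h]
  have : s ^ (-(3/2) : ℝ) = s * s ^ (-(5/2) : ℝ) := by
    rw [← Real.rpow_one_add' (by linarith) (by norm_num)]; norm_num
  rw [this]; ring

lemma kk_zero {s : ℝ} (h : 1 ≤ s) : kk s = 0 := by
  rcases h.lt_or_eq with h | rfl
  · exact kk_zero_gt h
  have h1 : Tendsto kk (nhdsWithin 1 (Ioi 1)) (nhds (kk 1)) :=
    (kk_contDiff.continuous.tendsto _).mono_left nhdsWithin_le_nhds
  refine tendsto_nhds_unique h1 (tendsto_const_nhds.congr' ?_)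
  filter_upwards [self_mem_nhdsWithin] with t ht using (kk_zero_gt ht).symm

/-- A smooth function on `ℝ` which vanishes for `s ≥ 1` is bounded on `s ≥ 0`. -/
lemma bdd_of_zero {h : ℝ → ℝ} (hc : Continuous h) (h0 : ∀ s, 1 ≤ s → h s = 0) :
    ∃ C, 0 < C ∧ ∀ s, 0 ≤ s → |h s| ≤ C := by
  obtain ⟨C, hC⟩ := (isCompact_Icc (a := (0:ℝ)) (b := 1)).exists_bound_of_continuousOn
    hc.continuousOn
  refine ⟨max C 1, by positivity, fun s hs => ?_⟩
  rcases le_or_gt s 1 with h | h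
  · exact (hC s ⟨hs, h⟩).trans (le_max_left _ _)
  · rw [h0 s h.le, abs_zero]; positivity

lemma nn'_bound : ∃ C, 0 < C ∧ ∀ s, 0 < s → |deriv nn s| ≤ C * s ^ (-(3/2) : ℝ) := by
  obtain ⟨C, hC⟩ := (isCompact_Icc (a := (0:ℝ)) (b := 1)).exists_bound_of_continuousOn
    (contDiff_deriv' nn_contDiff).continuous.continuousOn
  refine ⟨max C 1, by positivity, fun s hs => ?_⟩
  rcases le_or_gt s 1 with h | h
  · calc |deriv nn s| ≤ max C 1 * 1 := by rw [mul_one]; exact (hC s ⟨hs.le, h⟩).trans (le_max_left _ _)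
      _ ≤ _ := by
        gcongr
        exact Real.one_le_rpow_of_pos_of_le_one_of_nonpos hs h (by norm_num)
  · have : 0 ≤ s ^ (-(3/2) : ℝ) := by positivity
    rw [deriv_nn h.le, abs_mul, abs_of_nonneg this]
    gcongr
    rw [abs_neg, abs_of_pos (by norm_num)]
    exact le_trans (by norm_num) (le_max_right C 1)

/-- total mass of the kernel -/
def m0 : ℝ := ∫ z : E3, kk (‖z‖ ^ 2)

lemma m0_ne : m0 ≠ 0 := by
  have h1 := integral_fun_norm_addHaar (volume : Measure E3) (fun r => kk (r ^ 2))
  have h2 : ∫ y in Ioi (0:ℝ), y ^ (Module.finrank ℝ E3 - 1) • kk (y ^ 2) = -1 := by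
    have hd : ∀ y : ℝ, HasDerivAt (fun y => 2 * y ^ 3 * deriv nn (y ^ 2))
        (y ^ 2 * kk (y ^ 2)) y := by
      intro y
      have e1 := (hasDerivAt_of_smooth (contDiff_deriv' nn_contDiff) (y ^ 2)).comp y
        (hasDerivAt_pow 2 y)
      have e2 := ((hasDerivAt_pow 3 y).const_mul 2).mul e1
      refine e2.congr_deriv ?_
      simp [kk]; ring
    have h3 : ∫ y in (0:ℝ)..1, y ^ 2 * kk (y ^ 2) = -1 := by
      rw [intervalIntegral.integral_eq_sub_of_hasDerivAt (fun y _ => hd y)]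
      · rw [one_pow, one_pow, deriv_nn le_rfl]; norm_num
      · apply Continuous.intervalIntegrable
        exact (continuous_pow 2).mul (kk_contDiff.continuous.comp (continuous_pow 2))
    rw [← h3, intervalIntegral.integral_of_le zero_le_one]
    simp only [finrank_euclideanSpace, Fintype.card_fin, smul_eq_mul]
    apply setIntegral_eq_of_subset_of_forall_sdiff_eq_zero measurableSet_Ioi Ioc_subset_Ioi_self
    intro y hy
    have : 1 < y := by
      by_contra hh
      exact hy.2 ⟨hy.1, not_lt.1 hh⟩
    rw [kk_zero (by nlinarith)]; simp
  rw [m0, h1, h2]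
  simp only [finrank_euclideanSpace, Fintype.card_fin, smul_eq_mul, nsmul_eq_mul]
  have : 0 < volume.real (ball (0:E3) 1) :=
    toReal_pos (measure_ball_pos volume (0:E3) one_pos).ne' measure_ball_lt_top.ne
  simp [this.ne']

/-- `n_ε(s) = ε⁻¹ n(s/ε²)` -/
def nne (ε s : ℝ) : ℝ := ε⁻¹ * nn (s / ε ^ 2)

lemma nne_contDiff (ε : ℝ) : ContDiff ℝ smo (nne ε) :=
  contDiff_const.mul (nn_contDiff.comp (contDiff_id.div_const _))

lemma nne_eq {ε s : ℝ} (hε : 0 < ε) (h : ε ^ 2 ≤ s) : nne ε s = s ^ (-(1/2) : ℝ) := by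
  have h2 : 0 ≤ s := (by positivity : (0:ℝ) ≤ ε ^ 2).trans h
  rw [nne, nn_eq (by rw [le_div_iff₀ (by positivity)]; linarith),
    Real.div_rpow h2 (by positivity), ← Real.rpow_natCast,
    ← Real.rpow_mul hε.le]
  norm_num [Real.rpow_neg_one]
  field_simp

lemma deriv_comp_div {h : ℝ → ℝ} (hh : ContDiff ℝ smo h) (a b : ℝ) :
    deriv (fun s => a * h (s / b)) = fun s => a * b⁻¹ * deriv h (s / b) := by
  funext s
  have := ((hasDerivAt_of_smooth hh (s / b)).comp s ((hasDerivAt_id s).div_const b)).const_mul a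
  refine HasDerivAt.deriv (f := fun s => a * h (s / b)) (this.congr_deriv ?_)
  simp; ring

lemma deriv_nne (ε : ℝ) : deriv (nne ε) = fun s => ε⁻¹ * (ε ^ 2)⁻¹ * deriv nn (s / ε ^ 2) :=
  deriv_comp_div nn_contDiff _ _

lemma lap_nne {ε : ℝ} (hε : 0 < ε) (s : ℝ) :
    6 * deriv (nne ε) s + 4 * s * deriv (deriv (nne ε)) s = (ε ^ 3)⁻¹ * kk (s / ε ^ 2) := by
  rw [deriv_nne, deriv_comp_div (contDiff_deriv' nn_contDiff), kk]
  field_simp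

lemma nne'_bound : ∃ C, 0 < C ∧ ∀ ε, 0 < ε → ∀ s, 0 < s →
    |deriv (nne ε) s| ≤ C * s ^ (-(3/2) : ℝ) := by
  obtain ⟨C, hC, h⟩ := nn'_bound
  refine ⟨C, hC, fun ε hε s hs => ?_⟩
  rw [deriv_nne, abs_mul, abs_of_pos (by positivity)]
  calc _ ≤ ε⁻¹ * (ε ^ 2)⁻¹ * (C * (s / ε ^ 2) ^ (-(3/2) : ℝ)) := by
        gcongr; exact h _ (by positivity)
    _ = _ := by
      rw [Real.div_rpow hs.le (by positivity), ← Real.rpow_natCast ε 2, ← Real.rpow_mul hε.le]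
      have : ε ^ (((2:ℕ):ℝ) * -(3/2)) = (ε ^ 3)⁻¹ := by
        rw [← Real.rpow_natCast ε 3, ← Real.rpow_neg hε.le]; norm_num
      rw [this]; simp only [Real.rpow_natCast]; field_simp
end

section
def kap (ε : ℝ) (z : E3) : ℝ := (ε ^ 3)⁻¹ * kk (‖z‖ ^ 2 / ε ^ 2)

lemma kap_contDiff (ε : ℝ) : ContDiff ℝ smo (kap ε) :=
  contDiff_const.mul (kk_contDiff.comp ((contDiff_id.norm_sq ℝ).div_const _))

lemma kap_zero {ε : ℝ} (hε : 0 < ε) {z : E3} (h : ε ≤ ‖z‖) : kap ε z = 0 := by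
  rw [kap, kk_zero, mul_zero]
  rw [le_div_iff₀ (by positivity), one_mul]
  gcongr

lemma kap_bound : ∃ C, 0 < C ∧ ∀ ε, 0 < ε → ∀ z, |kap ε z| ≤ C * (ε ^ 3)⁻¹ := by
  obtain ⟨C, hC, h⟩ := bdd_of_zero kk_contDiff.continuous (fun s => kk_zero)
  refine ⟨C, hC, fun ε hε z => ?_⟩
  rw [kap, abs_mul, abs_of_pos (by positivity), mul_comm]
  gcongr
  exact h _ (by positivity)

lemma kap_compact {ε : ℝ} (hε : 0 < ε) : HasCompactSupport (kap ε) := by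
  refine HasCompactSupport.intro (isCompact_closedBall (0:E3) ε) fun z hz => ?_
  apply kap_zero hε
  simp at hz
  exact hz.le

lemma kap_integrable {ε : ℝ} (hε : 0 < ε) (x : E3) : Integrable (fun y => kap ε (y - x)) :=
  ((kap_contDiff ε).continuous.integrable_of_hasCompactSupport (kap_compact hε)).comp_sub_right x

lemma kap_integral {ε : ℝ} (hε : 0 < ε) (x : E3) : ∫ y, kap ε (y - x) = m0 := by
  rw [integral_sub_right_eq_self (kap ε) x]
  have h := Measure.integral_comp_inv_smul_of_nonneg (volume : Measure E3)
    (fun z => kk (‖z‖ ^ 2)) hε.le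
  simp only [norm_smul, norm_inv, Real.norm_eq_abs, mul_pow, inv_pow, sq_abs,
    finrank_euclideanSpace, Fintype.card_fin] at h
  rw [m0]
  have h2 : ∀ z : E3, kap ε z = (ε^3)⁻¹ * kk ((ε ^ 2)⁻¹ * ‖z‖ ^ 2) := fun z => by
    rw [kap]; congr 2; ring
  simp_rw [h2]
  rw [integral_const_mul, h, smul_eq_mul, ← mul_assoc, inv_mul_cancel₀ (by positivity), one_mul]

lemma kap_mul_integrable {ε : ℝ} (hε : 0 < ε) (x : E3) {f : E3 → ℝ} (hf : Integrable f) :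
    Integrable (fun y => kap ε (y - x) * f y) := by
  obtain ⟨C, hC, h⟩ := kap_bound
  exact hf.bdd_mul (c := C * (ε ^ 3)⁻¹)
    ((kap_contDiff ε).continuous.comp (continuous_id.sub continuous_const)).aestronglyMeasurable
    (Eventually.of_forall fun y => h ε hε _)

lemma kap_tendsto {f : E3 → ℝ} (hf : Integrable f) : ∀ᵐ x,
    Tendsto (fun ε => ∫ y, kap ε (y - x) * f y) (nhdsWithin 0 (Ioi 0)) (nhds (m0 * f x)) := by
  obtain ⟨C, hC, h⟩ := kap_bound
  filter_upwards [IsUnifLocDoublingMeasure.ae_tendsto_average_norm_sub volume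
    hf.locallyIntegrable 1] with x hx
  have hx := hx (fun _ : ℝ => x) (fun ε => ε) tendsto_id (by
    filter_upwards [self_mem_nhdsWithin] with ε hε
    exact mem_closedBall_self (by simpa using (le_of_lt hε)))
  rw [tendsto_iff_norm_sub_tendsto_zero]
  have h3 := hx.const_mul (C * volume.real (closedBall (0:E3) 1))
  rw [mul_zero] at h3
  refine squeeze_zero' (Eventually.of_forall fun _ => norm_nonneg _) ?_ h3
  filter_upwards [self_mem_nhdsWithin] with ε (hε : 0 < ε)
  have e1 : (∫ y, kap ε (y - x) * f y) - m0 * f x = ∫ y, kap ε (y - x) * (f y - f x) := by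
    rw [← kap_integral hε x, ← integral_mul_const, ← integral_sub (kap_mul_integrable hε x hf)
      ((kap_integrable hε x).mul_const _)]
    congr 1; funext y; ring
  have e2 : ∫ y, kap ε (y - x) * (f y - f x) =
      ∫ y in closedBall x ε, kap ε (y - x) * (f y - f x) := by
    symm; apply setIntegral_eq_integral_of_forall_compl_eq_zero
    intro y hy
    rw [kap_zero hε, zero_mul]
    rw [mem_closedBall, dist_eq_norm] at hy
    exact (not_le.1 hy).le
  have hv : volume.real (closedBall x ε) = ε ^ 3 * volume.real (closedBall (0:E3) 1) := by
    rw [Measure.addHaar_real_closedBall _ _ hε.le, Measure.addHaar_real_closedBall _ _ zero_le_one]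
    simp
  rw [e1, e2]
  calc _ ≤ ∫ y in closedBall x ε, ‖kap ε (y - x) * (f y - f x)‖ :=
        norm_integral_le_integral_norm _
    _ ≤ ∫ y in closedBall x ε, (C * (ε ^ 3)⁻¹) * ‖f y - f x‖ := by
        apply integral_mono_of_nonneg (Eventually.of_forall fun _ => norm_nonneg _)
        · apply Integrable.const_mul
          apply Integrable.norm
          exact hf.integrableOn.sub (integrableOn_const measure_closedBall_lt_top.ne)
        · exact Eventually.of_forall fun y => by
            simp only [norm_mul]
            gcongr
            exact h ε hε _
    _ = _ := by
        rw [integral_const_mul, setAverage_eq, hv, smul_eq_mul]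
        have : 0 < volume.real (closedBall (0:E3) 1) :=
          toReal_pos (measure_closedBall_pos volume (0:E3) one_pos).ne'
            measure_closedBall_lt_top.ne
        field_simp

/-- Newtonian-type kernel -/
def Kr (z : E3) : ℝ≥0∞ := oR ((‖z‖ ^ 2)⁻¹)

lemma measurable_Kr : Measurable Kr := by unfold Kr; fun_prop

lemma repr_bound : ∃ C : ℝ, 0 < C ∧ ∀ (x0 : E3) (R : ℝ), 0 < R → ∀ (f : E3 → ℝ)
    (F : E3 → Fin 3 → ℝ), Integrable f → (∀ i, Integrable (fun y => F y i)) →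
    (∀ ψ : E3 → ℝ, ContDiff ℝ smo ψ → HasCompactSupport ψ →
      tsupport ψ ⊆ ball x0 R →
      ∫ y, f y * ∑ i, pd i (pd i ψ) y = ∫ y, ∑ i, F y i * pd i ψ y) →
    ∀ᵐ x, x ∈ ball x0 (R / 2) →
      ‖f x - m0⁻¹ * ∫ y, kap (R / 2) (y - x) * f y‖ₑ ≤
        oR C * ∫⁻ y, Kr (y - x) * ∑ i, ‖F y i‖ₑ := by
  obtain ⟨C, hC, hn⟩ := nne'_bound
  refine ⟨|m0|⁻¹ * (4 * C), mul_pos (inv_pos.2 (abs_pos.2 m0_ne)) (by positivity),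
    fun x0 R hR f F hf hF h => ?_⟩
  filter_upwards [kap_tendsto hf] with x hx hxB
  set J := ∫⁻ y, Kr (y - x) * ∑ i, ‖F y i‖ₑ with hJ
  have hρ : 0 < R / 2 := by positivity
  have hsub : closedBall x (R / 2) ⊆ ball x0 R := by
    intro y hy
    rw [mem_ball] at hxB ⊢
    rw [mem_closedBall] at hy
    linarith [dist_triangle y x x0]
  have key : ∀ ε, 0 < ε → ε < R / 2 →
      ‖(∫ y, kap ε (y - x) * f y) - ∫ y, kap (R / 2) (y - x) * f y‖ₑ ≤ oR (4 * C) * J := by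
    intro ε hε hεR
    let g : ℝ → ℝ := fun s => nne ε s - nne (R / 2) s
    have hg : ContDiff ℝ smo g := (nne_contDiff ε).sub (nne_contDiff _)
    have hdg : deriv g = fun s => deriv (nne ε) s - deriv (nne (R / 2)) s := by
      funext s
      exact ((hasDerivAt_of_smooth (nne_contDiff ε) s).sub
        (hasDerivAt_of_smooth (nne_contDiff _) s)).deriv
    have hddg : deriv (deriv g) = fun s => deriv (deriv (nne ε)) s - deriv (deriv (nne (R / 2))) s := by
      rw [hdg]
      funext s
      exact ((hasDerivAt_of_smooth (contDiff_deriv' (nne_contDiff ε)) s).sub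
        (hasDerivAt_of_smooth (contDiff_deriv' (nne_contDiff _)) s)).deriv
    have hsupp : ∀ y, y ∉ closedBall x (R / 2) → g (‖y - x‖ ^ 2) = 0 := by
      intro y hy
      rw [mem_closedBall, dist_eq_norm, not_le] at hy
      have h1 : (R / 2) ^ 2 ≤ ‖y - x‖ ^ 2 := by gcongr
      have h2 : ε ^ 2 ≤ ‖y - x‖ ^ 2 := by gcongr; linarith
      simp only [g]
      rw [nne_eq hε h2, nne_eq hρ h1, sub_self]
    have hts : tsupport (fun y : E3 => g (‖y - x‖ ^ 2)) ⊆ closedBall x (R / 2) := by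
      apply closure_minimal _ isClosed_closedBall
      intro y hy
      by_contra hh
      exact hy (hsupp y hh)
    have h1 := h (fun y => g (‖y - x‖ ^ 2)) (contDiff_radial hg x)
      (HasCompactSupport.intro (isCompact_closedBall x (R / 2)) hsupp) (hts.trans hsub)
    have h2 : ∫ y, f y * ∑ i, pd i (pd i (fun y => g (‖y - x‖ ^ 2))) y =
        (∫ y, kap ε (y - x) * f y) - ∫ y, kap (R / 2) (y - x) * f y := by
      rw [← integral_sub (kap_mul_integrable hε x hf) (kap_mul_integrable hρ x hf)]
      congr 1; funext y
      rw [lap_radial hg, hddg, hdg, kap, kap, ← lap_nne hε, ← lap_nne hρ]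
      ring
    rw [← h2, h1]
    refine (enorm_integral_le_lintegral_enorm _).trans ?_
    rw [hJ, ← lintegral_const_mul' _ _ ofReal_ne_top]
    apply lintegral_mono
    intro y
    simp only
    have hpd : ∀ i, ‖pd i (fun y => g (‖y - x‖ ^ 2)) y‖ₑ ≤ oR (4 * C) * Kr (y - x) := by
      intro i
      rw [pd_radial hg, hdg, Kr, ← ofReal_mul (by positivity), Real.enorm_eq_ofReal_abs]
      apply ofReal_le_ofReal
      by_cases hy : y = x
      · simp [hy]
      have hpos : 0 < ‖y - x‖ := norm_pos_iff.2 (sub_ne_zero.2 hy)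
      have hs : 0 < ‖y - x‖ ^ 2 := by positivity
      have b1 := hn ε hε _ hs
      have b2 := hn (R / 2) hρ _ hs
      have b3 : |(y - x) i| ≤ ‖y - x‖ := by
        have := EuclideanSpace.norm_eq (y - x)
        rw [this]
        apply Real.le_sqrt_of_sq_le
        have := Finset.single_le_sum (f := fun j => ‖(y - x) j‖ ^ 2) (fun j _ => by positivity)
          (Finset.mem_univ i)
        simpa using this
      have e : (‖y - x‖ ^ 2) ^ (-(3/2) : ℝ) = (‖y - x‖ ^ 3)⁻¹ := by
        rw [← Real.rpow_natCast, ← Real.rpow_mul hpos.le, ← Real.rpow_natCast,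
          ← Real.rpow_neg hpos.le]
        norm_num
      rw [e] at b1 b2
      rw [abs_mul, abs_mul, abs_two]
      calc _ ≤ 2 * ‖y - x‖ * (C * (‖y - x‖ ^ 3)⁻¹ + C * (‖y - x‖ ^ 3)⁻¹) := by
            gcongr
            exact (abs_sub _ _).trans (add_le_add b1 b2)
        _ = _ := by field_simp; ring
    calc _ ≤ ∑ i, ‖F y i * pd i (fun y => g (‖y - x‖ ^ 2)) y‖ₑ := enorm_sum_le _ _
      _ ≤ ∑ i, (oR (4 * C) * Kr (y - x)) * ‖F y i‖ₑ := by
          apply Finset.sum_le_sum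
          intro i _
          rw [enorm_mul, mul_comm]
          gcongr
          exact hpd i
      _ = _ := by rw [← Finset.mul_sum, mul_assoc]
  have hlim : ‖m0 * f x - ∫ y, kap (R / 2) (y - x) * f y‖ₑ ≤ oR (4 * C) * J := by
    have ht : Tendsto (fun ε => ‖(∫ y, kap ε (y - x) * f y) - ∫ y, kap (R / 2) (y - x) * f y‖ₑ)
      (nhdsWithin 0 (Ioi 0)) (nhds (‖m0 * f x - ∫ y, kap (R / 2) (y - x) * f y‖ₑ)) :=
      (hx.sub_const _).enorm
    refine le_of_tendsto ht ?_
    filter_upwards [self_mem_nhdsWithin, nhdsWithin_le_nhds (gt_mem_nhds hρ)] with ε h1 h2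
      using key ε h1 h2
  have e : f x - m0⁻¹ * ∫ y, kap (R / 2) (y - x) * f y =
      m0⁻¹ * (m0 * f x - ∫ y, kap (R / 2) (y - x) * f y) := by
    rw [mul_sub, ← mul_assoc, inv_mul_cancel₀ m0_ne, one_mul]
  rw [e, enorm_mul, ofReal_mul (inv_nonneg.2 (abs_nonneg _)), mul_assoc,
    Real.enorm_eq_ofReal_abs, abs_inv]
  gcongr
end

section
lemma young {K F : E3 → ℝ≥0∞} (hK : Measurable K) (hF : Measurable F) {p q k : ℝ}
    (hp : 1 ≤ p) (hpq : p ≤ q) (hk : 0 < k) (hr : 1 / p + 1 / k = 1 + 1 / q) :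
    ∫⁻ x, (∫⁻ y, K (y - x) * F y) ^ q ≤ (∫⁻ z, K z ^ k) ^ (q / k) * (∫⁻ y, F y ^ p) ^ (q / p) := by
  have hp0 : 0 < p := by linarith
  have hq0 : 0 < q := by linarith
  have ek : k * (1 / q + (1 - 1 / p)) = 1 := by
    have : 1 / q + (1 - 1 / p) = 1 / k := by linarith
    rw [this]; field_simp
  have t2 : 0 ≤ 1 - 1 / p := by rw [sub_nonneg, div_le_one hp0]; exact hp
  have t3 : 0 ≤ 1 / p - 1 / q := by rw [sub_nonneg]; exact one_div_le_one_div_of_le hp0 hpq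
  have t1 : 0 ≤ 1 / q := by positivity
  have hKx : ∀ x : E3, Measurable fun y => K (y - x) := fun x =>
    hK.comp (measurable_id.sub measurable_const)
  have hpt : ∀ x : E3, (∫⁻ y, K (y - x) * F y) ^ q ≤ (∫⁻ y, K (y - x) ^ k * F y ^ p) *
      ((∫⁻ z, K z ^ k) ^ (q * (1 - 1 / p)) * (∫⁻ y, F y ^ p) ^ (q * (1 / p - 1 / q))) := by
    intro x
    have h := lintegral_prod_norm_pow_le (μ := (volume : Measure E3))
      (Finset.univ : Finset (Fin 3))
      (f := ![fun y => K (y - x) ^ k * F y ^ p, fun y => K (y - x) ^ k, fun y => F y ^ p])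
      (p := ![1 / q, 1 - 1 / p, 1 / p - 1 / q])
      (by
        intro i _
        fin_cases i
        · exact (((hKx x).pow_const k).mul (hF.pow_const p)).aemeasurable
        · exact ((hKx x).pow_const k).aemeasurable
        · exact (hF.pow_const p).aemeasurable) (by simp [Fin.sum_univ_three]; ring) (by
          intro i _; fin_cases i; exacts [t1, t2, t3])
    simp only [Fin.prod_univ_three, Matrix.cons_val_zero, Matrix.cons_val_one,
      Matrix.cons_val] at h
    have e1 : ∀ y, (K (y - x) ^ k * F y ^ p) ^ (1 / q) * (K (y - x) ^ k) ^ (1 - 1 / p) *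
        (F y ^ p) ^ (1 / p - 1 / q) = K (y - x) * F y := by
      intro y
      rw [mul_rpow_of_nonneg _ _ t1]
      simp only [← rpow_mul]
      calc _ = (K (y - x) ^ (k * (1 / q)) * K (y - x) ^ (k * (1 - 1 / p))) *
            (F y ^ (p * (1 / q)) * F y ^ (p * (1 / p - 1 / q))) := by ring
        _ = _ := by
          rw [← rpow_add_of_nonneg _ _ (by positivity) (by positivity),
            ← rpow_add_of_nonneg _ _ (by positivity) (by positivity), ← mul_add, ek,
            ← mul_add]
          have : p * (1 / q + (1 / p - 1 / q)) = 1 := by field_simp; ring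
          rw [this]; simp
    simp_rw [e1] at h
    have e2 : ∫⁻ y, K (y - x) ^ k = ∫⁻ z, K z ^ k := lintegral_sub_right_eq_self (fun z => K z ^ k) x
    rw [e2] at h
    calc _ ≤ _ := rpow_le_rpow h hq0.le
      _ = _ := by
        rw [mul_rpow_of_nonneg _ _ hq0.le, mul_rpow_of_nonneg _ _ hq0.le,
          ← rpow_mul, ← rpow_mul, ← rpow_mul]
        have : 1 / q * q = 1 := by field_simp
        rw [this, rpow_one, mul_assoc, mul_comm _ q, mul_comm _ q]
  have hm : Measurable (fun w : E3 × E3 => K (w.2 - w.1) ^ k * F w.2 ^ p) :=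
    ((hK.comp (measurable_snd.sub measurable_fst)).pow_const k).mul
      ((hF.comp measurable_snd).pow_const p)
  calc _ ≤ ∫⁻ x, (∫⁻ y, K (y - x) ^ k * F y ^ p) *
      ((∫⁻ z, K z ^ k) ^ (q * (1 - 1 / p)) * (∫⁻ y, F y ^ p) ^ (q * (1 / p - 1 / q))) :=
        lintegral_mono hpt
    _ = (∫⁻ x, ∫⁻ y, K (y - x) ^ k * F y ^ p) *
      ((∫⁻ z, K z ^ k) ^ (q * (1 - 1 / p)) * (∫⁻ y, F y ^ p) ^ (q * (1 / p - 1 / q))) := by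
        rw [lintegral_mul_const]
        exact hm.lintegral_prod_right'
    _ = ((∫⁻ z, K z ^ k) * ∫⁻ y, F y ^ p) *
      ((∫⁻ z, K z ^ k) ^ (q * (1 - 1 / p)) * (∫⁻ y, F y ^ p) ^ (q * (1 / p - 1 / q))) := by
        congr 1
        rw [lintegral_lintegral_swap hm.aemeasurable]
        have : ∀ y : E3, ∫⁻ x, K (y - x) ^ k * F y ^ p = (∫⁻ z, K z ^ k) * F y ^ p := by
          intro y
          rw [lintegral_mul_const _ ((show Measurable fun x => K (y - x) from
            hK.comp (measurable_const.sub measurable_id)).pow_const k)]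
          congr 1
          exact lintegral_sub_left_eq_self (fun z => K z ^ k) y
        simp_rw [this]
        rw [lintegral_const_mul _ (hF.pow_const p)]
    _ = ((∫⁻ z, K z ^ k) ^ (1 : ℝ) * (∫⁻ z, K z ^ k) ^ (q * (1 - 1 / p))) *
      ((∫⁻ y, F y ^ p) ^ (1 : ℝ) * (∫⁻ y, F y ^ p) ^ (q * (1 / p - 1 / q))) := by
        rw [rpow_one, rpow_one]; ring
    _ = _ := by
        rw [← rpow_add_of_nonneg _ _ zero_le_one (by positivity),
          ← rpow_add_of_nonneg _ _ zero_le_one (by positivity)]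
        congr 2
        · have : 1 - 1 / p = 1 / k - 1 / q := by linarith
          rw [this]; field_simp; ring
        · field_simp; ring

lemma kernel_int {k : ℝ} (hk2 : k < 3 / 2) : ∃ C : ℝ, 0 < C ∧ ∀ ρ : ℝ, 0 < ρ →
    ∫⁻ z in ball (0 : E3) ρ, Kr z ^ k = oR (C * ρ ^ (3 - 2 * k)) := by
  have hv : 0 < volume.real (ball (0:E3) 1) :=
    toReal_pos (measure_ball_pos volume (0:E3) one_pos).ne' measure_ball_lt_top.ne
  have hk3 : 0 < 3 - 2 * k := by linarith
  refine ⟨3 * volume.real (ball (0:E3) 1) * (3 - 2 * k)⁻¹, by positivity,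
    fun ρ hρ => ?_⟩
  let h : ℝ → ℝ := fun y => ((y ^ 2)⁻¹) ^ k
  have hh : ∀ y ∈ Ioo 0 ρ, y ^ (Module.finrank ℝ E3 - 1) • h y = y ^ (2 - 2 * k) := by
    intro y hy
    have hy0 : 0 < y := hy.1
    simp only [h, finrank_euclideanSpace, Fintype.card_fin, smul_eq_mul]
    rw [Real.inv_rpow (by positivity), ← Real.rpow_natCast,
      ← Real.rpow_mul hy0.le, ← Real.rpow_neg hy0.le, ← Real.rpow_add hy0]
    congr 1
  have hii : IntegrableOn (fun y : ℝ => y ^ (2 - 2 * k)) (Ioo 0 ρ) := by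
    have := (intervalIntegral.intervalIntegrable_rpow' (a := 0) (b := ρ)
      (r := 2 - 2 * k) (by linarith))
    rw [intervalIntegrable_iff_integrableOn_Ioo_of_le hρ.le] at this
    exact this
  have hint : IntegrableOn (fun z : E3 => h ‖z‖) (ball (0 : E3) ρ) := by
    rw [integrableOn_fun_norm_addHaar]
    exact hii.congr_fun (fun y hy => (hh y hy).symm) measurableSet_Ioo
  have hval : ∫ z in ball (0 : E3) ρ, h ‖z‖ =
      3 * volume.real (ball (0:E3) 1) * (3 - 2 * k)⁻¹ * ρ ^ (3 - 2 * k) := by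
    have e1 : ∫ z in ball (0 : E3) ρ, h ‖z‖ = ∫ z : E3, (Iio ρ).indicator h ‖z‖ := by
      rw [← integral_indicator measurableSet_ball]
      congr 1; funext z; simp [indicator]
    rw [e1, integral_fun_norm_addHaar]
    have e2 : ∫ y in Ioi (0:ℝ), y ^ (Module.finrank ℝ E3 - 1) • (Iio ρ).indicator h y =
        ∫ y in Ioo 0 ρ, y ^ (2 - 2 * k) := by
      rw [← setIntegral_congr_fun measurableSet_Ioo (fun y hy => hh y hy)]
      have : Ioo 0 ρ = Ioi 0 ∩ Iio ρ := rfl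
      rw [this, ← setIntegral_indicator measurableSet_Iio]
      congr 1; funext y; simp only [indicator]; split_ifs <;> simp
    rw [e2, ← integral_Ioc_eq_integral_Ioo, ← intervalIntegral.integral_of_le hρ.le,
      integral_rpow (Or.inl (by linarith))]
    have : 2 - 2 * k + 1 = 3 - 2 * k := by ring
    rw [this, Real.zero_rpow hk3.ne']
    simp; ring
  rw [← hval, ofReal_integral_eq_lintegral_ofReal hint (Eventually.of_forall fun z => by
    simp only [h, Pi.zero_apply]; positivity)]
  apply setLIntegral_congr_fun_ae measurableSet_ball
  have : ∀ᵐ z : E3, z ≠ 0 := by simp [ae_iff]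
  filter_upwards [this] with z hz _
  rw [Kr, ofReal_rpow_of_pos (by have := norm_pos_iff.2 hz; positivity)]

lemma pot_bound {p q k : ℝ} (hp : 1 ≤ p) (hpq : p ≤ q) (hk : 0 < k) (hk2 : k < 3 / 2)
    (hr : 1 / p + 1 / k = 1 + 1 / q) : ∃ C : ℝ, 0 < C ∧ ∀ (x0 : E3) (R : ℝ), 0 < R →
    ∀ F : E3 → ℝ≥0∞, Measurable F →
    ∫⁻ x in ball x0 R, (∫⁻ y in ball x0 R, Kr (y - x) * F y) ^ q ≤
      oR (C * R ^ ((3 - 2 * k) * (q / k))) *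
        (∫⁻ y in ball x0 R, F y ^ p) ^ (q / p) := by
  obtain ⟨C, hC, hker⟩ := kernel_int hk2
  have hp0 : 0 < p := by linarith
  have hq0 : 0 < q := by linarith
  refine ⟨(C * 2 ^ (3 - 2 * k)) ^ (q / k), by positivity, fun x0 R hR F hF => ?_⟩
  have hy := young (K := (ball 0 (2 * R)).indicator Kr) (F := (ball x0 R).indicator F)
    (measurable_Kr.indicator measurableSet_ball) (hF.indicator measurableSet_ball) hp hpq hk hr
  have e1 : ∫⁻ z, ((ball 0 (2 * R)).indicator Kr z) ^ k =
      oR (C * (2 * R) ^ (3 - 2 * k)) := by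
    rw [← hker (2 * R) (by positivity), ← lintegral_indicator measurableSet_ball]
    congr 1; funext z; simp only [indicator]; split_ifs <;> simp [hk]
  have e2 : ∫⁻ z, ((ball x0 R).indicator F z) ^ p = ∫⁻ y in ball x0 R, F y ^ p := by
    rw [← lintegral_indicator measurableSet_ball]
    congr 1; funext z; simp only [indicator]; split_ifs <;> simp [hp0]
  rw [e1, e2, ofReal_rpow_of_nonneg (by positivity) (by positivity)] at hy
  have e3 : (C * (2 * R) ^ (3 - 2 * k)) ^ (q / k) =
      (C * 2 ^ (3 - 2 * k)) ^ (q / k) * R ^ ((3 - 2 * k) * (q / k)) := by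
    rw [Real.mul_rpow (by norm_num) hR.le, ← mul_assoc, Real.mul_rpow (by positivity) (by positivity),
      ← Real.rpow_mul hR.le]
  rw [e3] at hy
  refine le_trans ?_ hy
  rw [← lintegral_indicator measurableSet_ball]
  apply lintegral_mono
  intro x
  simp only [indicator]
  split_ifs with hx
  · apply rpow_le_rpow _ hq0.le
    rw [← lintegral_indicator measurableSet_ball]
    apply lintegral_mono
    intro y
    simp only [indicator]
    split_ifs with h1 h2
    · exact le_rfl
    · exfalso; apply h2
      rw [mem_ball] at *
      rw [dist_zero_right, ← dist_eq_norm]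
      linarith [dist_triangle_right y x x0]
    · exact zero_le
    · exact zero_le
  · exact zero_le
end

section
lemma kap_even (ε : ℝ) (z : E3) : kap ε (-z) = kap ε z := by simp [kap]

lemma kap_sub_comm (ε : ℝ) (x y : E3) : kap ε (x - y) = kap ε (y - x) := by
  rw [← kap_even, neg_sub]

lemma pd_kap (ε : ℝ) (i : Fin 3) (x : E3) : pd i (fun y => kap ε (y - x)) = fun y =>
    2 * (y - x) i * deriv (fun s => (ε ^ 3)⁻¹ * kk (s / ε ^ 2)) (‖y - x‖ ^ 2) :=
  pd_radial (h := fun s => (ε ^ 3)⁻¹ * kk (s / ε ^ 2))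
    (contDiff_const.mul (kk_contDiff.comp (contDiff_id.div_const _))) x i

lemma pd_kap_neg (ε : ℝ) (i : Fin 3) (x y : E3) :
    pd i (kap ε) (x - y) = - pd i (fun y => kap ε (y - x)) y := by
  have h := pd_kap ε i 0
  simp only [sub_zero] at h
  have h2 : pd i (kap ε) = _ := h
  rw [h2, pd_kap]
  simp only [PiLp.sub_apply]
  rw [norm_sub_rev x y]
  ring

lemma tsupport_kap_sub {ρ : ℝ} (hρ : 0 < ρ) (x : E3) :
    tsupport (fun y => kap ρ (y - x)) ⊆ closedBall x ρ := by
  apply closure_minimal _ isClosed_closedBall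
  intro y hy
  by_contra hh
  apply hy
  rw [mem_closedBall, dist_eq_norm, not_le] at hh
  exact kap_zero hρ hh.le

/-- Lipschitz bound of the mollification in terms of the weak gradient -/
lemma moll_lip : ∃ C : ℝ, 0 < C ∧ ∀ (x0 : E3) (R : ℝ), 0 < R → ∀ (f : E3 → ℝ)
    (F : E3 → Fin 3 → ℝ), Integrable f → (∀ i, Integrable (fun y => F y i)) →
    (∀ ψ : E3 → ℝ, ContDiff ℝ smo ψ → HasCompactSupport ψ →
      tsupport ψ ⊆ ball x0 R → ∀ i, ∫ y, f y * pd i ψ y = - ∫ y, F y i * ψ y) →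
    ∀ x ∈ ball x0 (R / 2),
      |(∫ y, kap (R / 2) (y - x) * f y) - ∫ y, kap (R / 2) (y - x0) * f y| ≤
        C * (R ^ 2)⁻¹ * ∑ i, ∫ y, |F y i| := by
  obtain ⟨C, hC, hk⟩ := kap_bound
  refine ⟨4 * C, by positivity, fun x0 R hR f F hf hF h x hx => ?_⟩
  have hρ : 0 < R / 2 := by positivity
  let L := ContinuousLinearMap.mul ℝ ℝ
  have hM : ∀ x, (∫ y, kap (R / 2) (y - x) * f y) = convolution f (kap (R/2)) L volume x := by
    intro x
    rw [convolution]
    congr 1; funext y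
    simp only [L, ContinuousLinearMap.mul_apply']
    rw [kap_sub_comm, mul_comm]
  have hk1 : ContDiff ℝ 1 (kap (R / 2)) := (kap_contDiff _).of_le (by exact_mod_cast le_top)
  have hD := (kap_compact hρ).hasFDerivAt_convolution_right L hf.locallyIntegrable hk1
  have hDi : ∀ x ∈ ball x0 (R / 2), ∀ i,
      |(convolution f (fderiv ℝ (kap (R/2))) (L.precompR E3) volume x) (EuclideanSpace.single i 1)|
        ≤ C * ((R / 2) ^ 3)⁻¹ * ∫ y, |F y i| := by
    intro x hx i
    rw [convolution_precompR_apply L hf.locallyIntegrable ((kap_compact hρ).fderiv ℝ)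
      (hk1.continuous_fderiv one_ne_zero), convolution]
    have e : ∀ y, (L (f y)) ((fderiv ℝ (kap (R / 2)) (x - y)) (EuclideanSpace.single i 1)) =
        -(f y * pd i (fun y => kap (R / 2) (y - x)) y) := by
      intro y
      have := pd_kap_neg (R / 2) i x y
      rw [pd] at this
      rw [this]
      simp [L]
    have hcs : HasCompactSupport (fun y => kap (R / 2) (y - x)) :=
      HasCompactSupport.of_support_subset_isCompact (isCompact_closedBall x (R / 2))
        ((subset_tsupport _).trans (tsupport_kap_sub hρ x))
    simp_rw [e]
    rw [integral_neg, h (fun y => kap (R / 2) (y - x)) ((kap_contDiff _).comp (contDiff_id.sub contDiff_const)) hcs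
      ((tsupport_kap_sub hρ x).trans (fun y hy => by
        rw [mem_ball] at hx ⊢
        rw [mem_closedBall] at hy
        linarith [dist_triangle y x x0])) i, neg_neg, ← integral_const_mul]
    refine (abs_integral_le_integral_abs).trans ?_
    apply integral_mono_of_nonneg (Eventually.of_forall fun _ => abs_nonneg _)
      ((hF i).abs.const_mul _)
    refine Eventually.of_forall fun y => ?_
    simp only [abs_mul]
    rw [mul_comm]
    gcongr
    exact hk _ hρ _
  have hDn : ∀ x ∈ ball x0 (R / 2),
      ‖convolution f (fderiv ℝ (kap (R/2))) (L.precompR E3) volume x‖ ≤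
        C * ((R / 2) ^ 3)⁻¹ * ∑ i, ∫ y, |F y i| := by
    intro x hx
    have hnn : ∀ i, 0 ≤ ∫ y, |F y i| := fun i => integral_nonneg fun _ => abs_nonneg _
    apply ContinuousLinearMap.opNorm_le_bound _ (mul_nonneg (by positivity)
      (Finset.sum_nonneg fun i _ => hnn i))
    intro w
    have hw : w = ∑ i, w i • (EuclideanSpace.single i (1:ℝ) : E3) := by
      ext j; simp [Pi.single_apply]
    conv_lhs => rw [hw]
    rw [map_sum, Finset.mul_sum, Finset.sum_mul]
    refine (norm_sum_le _ _).trans (Finset.sum_le_sum fun i _ => ?_)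
    rw [map_smul, norm_smul, mul_comm]
    have := hDi x hx i
    have b3 : ‖w i‖ ≤ ‖w‖ := PiLp.norm_apply_le w i
    exact mul_le_mul this b3 (norm_nonneg _) (mul_nonneg (by positivity) (hnn i))
  have := (convex_ball x0 (R / 2)).norm_image_sub_le_of_norm_hasFDerivWithin_le
    (fun x _ => (hD x).hasFDerivWithinAt) hDn (mem_ball_self hρ) hx
  rw [hM, hM]
  refine (this.trans (mul_le_mul_of_nonneg_left (show ‖x - x0‖ ≤ R / 2 from ?_) ?_)).trans
    (le_of_eq ?_)
  · rw [← dist_eq_norm]; exact (mem_ball.1 hx).le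
  · exact mul_nonneg (by positivity) (Finset.sum_nonneg fun i _ =>
      integral_nonneg fun _ => abs_nonneg _)
  · field_simp; ring

lemma Kr_lower {x0 x y : E3} {R : ℝ} (hR : 0 < R) (hx : x ∈ ball x0 R)
    (hy : y ∈ ball x0 R) (hne : y ≠ x) : oR ((4 * R ^ 2)⁻¹) ≤ Kr (y - x) := by
  apply ofReal_le_ofReal
  have h1 : ‖y - x‖ ≤ 2 * R := by
    rw [mem_ball] at hx hy
    rw [← dist_eq_norm]
    linarith [dist_triangle_right y x x0]
  have h2 : 0 < ‖y - x‖ := norm_pos_iff.2 (sub_ne_zero.2 hne)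
  apply inv_anti₀ (by positivity)
  calc ‖y - x‖ ^ 2 ≤ (2 * R) ^ 2 := by gcongr
    _ = _ := by ring

/-- oscillation from the mean, scalar version -/
lemma osc : ∃ C : ℝ, 0 < C ∧ ∀ (x0 : E3) (R : ℝ), 0 < R → ∀ (f : E3 → ℝ)
    (F : E3 → Fin 3 → ℝ), Integrable f → (∀ i, Integrable (fun y => F y i)) →
    (∀ y, y ∉ ball x0 R → ∀ i, F y i = 0) →
    (∀ ψ : E3 → ℝ, ContDiff ℝ smo ψ → HasCompactSupport ψ →
      tsupport ψ ⊆ ball x0 R → ∀ i, ∫ y, f y * pd i ψ y = - ∫ y, F y i * ψ y) →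
    ∀ᵐ x, x ∈ ball x0 (R / 2) →
      ‖f x - m0⁻¹ * ∫ y, kap (R / 2) (y - x0) * f y‖ₑ ≤
        oR C * ∫⁻ y in ball x0 R, Kr (y - x) * ∑ i, ‖F y i‖ₑ := by
  obtain ⟨C1, hC1, h1⟩ := repr_bound
  obtain ⟨C2, hC2, h2⟩ := moll_lip
  refine ⟨C1 + |m0|⁻¹ * C2 * 4, by positivity, fun x0 R hR f F hf hF hF0 h => ?_⟩
  have hlap : ∀ ψ : E3 → ℝ, ContDiff ℝ smo ψ → HasCompactSupport ψ →
      tsupport ψ ⊆ ball x0 R →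
      ∫ y, f y * ∑ i, pd i (pd i ψ) y = ∫ y, ∑ i, (-F y i) * pd i ψ y := by
    intro ψ hψ hc hs
    have hcp : ∀ i, HasCompactSupport (pd i ψ) := fun i => hc.fderiv_apply ℝ _
    have bd : ∀ g : E3 → ℝ, Continuous g → HasCompactSupport g → ∀ q : E3 → ℝ, Integrable q →
        Integrable (fun y => q y * g y) := by
      intro g hg hgc q hq
      obtain ⟨c, hc⟩ := hgc.exists_bound_of_continuous hg
      exact hq.mul_bdd (c := c) hg.aestronglyMeasurable (Eventually.of_forall hc)
    simp_rw [Finset.mul_sum]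
    rw [integral_finsetSum _ (fun i _ => bd _ (contDiff_pd (contDiff_pd hψ)).continuous
        ((hcp i).fderiv_apply ℝ _) _ hf),
      integral_finsetSum _ (fun i _ => by
        simpa using (bd _ (contDiff_pd hψ).continuous (hcp i) _ (hF i)).neg)]
    refine Finset.sum_congr rfl fun i _ => ?_
    rw [h (pd i ψ) (contDiff_pd hψ) (hcp i) (((tsupport_fderiv_apply_subset ℝ _)).trans hs) i,
      ← integral_neg]
    simp
  filter_upwards [h1 x0 R hR f (fun y i => -F y i) hf (fun i => (hF i).neg) hlap] with x hx hxB
  have hx1 := hx hxB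
  have hx2 := h2 x0 R hR f F hf hF h x hxB
  have hJ : ∫⁻ y, Kr (y - x) * ∑ i, ‖-F y i‖ₑ =
      ∫⁻ y in ball x0 R, Kr (y - x) * ∑ i, ‖F y i‖ₑ := by
    simp_rw [enorm_neg]
    symm
    apply setLIntegral_eq_of_support_subset
    intro y hy
    by_contra hh
    apply hy
    simp [hF0 y hh]
  rw [hJ] at hx1
  set J := ∫⁻ y in ball x0 R, Kr (y - x) * ∑ i, ‖F y i‖ₑ
  have hJ2 : oR ((4 * R ^ 2)⁻¹ * ∑ i, ∫ y, |F y i|) ≤ J := by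
    rw [ofReal_mul (by positivity), ofReal_sum_of_nonneg
      (fun i _ => integral_nonneg fun _ => abs_nonneg _)]
    have e : ∀ i, oR (∫ y, |F y i|) = ∫⁻ y, ‖F y i‖ₑ := fun i =>
      ofReal_integral_norm_eq_lintegral_enorm (hF i)
    simp_rw [e]
    rw [← lintegral_finsetSum' _ (fun i _ => (hF i).aestronglyMeasurable.enorm)]
    have : ∫⁻ y, ∑ i, ‖F y i‖ₑ = ∫⁻ y in ball x0 R, ∑ i, ‖F y i‖ₑ := by
      symm
      apply setLIntegral_eq_of_support_subset
      intro y hy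
      by_contra hh
      apply hy
      simp [hF0 y hh]
    rw [this, ← lintegral_const_mul' _ _ ofReal_ne_top]
    apply setLIntegral_mono_ae' measurableSet_ball
    have : ∀ᵐ z : E3, z ≠ x := by simp [ae_iff]
    filter_upwards [this] with y hne hy
    gcongr
    exact Kr_lower hR (ball_subset_ball (by linarith) hxB) hy hne
  calc _ = ‖(f x - m0⁻¹ * ∫ y, kap (R / 2) (y - x) * f y) + m0⁻¹ * ((∫ y, kap (R / 2) (y - x) * f y) -
        ∫ y, kap (R / 2) (y - x0) * f y)‖ₑ := by congr 1; ring
    _ ≤ _ := enorm_add_le _ _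
    _ ≤ oR C1 * J + oR (|m0|⁻¹ * C2 * 4) * J := by
      gcongr
      rw [enorm_mul, Real.enorm_eq_ofReal_abs, Real.enorm_eq_ofReal_abs]
      calc _ ≤ oR |m0⁻¹| * oR (C2 * (R ^ 2)⁻¹ * ∑ i, ∫ y, |F y i|) := by
            gcongr
        _ = oR (|m0|⁻¹ * C2 * 4) *
              oR ((4 * R ^ 2)⁻¹ * ∑ i, ∫ y, |F y i|) := by
            rw [← ofReal_mul (abs_nonneg _), ← ofReal_mul (by positivity), abs_inv]
            congr 1; field_simp
        _ ≤ _ := by gcongr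
    _ = _ := by rw [← add_mul, ← ofReal_add (by positivity) (by positivity)]
end

section
/-- squared Frobenius norm of a matrix -/
def gn (G : Fin 3 → Fin 3 → ℝ) : ℝ≥0∞ := oR (∑ i, ∑ j, (G i j) ^ 2)

lemma measurable_gn : Measurable gn := by
  unfold gn
  fun_prop

lemma enorm_le_gn (G : Fin 3 → Fin 3 → ℝ) (i j : Fin 3) : ‖G i j‖ₑ ≤ gn G ^ hlf := by
  have h1 : (G i j) ^ 2 ≤ ∑ i, ∑ j, (G i j) ^ 2 := by
    refine le_trans ?_ (Finset.single_le_sum (f := fun i => ∑ j, (G i j) ^ 2)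
      (fun i _ => by positivity) (Finset.mem_univ i))
    exact Finset.single_le_sum (f := fun j => (G i j) ^ 2)
      (fun i _ => by positivity) (Finset.mem_univ j)
  rw [gn, ofReal_rpow_of_nonneg (by positivity) (by norm_num), ← ofReal_norm]
  apply ofReal_le_ofReal
  rw [← Real.sqrt_eq_rpow, Real.norm_eq_abs]
  exact Real.abs_le_sqrt h1

lemma gn_rpow (G : Fin 3 → Fin 3 → ℝ) : (gn G ^ hlf) ^ (2 : ℝ) = gn G := by
  rw [← rpow_mul]; norm_num

lemma vol_ball' : ∃ C : ℝ, 0 < C ∧ ∀ (x : E3) (R : ℝ), 0 < R →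
    volume (ball x R) = oR (C * R ^ 3) := by
  refine ⟨Real.pi * 4 / 3, by positivity, fun x R hR => ?_⟩
  rw [EuclideanSpace.volume_ball_fin_three, ← ofReal_pow hR.le,
    ← ofReal_mul (by positivity), mul_comm]

lemma l1_le_l2 {X : Type*} [MeasurableSpace X] (μ : Measure X) {f : X → ℝ≥0∞} (hf : AEMeasurable f μ) :
    ∫⁻ x, f x ∂μ ≤ (∫⁻ x, f x ^ 2 ∂μ) ^ hlf * (μ univ) ^ hlf := by
  have h := lintegral_mul_le_Lp_mul_Lq μ Real.HolderConjugate.two_two hf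
    (aemeasurable_const (b := (1:ℝ≥0∞)))
  simpa using h

lemma hold2 {X : Type*} [MeasurableSpace X] (μ : Measure X) {f g : X → ℝ≥0∞} (hf : AEMeasurable f μ)
    (hg : AEMeasurable g μ) :
    ∫⁻ x, f x * g x ∂μ ≤ (∫⁻ x, f x ^ 2 ∂μ) ^ hlf * (∫⁻ x, g x ^ 2 ∂μ) ^ hlf := by
  have h := lintegral_mul_le_Lp_mul_Lq μ Real.HolderConjugate.two_two hf hg
  simpa using h

lemma sqrt_ofReal_sq {a : ℝ} (ha : 0 ≤ a) : oR (a ^ 2) ^ hlf = oR a := by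
  rw [ofReal_rpow_of_nonneg (by positivity) (by norm_num), ← Real.sqrt_eq_rpow,
    Real.sqrt_sq ha]

lemma enorm_le_sum (w : E3) : ‖w‖ₑ ≤ ∑ j, ‖w j‖ₑ := by
  have h : w = ∑ j, w j • (EuclideanSpace.single j (1:ℝ) : E3) := by
    ext k
    fin_cases k <;> simp [Fin.sum_univ_three]
  calc ‖w‖ₑ = ‖∑ j, w j • (EuclideanSpace.single j (1:ℝ) : E3)‖ₑ := by rw [← h]
    _ ≤ ∑ j, ‖w j • (EuclideanSpace.single j (1:ℝ) : E3)‖ₑ := enorm_sum_le _ _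
    _ = _ := by
      simp only [enorm_smul]
      congr! with j
      rw [← ofReal_norm (EuclideanSpace.single j (1:ℝ) : E3)]; simp

lemma coord_enorm_le (w : E3) (j : Fin 3) : ‖w j‖ₑ ≤ ‖w‖ₑ := by
  rw [← ofReal_norm, ← ofReal_norm]
  exact ofReal_le_ofReal (PiLp.norm_apply_le w j)

/-- weak-gradient data on a ball of a slice -/
def WG (x0 : E3) (R : ℝ) (u : E3 → E3) (G : E3 → Fin 3 → Fin 3 → ℝ) : Prop :=
  ∀ ψ : E3 → ℝ, ContDiff ℝ smo ψ → HasCompactSupport ψ → tsupport ψ ⊆ ball x0 R →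
    ∀ i j : Fin 3, ∫ x, u x j * pd i ψ x = - ∫ x, G x i j * ψ x

lemma indicator_mul_of_tsupport {s : Set E3} {f ψ : E3 → ℝ} (h : tsupport ψ ⊆ s) (x : E3) :
    s.indicator f x * ψ x = f x * ψ x := by
  by_cases hx : x ∈ s
  · rw [indicator_of_mem hx]
  · rw [image_eq_zero_of_notMem_tsupport (fun hh => hx (h hh))]; simp

lemma oscV : ∃ C : ℝ, 0 < C ∧ ∀ (x0 : E3) (R : ℝ), 0 < R → ∀ (u : E3 → E3)
    (G : E3 → Fin 3 → Fin 3 → ℝ) (a : ℝ), 0 ≤ a → Measurable u → Measurable G →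
    ∫⁻ x in ball x0 R, ‖u x‖ₑ ^ 2 ≤ oR (a ^ 2) →
    ∫⁻ x in ball x0 R, gn (G x) ≠ ∞ → WG x0 R u G →
    ∃ c : E3, ‖c‖ₑ ≤ oR (C * a * R ^ (-(3 / 2) : ℝ)) ∧
      ∀ᵐ x, x ∈ ball x0 (R / 2) →
      ‖u x - c‖ₑ ≤
        oR C * ∫⁻ y in ball x0 R, Kr (y - x) * gn (G y) ^ hlf := by
  obtain ⟨C1, hC1, h1⟩ := osc
  obtain ⟨C2, hC2, h2⟩ := kap_bound
  obtain ⟨C3, hC3, h3⟩ := vol_ball'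
  refine ⟨9 * C1 + 3 * (|m0|⁻¹ * (C2 * 8)) * C3 ^ hlf, by positivity,
    fun x0 R hR u G a ha hu hG hua hGf hw => ?_⟩
  have hB : MeasurableSet (ball x0 R) := measurableSet_ball
  have hl1 : ∫⁻ x in ball x0 R, ‖u x‖ₑ ≤ oR (a * (C3 * R ^ 3) ^ (1/2:ℝ)) := by
    refine (l1_le_l2 _ hu.enorm.aemeasurable).trans ?_
    rw [Measure.restrict_apply_univ, h3 x0 R hR, ofReal_mul ha, ← sqrt_ofReal_sq ha,
      ofReal_rpow_of_nonneg (by positivity : 0 ≤ C3 * R ^ 3) (by norm_num)]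
    gcongr
  have huj : ∀ j, Integrable ((ball x0 R).indicator (fun x => u x j)) := by
    intro j
    have hm : Measurable (fun x => u x j) := by fun_prop
    rw [integrable_indicator_iff hB]
    refine ⟨hm.aestronglyMeasurable, ?_⟩
    refine (lintegral_mono (fun x => coord_enorm_le (u x) j)).trans_lt (hl1.trans_lt ofReal_lt_top)
  have hGj : ∀ i j, Integrable ((ball x0 R).indicator (fun x => G x i j)) := by
    intro i j
    have hm : Measurable (fun x => G x i j) := by fun_prop
    rw [integrable_indicator_iff hB]
    refine ⟨hm.aestronglyMeasurable, ?_⟩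
    refine (lintegral_mono (fun x => enorm_le_gn (G x) i j)).trans_lt ?_
    refine (l1_le_l2 _ ((measurable_gn.comp hG).pow_const _).aemeasurable).trans_lt ?_
    simp_rw [← rpow_two, Function.comp_def, gn_rpow]
    rw [Measure.restrict_apply_univ]
    exact mul_lt_top (rpow_lt_top_of_nonneg (by norm_num) hGf)
      (rpow_lt_top_of_nonneg (by norm_num) measure_ball_lt_top.ne)
  have key := fun j => h1 x0 R hR _
    (fun y i => (ball x0 R).indicator (fun x => G x i j) y) (huj j) (fun i => hGj i j)
    (fun y hy i => indicator_of_notMem hy _) (fun ψ hψ hc hs i => by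
      have e := hw ψ hψ hc hs i j
      have e1 : ∀ y, (ball x0 R).indicator (fun x => u x j) y * pd i ψ y = u y j * pd i ψ y :=
        indicator_mul_of_tsupport ((tsupport_fderiv_apply_subset ℝ _).trans hs)
      have e2 : ∀ y, (ball x0 R).indicator (fun x => G x i j) y * ψ y = G y i j * ψ y :=
        indicator_mul_of_tsupport hs
      simp only [e1, e2, e])
  set c0 : Fin 3 → ℝ := fun j => m0⁻¹ * ∫ y, kap (R / 2) (y - x0) *
    (ball x0 R).indicator (fun x => u x j) y with hc0
  have hcj : ∀ j, ‖c0 j‖ₑ ≤ oR ((|m0|⁻¹ * (C2 * 8)) * C3 ^ hlf * a * R ^ (-(3/2):ℝ)) := by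
    intro j
    rw [hc0]
    simp only [enorm_mul]
    have h4 : ‖∫ y, kap (R / 2) (y - x0) * (ball x0 R).indicator (fun x => u x j) y‖ₑ ≤
        oR (C2 * ((R/2) ^ 3)⁻¹ * (a * (C3 * R ^ 3) ^ (1/2:ℝ))) := by
      refine (enorm_integral_le_lintegral_enorm _).trans ?_
      rw [ofReal_mul (by positivity)]
      refine le_trans ?_ (mul_le_mul_right hl1 _)
      rw [← lintegral_const_mul' _ _ ofReal_ne_top, ← lintegral_indicator hB]
      apply lintegral_mono
      intro y
      dsimp only
      by_cases hy : y ∈ ball x0 R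
      · rw [indicator_of_mem hy, indicator_of_mem hy, enorm_mul]
        gcongr
        · rw [← ofReal_norm]
          exact ofReal_le_ofReal (h2 _ (by positivity) _)
        · exact coord_enorm_le _ _
      · rw [indicator_of_notMem hy]; simp
    refine (mul_le_mul_right h4 _).trans ?_
    rw [← ofReal_norm, Real.norm_eq_abs, ← ofReal_mul (abs_nonneg _)]
    apply ofReal_le_ofReal
    rw [abs_inv, Real.mul_rpow hC3.le (by positivity), ← Real.rpow_natCast, ← Real.rpow_natCast,
      ← Real.rpow_mul hR.le]
    have e : R ^ (((3:ℕ):ℝ) * (1/2)) = R ^ (-(3/2):ℝ) * R ^ 3 := by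
      rw [← Real.rpow_natCast, ← Real.rpow_add hR]; norm_num
    rw [e]
    apply le_of_eq
    rw [Real.rpow_natCast]
    field_simp
    norm_num
    ring
  refine ⟨(WithLp.equiv 2 (Fin 3 → ℝ)).symm c0, ?_, ?_⟩
  · refine (enorm_le_sum _).trans ?_
    refine (Finset.sum_le_sum (fun j _ => hcj j)).trans ?_
    rw [← ofReal_sum_of_nonneg (fun j _ => by positivity)]
    apply ofReal_le_ofReal
    simp only [Finset.sum_const, Finset.card_univ, Fintype.card_fin, nsmul_eq_mul]
    have : 0 ≤ 9 * C1 * a * R ^ (-(3/2):ℝ) := by positivity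
    push_cast
    nlinarith
  · filter_upwards [ae_all_iff.2 key] with x hx hxB
    have hxR : x ∈ ball x0 R := ball_subset_ball (by linarith) hxB
    refine (enorm_le_sum _).trans ?_
    have hstep : ∀ j, ‖(u x - (WithLp.equiv 2 (Fin 3 → ℝ)).symm c0) j‖ₑ ≤
        oR (3 * C1) * ∫⁻ y in ball x0 R, Kr (y - x) * gn (G y) ^ hlf := by
      intro j
      have h5 := hx j hxB
      rw [indicator_of_mem hxR] at h5
      refine le_trans (le_of_eq ?_) (h5.trans ?_)
      · simp [hc0]
      rw [mul_comm 3, ofReal_mul hC1.le, mul_assoc]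
      gcongr
      rw [← lintegral_const_mul' _ _ ofReal_ne_top]
      apply setLIntegral_mono' hB
      intro y hy
      rw [mul_left_comm]
      gcongr
      calc ∑ i, ‖(ball x0 R).indicator (fun x => G x i j) y‖ₑ
          ≤ ∑ i : Fin 3, gn (G y) ^ hlf := by
            apply Finset.sum_le_sum
            intro i _
            rw [indicator_of_mem hy]
            exact enorm_le_gn _ _ _
        _ = _ := by simp
    refine (Finset.sum_le_sum (fun j _ => hstep j)).trans ?_
    rw [← Finset.sum_mul, ← ofReal_sum_of_nonneg (fun j _ => by positivity)]
    gcongr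
    simp only [Finset.sum_const, Finset.card_univ, Fintype.card_fin, nsmul_eq_mul]
    have : 0 ≤ 3 * (|m0|⁻¹ * (C2 * 8)) * C3 ^ hlf := by positivity
    push_cast
    linarith
end

section
lemma measurable_pot {H : E3 → ℝ≥0∞} (hH : Measurable H) (s : Set E3) :
    Measurable (fun x => ∫⁻ y in s, Kr (y - x) * H y) := by
  apply Measurable.lintegral_prod_right' (f := fun z : E3 × E3 => Kr (z.2 - z.1) * H z.2)
  exact (measurable_Kr.comp (by fun_prop)).mul (hH.comp (by fun_prop))

lemma pot_gn {q k e : ℝ} (hq : 2 ≤ q) (hk : 0 < k) (hk2 : k < 3 / 2)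
    (hr : 1 / 2 + 1 / k = 1 + 1 / q) (he : (3 - 2 * k) * (q / k) = e) :
    ∃ C : ℝ, 0 < C ∧ ∀ (x0 : E3) (R : ℝ), 0 < R →
    ∀ G : E3 → Fin 3 → Fin 3 → ℝ, Measurable G →
    ∫⁻ x in ball x0 (R / 2),
      (∫⁻ y in ball x0 R, Kr (y - x) * gn (G y) ^ hlf) ^ q ≤
      oR (C * R ^ e) * (∫⁻ y in ball x0 R, gn (G y)) ^ (q / 2) := by
  obtain ⟨C, hC, h⟩ := pot_bound (p := 2) (q := q) (k := k) (by norm_num) hq hk hk2 hr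
  refine ⟨C, hC, fun x0 R hR G hG => ?_⟩
  have h1 := h x0 R hR (fun y => gn (G y) ^ hlf) ((measurable_gn.comp hG).pow_const _)
  simp only [gn_rpow, he] at h1
  exact (lintegral_mono_set (ball_subset_ball (by linarith))).trans h1

lemma sq_diff_le (u c : E3) : ‖‖u‖ ^ 2 - ‖c‖ ^ 2‖ₑ ≤ ‖u - c‖ₑ ^ 2 + 2 * ‖c‖ₑ * ‖u - c‖ₑ := by
  simp only [← ofReal_norm]
  rw [← ofReal_pow (norm_nonneg _), show (2:ℝ≥0∞) * oR ‖c‖ = oR 2 * oR ‖c‖ by simp,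
    ← ofReal_mul (by norm_num), ← ofReal_mul (by positivity),
    ← ofReal_add (by positivity) (by positivity)]
  apply ofReal_le_ofReal
  have h1 := norm_sub_norm_le u c
  have h2 := norm_sub_norm_le c u
  rw [norm_sub_rev] at h2
  rw [Real.norm_eq_abs, abs_le]
  have h3 := norm_nonneg u
  have h4 := norm_nonneg c
  have h5 := norm_nonneg (u - c)
  constructor <;> nlinarith

lemma rpow_ofReal_mul {C R e s : ℝ} (hC : 0 < C) (hR : 0 < R) (hs : 0 ≤ s) :
    oR (C * R ^ e) ^ s = oR (C ^ s * R ^ (e * s)) := by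
  rw [ofReal_rpow_of_nonneg (by positivity) hs, Real.mul_rpow hC.le (by positivity),
    ← Real.rpow_mul hR.le]

lemma om3 {a b c : ℝ} (ha : 0 ≤ a) (hb : 0 ≤ b) {I : ℝ≥0∞} :
    oR a * ((oR b * I) * oR c) = oR (a * b * c) * I := by
  rw [ofReal_mul (by positivity), ofReal_mul ha]; ring

lemma algV1 {C1 C2 C3 R a : ℝ} (hC1 : 0 < C1) (hC2 : 0 < C2) (hC3 : 0 < C3) (hR : 0 < R) (ha : 0 ≤ a)
    (I : ℝ≥0∞) : oR (C1 ^ 2) * ((oR (C2 * R ^ (1:ℝ)) * I ^ (4/2:ℝ)) ^ (1/2:ℝ) *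
          oR a) +
        (2 * oR (C1 * a * R ^ (-(3 / 2) : ℝ)) * oR C1) *
          ((oR (C3 * R ^ (2:ℝ)) * I ^ (2/2:ℝ)) ^ (1/2:ℝ) * oR a) =
      oR (C1 ^ 2 * C2 ^ (1/2:ℝ) * a * R ^ (1/2:ℝ)) * I +
        oR (2 * C1 * C1 * C3 ^ (1/2:ℝ) * a ^ 2 * R ^ (-(1/2):ℝ)) * I ^ (1/2:ℝ) := by
  rw [mul_rpow_of_nonneg _ _ (by norm_num), mul_rpow_of_nonneg _ _ (by norm_num),
    ← rpow_mul, ← rpow_mul, rpow_ofReal_mul hC2 hR (by norm_num),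
    rpow_ofReal_mul hC3 hR (by norm_num)]
  rw [show (2:ℝ≥0∞) = oR 2 by simp, ← ofReal_mul (by norm_num),
    ← ofReal_mul (by positivity)]
  have e1 : (4 / 2 * (1/2) : ℝ) = 1 := by norm_num
  have e2 : (2 / 2 * (1/2) : ℝ) = 1/2 := by norm_num
  rw [e1, e2, rpow_one]
  have e3 : R ^ (-(1/2):ℝ) = R ^ (-(3/2):ℝ) * R ^ (2 * (1/2) : ℝ) := by
    rw [← Real.rpow_add hR]; norm_num
  rw [e3]
  rw [om3 (by positivity) (by positivity),
    om3 (by positivity) (by positivity)]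
  congr 3
  · norm_num; ring
  · ring

lemma algV2 {C1 C2 C3 R a : ℝ} (hC1 : 0 < C1) (hC2 : 0 < C2) (hC3 : 0 < C3) (hR : 0 < R) (ha : 0 ≤ a)
    (I : ℝ≥0∞) : oR (2 * C1 ^ 2) * (oR (a ^ (6/5:ℝ)) *
          (oR (C2 * R ^ (1/2:ℝ)) * I ^ (5/2:ℝ)) ^ (2/5:ℝ)) +
        (2 * oR (C1 * a * R ^ (-(3 / 2) : ℝ)) ^ 2) *
          (oR (a ^ (6/5:ℝ)) * oR (C3 * R ^ (3:ℝ)) ^ (2/5:ℝ)) =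
      oR (2 * C1 ^ 2 * C2 ^ (2/5:ℝ) * a ^ (6/5:ℝ) * R ^ (1/5:ℝ)) * I +
        oR (2 * C1 ^ 2 * C3 ^ (2/5:ℝ) * a ^ (6/5:ℝ) * R ^ (1/5:ℝ)) *
          oR (a ^ 2 / R ^ 2) := by
  rw [mul_rpow_of_nonneg _ _ (by norm_num),
    ← rpow_mul, rpow_ofReal_mul hC2 hR (by norm_num),
    rpow_ofReal_mul hC3 hR (by norm_num)]
  rw [← ofReal_pow (by positivity), show (2:ℝ≥0∞) = oR 2 by simp,
    ← ofReal_mul (by norm_num), ← ofReal_mul (by positivity)]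
  have e1 : (5 / 2 * (2/5) : ℝ) = 1 := by norm_num
  rw [e1, rpow_one]
  have e3 : R ^ (1/5:ℝ) / R ^ 2 = (R ^ (-(3/2):ℝ)) ^ 2 * R ^ (3 * (2/5) : ℝ) := by
    rw [← Real.rpow_natCast, ← Real.rpow_natCast, ← Real.rpow_mul hR.le, ← Real.rpow_add hR,
      ← Real.rpow_sub hR]; norm_num
  congr 1
  · rw [mul_comm (oR (a ^ (6/5:ℝ))), om3 (by positivity) (by positivity)]
    congr 2
    norm_num; ring
  · rw [← ofReal_mul (by positivity), ← ofReal_mul (by positivity)]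
    congr 1
    calc _ = 2 * C1 ^ 2 * C3 ^ (2/5:ℝ) * a ^ (6/5:ℝ) * a ^ 2 * ((R ^ (-(3/2):ℝ)) ^ 2 * R ^ (3 * (2/5) : ℝ)) := by
          ring
      _ = _ := by rw [← e3]; ring

lemma sliceV1 : ∃ C : ℝ, 0 < C ∧ ∀ (x0 : E3) (R : ℝ), 0 < R → ∀ (u : E3 → E3)
    (G : E3 → Fin 3 → Fin 3 → ℝ) (a : ℝ), 0 ≤ a → Measurable u → Measurable G →
    ∫⁻ x in ball x0 R, ‖u x‖ₑ ^ 2 ≤ oR (a ^ 2) →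
    ∫⁻ x in ball x0 R, gn (G x) ≠ ∞ → WG x0 R u G →
    ∃ c : E3, ∫⁻ x in ball x0 (R / 2), ‖‖u x‖ ^ 2 - ‖c‖ ^ 2‖ₑ * ‖u x‖ₑ ≤
      oR (C * a * R ^ hlf) * (∫⁻ y in ball x0 R, gn (G y)) +
      oR (C * a ^ 2 * R ^ (-(1 / 2) : ℝ)) *
        (∫⁻ y in ball x0 R, gn (G y)) ^ hlf := by
  obtain ⟨C1, hC1, h1⟩ := oscV
  obtain ⟨C2, hC2, h2⟩ := pot_gn (q := 4) (k := 4 / 3) (e := 1) (by norm_num) (by norm_num)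
    (by norm_num) (by norm_num) (by norm_num)
  obtain ⟨C3, hC3, h3⟩ := pot_gn (q := 2) (k := 1) (e := 2) (by norm_num) (by norm_num)
    (by norm_num) (by norm_num) (by norm_num)
  refine ⟨C1 ^ 2 * C2 ^ hlf + 2 * C1 * C1 * C3 ^ (1/2 : ℝ), by positivity,
    fun x0 R hR u G a ha hu hG hua hGf hw => ?_⟩
  obtain ⟨c, hc, hx⟩ := h1 x0 R hR u G a ha hu hG hua hGf hw
  refine ⟨c, ?_⟩
  set J : E3 → ℝ≥0∞ := fun x => ∫⁻ y in ball x0 R, Kr (y - x) * gn (G y) ^ hlf with hJ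
  have hJm : Measurable J := measurable_pot ((measurable_gn.comp hG).pow_const _) _
  set I := ∫⁻ y in ball x0 R, gn (G y) with hI
  have h2' : ∫⁻ x in ball x0 (R/2), J x ^ (4:ℝ) ≤ _ := h2 x0 R hR G hG
  have h3' : ∫⁻ x in ball x0 (R/2), J x ^ (2:ℝ) ≤ _ := h3 x0 R hR G hG
  have hx : ∀ᵐ x, x ∈ ball x0 (R / 2) → ‖u x - c‖ₑ ≤ oR C1 * J x := hx
  clear_value J
  have hua' : (∫⁻ x in ball x0 (R/2), ‖u x‖ₑ ^ 2) ^ (1/2:ℝ) ≤ oR a := by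
    rw [← sqrt_ofReal_sq ha]
    gcongr
    exact (lintegral_mono_set (ball_subset_ball (by linarith))).trans hua
  have hm : Measurable (fun x => ‖u x‖ₑ) := hu.enorm
  calc ∫⁻ x in ball x0 (R / 2), ‖‖u x‖ ^ 2 - ‖c‖ ^ 2‖ₑ * ‖u x‖ₑ
      ≤ ∫⁻ x in ball x0 (R / 2), (oR (C1 ^ 2) * (J x ^ 2 * ‖u x‖ₑ) +
          (2 * ‖c‖ₑ * oR C1) * (J x * ‖u x‖ₑ)) := by
        apply setLIntegral_mono_ae' measurableSet_ball
        filter_upwards [hx] with x hx hxB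
        have hw := hx hxB
        calc _ ≤ (‖u x - c‖ₑ ^ 2 + 2 * ‖c‖ₑ * ‖u x - c‖ₑ) * ‖u x‖ₑ := by
              gcongr; exact sq_diff_le _ _
          _ ≤ ((oR C1 * J x) ^ 2 + 2 * ‖c‖ₑ * (oR C1 * J x)) * ‖u x‖ₑ := by
              gcongr
          _ = _ := by rw [ofReal_pow hC1.le]; ring
    _ = oR (C1 ^ 2) * (∫⁻ x in ball x0 (R / 2), J x ^ 2 * ‖u x‖ₑ) +
          (2 * ‖c‖ₑ * oR C1) * ∫⁻ x in ball x0 (R / 2), J x * ‖u x‖ₑ := by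
        rw [lintegral_add_left (by fun_prop), lintegral_const_mul _ (by fun_prop),
          lintegral_const_mul _ (by fun_prop)]
    _ ≤ oR (C1 ^ 2) * ((oR (C2 * R ^ (1:ℝ)) * I ^ (4/2:ℝ)) ^ (1/2:ℝ) *
          oR a) +
        (2 * oR (C1 * a * R ^ (-(3 / 2) : ℝ)) * oR C1) *
          ((oR (C3 * R ^ (2:ℝ)) * I ^ (2/2:ℝ)) ^ (1/2:ℝ) * oR a) := by
        gcongr
        · refine (hold2 _ (by fun_prop) (by fun_prop)).trans ?_
          gcongr
          refine le_trans (le_of_eq (lintegral_congr fun x => ?_)) h2'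
          rw [← pow_mul, ← rpow_natCast]; norm_num
        · refine (hold2 _ (by fun_prop) (by fun_prop)).trans ?_
          gcongr
          simpa only [← rpow_natCast, Nat.cast_ofNat] using h3'
    _ = oR (C1 ^ 2 * C2 ^ (1/2:ℝ) * a * R ^ (1/2:ℝ)) * I +
        oR (2 * C1 * C1 * C3 ^ (1/2:ℝ) * a ^ 2 * R ^ (-(1/2):ℝ)) * I ^ (1/2:ℝ) := by
        exact algV1 hC1 hC2 hC3 hR ha I
    _ ≤ _ := by
        gcongr
        · have : 0 ≤ 2 * C1 * C1 * C3 ^ (1/2 : ℝ) := by positivity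
          linarith
        · have : 0 ≤ C1 ^ 2 * C2 ^ hlf := by positivity
          linarith

lemma sliceV2 : ∃ C : ℝ, 0 < C ∧ ∀ (x0 : E3) (R : ℝ), 0 < R → ∀ (u : E3 → E3)
    (G : E3 → Fin 3 → Fin 3 → ℝ) (a : ℝ), 0 ≤ a → Measurable u → Measurable G →
    ∫⁻ x in ball x0 R, ‖u x‖ₑ ^ 2 ≤ oR (a ^ 2) →
    ∫⁻ x in ball x0 R, gn (G x) ≠ ∞ → WG x0 R u G →
    ∫⁻ x in ball x0 (R / 2), ‖u x‖ₑ ^ (16 / 5 : ℝ) ≤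
      oR (C * a ^ (6 / 5 : ℝ) * R ^ (1 / 5 : ℝ)) *
        ((∫⁻ y in ball x0 R, gn (G y)) + oR (a ^ 2 / R ^ 2)) := by
  obtain ⟨C1, hC1, h1⟩ := oscV
  obtain ⟨C2, hC2, h2⟩ := pot_gn (q := 5) (k := 10 / 7) (e := 1 / 2) (by norm_num) (by norm_num)
    (by norm_num) (by norm_num) (by norm_num)
  obtain ⟨C3, hC3, h3⟩ := vol_ball'
  refine ⟨2 * C1 ^ 2 * C2 ^ (2 / 5 : ℝ) + 2 * C1 ^ 2 * C3 ^ (2/5 : ℝ), by positivity,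
    fun x0 R hR u G a ha hu hG hua hGf hw => ?_⟩
  obtain ⟨c, hc, hx⟩ := h1 x0 R hR u G a ha hu hG hua hGf hw
  set J : E3 → ℝ≥0∞ := fun x => ∫⁻ y in ball x0 R, Kr (y - x) * gn (G y) ^ hlf with hJ
  have hJm : Measurable J := measurable_pot ((measurable_gn.comp hG).pow_const _) _
  set I := ∫⁻ y in ball x0 R, gn (G y) with hI
  have hsub : ball x0 (R/2) ⊆ ball x0 R := ball_subset_ball (by linarith)
  have h2' : ∫⁻ x in ball x0 (R/2), J x ^ (5:ℝ) ≤ _ := h2 x0 R hR G hG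
  have hx : ∀ᵐ x, x ∈ ball x0 (R / 2) → ‖u x - c‖ₑ ≤ oR C1 * J x := hx
  clear_value J
  have hua' : (∫⁻ x in ball x0 (R/2), ‖u x‖ₑ ^ 2) ^ (3/5:ℝ) ≤ oR (a ^ (6/5:ℝ)) := by
    have : a ^ (6/5:ℝ) = (a ^ 2) ^ (3/5:ℝ) := by
      rw [← Real.rpow_natCast, ← Real.rpow_mul ha]; norm_num
    rw [this, ← ofReal_rpow_of_nonneg (by positivity) (by norm_num)]
    gcongr
    exact (lintegral_mono_set hsub).trans hua
  have hm : Measurable (fun x => ‖u x‖ₑ) := hu.enorm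
  have hue : ∀ x, ‖u x‖ₑ ^ (6/5:ℝ) = (‖u x‖ₑ ^ 2) ^ (3/5:ℝ) := by
    intro x
    rw [← rpow_natCast, ← rpow_mul]; norm_num
  calc ∫⁻ x in ball x0 (R / 2), ‖u x‖ₑ ^ (16/5:ℝ)
      ≤ ∫⁻ x in ball x0 (R / 2), (oR (2 * C1 ^ 2) * (‖u x‖ₑ ^ (6/5:ℝ) * J x ^ 2) +
          (2 * ‖c‖ₑ ^ 2) * ‖u x‖ₑ ^ (6/5:ℝ)) := by
        apply setLIntegral_mono_ae' measurableSet_ball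
        filter_upwards [hx] with x hx hxB
        have hw := hx hxB
        have e1 : ‖u x‖ₑ ≤ oR C1 * J x + ‖c‖ₑ := by
          calc ‖u x‖ₑ = ‖u x - c + c‖ₑ := by simp
            _ ≤ ‖u x - c‖ₑ + ‖c‖ₑ := enorm_add_le _ _
            _ ≤ _ := by gcongr
        have e2 : ‖u x‖ₑ ^ 2 ≤ 2 * (oR C1 * J x) ^ 2 + 2 * ‖c‖ₑ ^ 2 := by
          refine (pow_le_pow_left' e1 2).trans ?_
          rw [← mul_add]
          have := rpow_add_le_mul_rpow_add_rpow (oR C1 * J x) ‖c‖ₑ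
            (p := 2) (by norm_num)
          norm_num at this
          exact this
        calc ‖u x‖ₑ ^ (16/5:ℝ) = ‖u x‖ₑ ^ (6/5:ℝ) * ‖u x‖ₑ ^ 2 := by
              rw [← rpow_natCast, ← rpow_add_of_nonneg _ _ (by norm_num) (by norm_num)]
              norm_num
          _ ≤ ‖u x‖ₑ ^ (6/5:ℝ) * (2 * (oR C1 * J x) ^ 2 + 2 * ‖c‖ₑ ^ 2) := by gcongr
          _ = _ := by
              rw [ofReal_mul (by norm_num), ofReal_pow hC1.le, ofReal_ofNat]; ring
    _ = oR (2 * C1 ^ 2) * (∫⁻ x in ball x0 (R / 2), ‖u x‖ₑ ^ (6/5:ℝ) * J x ^ 2) +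
          (2 * ‖c‖ₑ ^ 2) * ∫⁻ x in ball x0 (R / 2), ‖u x‖ₑ ^ (6/5:ℝ) := by
        rw [lintegral_add_left (by fun_prop), lintegral_const_mul _ (by fun_prop),
          lintegral_const_mul _ (by fun_prop)]
    _ ≤ oR (2 * C1 ^ 2) * (oR (a ^ (6/5:ℝ)) *
          (oR (C2 * R ^ (1/2:ℝ)) * I ^ (5/2:ℝ)) ^ (2/5:ℝ)) +
        (2 * oR (C1 * a * R ^ (-(3 / 2) : ℝ)) ^ 2) *
          (oR (a ^ (6/5:ℝ)) * oR (C3 * R ^ (3:ℝ)) ^ (2/5:ℝ)) := by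
        gcongr
        · have hJ5 : ∀ x, J x ^ 2 = (J x ^ (5:ℝ)) ^ (2/5:ℝ) := by
            intro x
            rw [← rpow_natCast, ← rpow_mul]; norm_num
          simp_rw [hue, hJ5]
          refine (lintegral_mul_norm_pow_le (by fun_prop) (by fun_prop) (by norm_num)
            (by norm_num) (by norm_num)).trans ?_
          gcongr
        · have h4 := lintegral_mul_norm_pow_le (μ := volume.restrict (ball x0 (R/2)))
            (f := fun x => ‖u x‖ₑ ^ 2) (g := fun _ => 1) (p := 3/5) (q := 2/5)
            (by fun_prop) (by fun_prop) (by norm_num) (by norm_num) (by norm_num)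
          simp only [one_rpow, mul_one, lintegral_one, Measure.restrict_apply_univ, ← hue] at h4
          refine h4.trans ?_
          gcongr
          refine (measure_mono hsub).trans ?_
          rw [h3 x0 R hR]
          norm_cast
    _ = oR (2 * C1 ^ 2 * C2 ^ (2/5:ℝ) * a ^ (6/5:ℝ) * R ^ (1/5:ℝ)) * I +
        oR (2 * C1 ^ 2 * C3 ^ (2/5:ℝ) * a ^ (6/5:ℝ) * R ^ (1/5:ℝ)) *
          oR (a ^ 2 / R ^ 2) := by
        exact algV2 hC1 hC2 hC3 hR ha I
    _ ≤ _ := by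
        rw [mul_add]
        gcongr
        · have : 0 ≤ 2 * C1 ^ 2 * C3 ^ (2/5 : ℝ) := by positivity
          linarith
        · have : 0 ≤ 2 * C1 ^ 2 * C2 ^ (2 / 5 : ℝ) := by positivity
          linarith
end

section
lemma kap_lip : ∃ C : ℝ, 0 < C ∧ ∀ ε, 0 < ε → ∀ z w, |kap ε z - kap ε w| ≤ C * (ε ^ 4)⁻¹ * ‖z - w‖ := by
  obtain ⟨C, hC⟩ := ContDiff.lipschitzWith_of_hasCompactSupport (kap_compact one_pos)
    ((kap_contDiff 1).of_le (by exact_mod_cast le_top) : ContDiff ℝ 1 (kap 1)) (by norm_num)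
  refine ⟨C + 1, by positivity, fun ε hε z w => ?_⟩
  have e : ∀ z, kap ε z = (ε ^ 3)⁻¹ * kap 1 (ε⁻¹ • z) := by
    intro z
    simp only [kap, norm_smul, norm_inv, Real.norm_eq_abs, abs_of_pos hε]
    congr 2
    field_simp
  rw [e, e, ← mul_sub, abs_mul, abs_of_pos (by positivity)]
  have h := hC.dist_le_mul (ε⁻¹ • z) (ε⁻¹ • w)
  rw [dist_eq_norm, dist_eq_norm, ← smul_sub, norm_smul, norm_inv, Real.norm_eq_abs,
    Real.norm_eq_abs, abs_of_pos hε] at h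
  calc (ε ^ 3)⁻¹ * |kap 1 (ε⁻¹ • z) - kap 1 (ε⁻¹ • w)|
      ≤ (ε ^ 3)⁻¹ * ((C + 1) * (ε⁻¹ * ‖z - w‖)) := by
        gcongr
        refine h.trans ?_
        gcongr
        simp
    _ = _ := by field_simp

lemma integral_pd_zero {g : E3 → ℝ} (hg : ContDiff ℝ smo g) (hc : HasCompactSupport g) (i : Fin 3) :
    ∫ x, pd i g x = 0 := by
  have hc' : HasCompactSupport (pd i g) := hc.fderiv_apply ℝ _
  have h := integral_mul_fderiv_eq_neg_fderiv_mul_of_integrable (μ := (volume : Measure E3)) (𝕜 := ℝ)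
    (f := fun _ : E3 => (1:ℝ)) (g := g) (v := EuclideanSpace.single i 1)
    (by simp) (by simp only [one_mul]; exact (contDiff_pd (i := i) hg).continuous.integrable_of_hasCompactSupport hc')
    (by simpa using hg.continuous.integrable_of_hasCompactSupport hc) (by fun_prop)
    (fun x _ => (hg.differentiable (by simp)).differentiableAt)
  simpa [pd] using h

/-- slice pressure equation -/
def PE (x0 : E3) (R : ℝ) (q : E3 → ℝ) (F : E3 → Fin 3 → ℝ) : Prop :=
  ∀ ψ : E3 → ℝ, ContDiff ℝ smo ψ → HasCompactSupport ψ → tsupport ψ ⊆ ball x0 R →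
    ∫ y, q y * ∑ i, pd i (pd i ψ) y = ∫ y, ∑ i, F y i * pd i ψ y

lemma tsupport_pd (i : Fin 3) (ψ : E3 → ℝ) : tsupport (pd i ψ) ⊆ tsupport ψ :=
  tsupport_fderiv_apply_subset ℝ _

lemma sliceP : ∃ C : ℝ, 0 < C ∧ ∀ (θ : ℝ), 0 < θ → θ ≤ 1 / 2 → ∀ (x0 : E3) (R : ℝ), 0 < R →
    ∀ (q : E3 → ℝ) (F : E3 → Fin 3 → ℝ) (c0 : ℝ), Measurable q → Measurable F →
    ∫⁻ x in ball x0 R, ‖q x - c0‖ₑ ^ r16 ≠ ∞ →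
    ∫⁻ x in ball x0 R, ∑ i, ‖F x i‖ₑ ≠ ∞ → PE x0 R q F →
    ∃ c : ℝ, ∫⁻ x in ball x0 (θ * R), ‖q x - c‖ₑ ^ r16 ≤
      oR (C * θ ^ (49 / 11 : ℝ)) * (∫⁻ x in ball x0 R, ‖q x - c0‖ₑ ^ r16) +
      oR (C * R ^ (1 / 11 : ℝ)) *
        (∫⁻ x in ball x0 R, ∑ i, ‖F x i‖ₑ) ^ r16 := by
  obtain ⟨C1, hC1, h1⟩ := repr_bound
  obtain ⟨C2, hC2, h2⟩ := pot_bound (p := 1) (q := 16 / 11) (k := 16 / 11) (by norm_num) (by norm_num)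
    (by norm_num) (by norm_num) (by norm_num)
  obtain ⟨C3, hC3, h3⟩ := vol_ball'
  obtain ⟨C4, hC4, h4⟩ := kap_lip
  have hm0 : 0 < |m0| := abs_pos.2 m0_ne
  set A := |m0|⁻¹ * C4 * 16 with hA
  have hApos : 0 < A := by positivity
  refine ⟨2 * (C1 ^ (16/11:ℝ) * C2) + 2 * (A ^ (16/11:ℝ) * C3 ^ (5/11:ℝ) * C3), by positivity,
    fun θ hθ hθ2 x0 R hR q F c0 hq hF hqf hFf hpe => ?_⟩
  have hB : MeasurableSet (ball x0 R) := measurableSet_ball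
  set M := ∫⁻ x in ball x0 R, ‖q x - c0‖ₑ ^ r16 with hM
  set b := ∫⁻ x in ball x0 R, ∑ i, ‖F x i‖ₑ with hb
  have hqm : Measurable (fun x => q x - c0) := by fun_prop
  have hl1 : ∫⁻ x in ball x0 R, ‖q x - c0‖ₑ ≤ M ^ (11/16:ℝ) * oR (C3 * R ^ (3:ℝ)) ^ (5/16:ℝ) := by
    have h5 := lintegral_mul_norm_pow_le (μ := volume.restrict (ball x0 R))
      (f := fun x => ‖q x - c0‖ₑ ^ (16/11:ℝ)) (g := fun _ => 1) (p := 11/16) (q := 5/16)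
      (by fun_prop) (by fun_prop) (by norm_num) (by norm_num) (by norm_num)
    simp only [← rpow_mul, one_rpow, mul_one, lintegral_one, Measure.restrict_apply_univ] at h5
    rw [h3 x0 R hR] at h5
    norm_num at h5
    norm_num
    exact h5
  set f := (ball x0 R).indicator (fun x => q x - c0) with hf
  have hfi : Integrable f := by
    rw [integrable_indicator_iff hB]
    exact ⟨hqm.aestronglyMeasurable, hl1.trans_lt (mul_lt_top
      (rpow_lt_top_of_nonneg (by norm_num) hqf) (rpow_lt_top_of_nonneg (by norm_num) ofReal_ne_top))⟩
  have hFi : ∀ i, Integrable (fun y => (ball x0 R).indicator (fun x => F x i) y) := by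
    intro i
    have hm : Measurable (fun x => F x i) := by fun_prop
    show Integrable ((ball x0 R).indicator (fun x => F x i))
    rw [integrable_indicator_iff hB]
    refine ⟨hm.aestronglyMeasurable, ?_⟩
    refine (lintegral_mono (fun x => ?_)).trans_lt hFf.lt_top
    exact Finset.single_le_sum (f := fun i => ‖F x i‖ₑ) (fun _ _ => zero_le) (Finset.mem_univ i)
  have heq : ∀ ψ : E3 → ℝ, ContDiff ℝ smo ψ → HasCompactSupport ψ →
      tsupport ψ ⊆ ball x0 R → ∫ y, f y * ∑ i, pd i (pd i ψ) y =
        ∫ y, ∑ i, (ball x0 R).indicator (fun x => F x i) y * pd i ψ y := by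
    intro ψ hψ hc hs
    have e1 : ∀ y, ∑ i, (ball x0 R).indicator (fun x => F x i) y * pd i ψ y =
        ∑ i, F y i * pd i ψ y := fun y => Finset.sum_congr rfl fun i _ =>
      indicator_mul_of_tsupport ((tsupport_pd i ψ).trans hs) y
    simp_rw [e1]
    rw [← hpe ψ hψ hc hs]
    have hLs : ∀ y, y ∉ ball x0 R → ∑ i, pd i (pd i ψ) y = 0 := by
      intro y hy
      apply Finset.sum_eq_zero
      intro i _
      exact image_eq_zero_of_notMem_tsupport (fun hh => hy (hs (tsupport_pd i _ (tsupport_pd i _ hh))))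
    have hcp : ∀ i, HasCompactSupport (pd i (pd i ψ)) := fun i => (hc.fderiv_apply ℝ _).fderiv_apply ℝ _
    have hcont : ∀ i, Continuous (pd i (pd i ψ)) := fun i => (contDiff_pd (i := i) (contDiff_pd (i := i) hψ)).continuous
    have hLc : Continuous (fun y => ∑ i, pd i (pd i ψ) y) := by fun_prop
    have hLi : Integrable (fun y => ∑ i, pd i (pd i ψ) y) :=
      integrable_finsetSum _ fun i _ => (hcont i).integrable_of_hasCompactSupport (hcp i)
    obtain ⟨D, hD⟩ : ∃ D, ∀ y, ‖∑ i, pd i (pd i ψ) y‖ ≤ D := by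
      apply hLc.bounded_above_of_compact_support
      refine HasCompactSupport.intro hc (fun y hy => ?_)
      apply Finset.sum_eq_zero
      intro i _
      exact image_eq_zero_of_notMem_tsupport (fun hh => hy (tsupport_pd i _ (tsupport_pd i _ hh)))
    have hz : ∫ y, c0 * ∑ i, pd i (pd i ψ) y = 0 := by
      rw [integral_const_mul, integral_finsetSum _ (fun i _ => (hcont i).integrable_of_hasCompactSupport (hcp i))]
      simp [integral_pd_zero (contDiff_pd hψ) (hc.fderiv_apply ℝ _)]
    have e2 : ∀ y, q y * ∑ i, pd i (pd i ψ) y = f y * ∑ i, pd i (pd i ψ) y + c0 * ∑ i, pd i (pd i ψ) y := by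
      intro y
      by_cases hy : y ∈ ball x0 R
      · rw [hf, indicator_of_mem hy]; ring
      · rw [hLs y hy]; simp
    simp_rw [e2]
    rw [integral_add _ (hLi.const_mul _), hz, add_zero]
    exact hfi.mul_bdd (c := D) hLc.aestronglyMeasurable (ae_of_all _ hD)
  have hx := h1 x0 R hR f (fun y i => (ball x0 R).indicator (fun x => F x i) y) hfi hFi heq
  set J : E3 → ℝ≥0∞ := fun x => ∫⁻ y in ball x0 R, Kr (y - x) * ∑ i, ‖F y i‖ₑ with hJ
  have hJm : Measurable J := measurable_pot (by fun_prop) _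
  have h2' : ∫⁻ x in ball x0 R, J x ^ (16/11:ℝ) ≤ _ := h2 x0 R hR _ (by fun_prop)
  have hJe : ∀ x, ∫⁻ y, Kr (y - x) * ∑ i, ‖(ball x0 R).indicator (fun x => F x i) y‖ₑ = J x := by
    intro x
    simp only [hJ]
    rw [← lintegral_indicator hB]
    congr 1
    ext y
    by_cases hy : y ∈ ball x0 R
    · simp [hy]
    · simp [hy]
  simp only [hJe] at hx
  clear_value J
  set L := oR (A * θ * R ^ (-3:ℝ)) * ∫⁻ x in ball x0 R, ‖q x - c0‖ₑ with hL
  refine ⟨c0 + m0⁻¹ * ∫ y, kap (R / 2) (y - x0) * f y, ?_⟩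
  have hpt : ∀ᵐ x, x ∈ ball x0 (θ * R) →
      ‖q x - (c0 + m0⁻¹ * ∫ y, kap (R / 2) (y - x0) * f y)‖ₑ ≤ oR C1 * J x + L := by
    filter_upwards [hx] with x hx hxB
    have hxR2 : x ∈ ball x0 (R / 2) := ball_subset_ball (by nlinarith) hxB
    have hxR : x ∈ ball x0 R := ball_subset_ball (by linarith) hxR2
    have e1 : q x - (c0 + m0⁻¹ * ∫ y, kap (R / 2) (y - x0) * f y) =
      (f x - m0⁻¹ * ∫ y, kap (R / 2) (y - x) * f y) +
        m0⁻¹ * ∫ y, (kap (R / 2) (y - x) - kap (R / 2) (y - x0)) * f y := by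
      simp_rw [sub_mul]
      rw [integral_sub (kap_mul_integrable (by positivity) x hfi) (kap_mul_integrable (by positivity) x0 hfi), hf, indicator_of_mem hxR]
      ring
    rw [e1]
    refine (enorm_add_le _ _).trans (add_le_add (hx hxR2) ?_)
    rw [enorm_mul]
    calc ‖m0⁻¹‖ₑ * ‖∫ y, (kap (R / 2) (y - x) - kap (R / 2) (y - x0)) * f y‖ₑ
        ≤ ‖m0⁻¹‖ₑ * (oR (C4 * ((R/2)^4)⁻¹ * (θ * R)) *
            ∫⁻ x in ball x0 R, ‖q x - c0‖ₑ) := by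
          gcongr
          refine (enorm_integral_le_lintegral_enorm _).trans ?_
          rw [← lintegral_const_mul' _ _ ofReal_ne_top, ← lintegral_indicator hB]
          apply lintegral_mono
          intro y
          dsimp only
          by_cases hy : y ∈ ball x0 R
          · rw [hf, indicator_of_mem hy, indicator_of_mem hy, enorm_mul]
            gcongr
            rw [← ofReal_norm]
            apply ofReal_le_ofReal
            refine (h4 _ (by positivity) _ _).trans ?_
            gcongr
            rw [mem_ball, dist_eq_norm, norm_sub_rev] at hxB
            rw [show y - x - (y - x0) = x0 - x by abel]
            exact hxB.le
          · rw [hf, indicator_of_notMem hy]; simp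
      _ = L := by
          rw [hL, ← mul_assoc, ← ofReal_norm, ← ofReal_mul (norm_nonneg _)]
          congr 2
          rw [norm_inv, Real.norm_eq_abs, hA, Real.rpow_neg hR.le]
          norm_cast
          field_simp
          norm_num
  calc ∫⁻ x in ball x0 (θ * R),
        ‖q x - (c0 + m0⁻¹ * ∫ y, kap (R / 2) (y - x0) * f y)‖ₑ ^ (16/11:ℝ)
      ≤ ∫⁻ x in ball x0 (θ * R), (2 * (oR C1 ^ (16/11:ℝ) * J x ^ (16/11:ℝ)) +
          2 * L ^ (16/11:ℝ)) := by
        apply setLIntegral_mono_ae' measurableSet_ball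
        filter_upwards [hpt] with x hx hxB
        refine (rpow_le_rpow (hx hxB) (by norm_num)).trans ?_
        refine (rpow_add_le_mul_rpow_add_rpow _ _ (by norm_num)).trans ?_
        rw [← mul_add, ← mul_rpow_of_nonneg _ _ (by norm_num)]
        gcongr
        calc (2:ℝ≥0∞) ^ ((16/11:ℝ) - 1) ≤ 2 ^ (1:ℝ) := by
              apply rpow_le_rpow_of_exponent_le <;> norm_num
          _ = 2 := by simp
    _ = 2 * (oR C1 ^ (16/11:ℝ) * ∫⁻ x in ball x0 (θ * R), J x ^ (16/11:ℝ)) +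
          2 * L ^ (16/11:ℝ) * volume (ball x0 (θ * R)) := by
        rw [lintegral_add_right _ measurable_const, lintegral_const_mul _ (by fun_prop),
          lintegral_const_mul _ (by fun_prop), lintegral_const, Measure.restrict_apply_univ]
    _ ≤ 2 * (oR C1 ^ (16/11:ℝ) * (oR (C2 * R ^ (1/11:ℝ)) * b ^ (16/11:ℝ))) +
        2 * (oR (A * θ * R ^ (-3:ℝ)) *
          (M ^ (11/16:ℝ) * oR (C3 * R ^ (3:ℝ)) ^ (5/16:ℝ))) ^ (16/11:ℝ) *
            oR (C3 * (θ * R) ^ 3) := by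
        rw [h3 _ _ (by positivity)]
        gcongr
        · refine (lintegral_mono_set (ball_subset_ball (by nlinarith))).trans (h2'.trans (le_of_eq ?_))
          norm_num [hb]
        · rw [hL]
          gcongr
    _ = oR (2 * (C1 ^ (16/11:ℝ) * C2) * R ^ (1/11:ℝ)) * b ^ (16/11:ℝ) +
        oR (2 * (A ^ (16/11:ℝ) * C3 ^ (5/11:ℝ) * C3) * θ ^ (49/11:ℝ)) * M := by
        clear_value A b M
        clear * - hC1 hC2 hC3 hR hθ hApos
        congr 1
        · rw [ofReal_rpow_of_nonneg hC1.le (by norm_num), show (2:ℝ≥0∞) = oR 2 by simp,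
            ← mul_assoc, ← mul_assoc, ← ofReal_mul (by positivity), ← ofReal_mul (by positivity)]
          congr 2; ring
        · rw [mul_rpow_of_nonneg _ _ (by norm_num), mul_rpow_of_nonneg _ _ (by norm_num),
            ← rpow_mul, ← rpow_mul, rpow_ofReal_mul (by positivity) hR (by norm_num),
            rpow_ofReal_mul (by positivity) hR (by norm_num), show (2:ℝ≥0∞) = oR 2 by simp]
          have e1 : (11/16 * (16/11) : ℝ) = 1 := by norm_num
          have e2 : (5/16 * (16/11) : ℝ) = 5/11 := by norm_num
          rw [e1, e2, rpow_one]
          have e3 : θ ^ (49/11:ℝ) = θ ^ (16/11:ℝ) * θ ^ 3 := by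
            rw [← Real.rpow_natCast, ← Real.rpow_add hθ]; norm_num
          have e4 : R ^ (-3 * (16/11) : ℝ) * R ^ (3 * (5/11) : ℝ) * R ^ 3 = 1 := by
            rw [← Real.rpow_natCast, ← Real.rpow_add hR, ← Real.rpow_add hR]; norm_num
          rw [mul_comm M, ← mul_assoc, ← mul_assoc, mul_right_comm, ← ofReal_mul (by positivity),
            ← ofReal_mul (by positivity), ← ofReal_mul (by positivity), e3,
            Real.mul_rpow hApos.le hθ.le]
          congr 2
          calc _ = 2 * (A ^ (16/11:ℝ) * C3 ^ (5/11:ℝ) * C3) * (θ ^ (16/11:ℝ) * θ ^ 3) *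
                (R ^ (-3 * (16/11) : ℝ) * R ^ (3 * (5/11) : ℝ) * R ^ 3) := by ring
            _ = _ := by rw [e4, mul_one]
    _ ≤ _ := by
        rw [add_comm]
        gcongr
        · have : 0 ≤ 2 * (C1 ^ (16/11:ℝ) * C2) := by positivity
          linarith
        · have : 0 ≤ 2 * (A ^ (16/11:ℝ) * C3 ^ (5/11:ℝ) * C3) := by positivity
          linarith
end

section
lemma pd_comm {f : E3 → ℝ} (hf : ContDiff ℝ smo f) (i j : Fin 3) : pd i (pd j f) = pd j (pd i f) := by
  have key : ∀ a b : Fin 3, ∀ x, pd a (pd b f) x =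
      fderiv ℝ (fderiv ℝ f) x (EuclideanSpace.single a 1) (EuclideanSpace.single b 1) := by
    intro a b x
    have h1 : DifferentiableAt ℝ (fderiv ℝ f) x :=
      ((hf.fderiv_right (m := 1) (by norm_cast)).differentiable (by simp)).differentiableAt
    have := (h1.hasFDerivAt.clm_apply (hasFDerivAt_const (EuclideanSpace.single b (1:ℝ)) x)).fderiv
    unfold pd
    rw [this]
    simp
  funext x
  rw [key, key]
  have := (hf.contDiffAt (x := x)).isSymmSndFDerivAt (by simp [minSmoothness_of_isRCLikeNormedField]; norm_cast)
  exact this _ _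

/-- admissible test functions -/
def Adm (K : Set E3) (ψ : E3 → ℝ) : Prop :=
  ContDiff ℝ smo ψ ∧ HasCompactSupport ψ ∧ tsupport ψ ⊆ K

lemma Adm.pd {K : Set E3} {ψ : E3 → ℝ} (h : Adm K ψ) (i : Fin 3) : Adm K (pd i ψ) :=
  ⟨contDiff_pd h.1, h.2.1.fderiv_apply ℝ _, (tsupport_pd i ψ).trans h.2.2⟩

lemma Adm.add {K : Set E3} {ψ χ : E3 → ℝ} (h : Adm K ψ) (h' : Adm K χ) : Adm K (fun x => ψ x + χ x) :=
  ⟨h.1.add h'.1, h.2.1.add h'.2.1, (tsupport_add ψ χ).trans (union_subset h.2.2 h'.2.2)⟩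

/-- Laplacian -/
def lap (ψ : E3 → ℝ) (x : E3) : ℝ := ∑ i, pd i (pd i ψ) x

lemma Adm.lap {K : Set E3} {ψ : E3 → ℝ} (h : Adm K ψ) : Adm K (lap ψ) := by
  have := (((h.pd 0).pd 0).add ((h.pd 1).pd 1)).add ((h.pd 2).pd 2)
  convert this using 1
  funext x
  simp [_root_.lap, Fin.sum_univ_three]

lemma Adm.mono {K L : Set E3} {ψ : E3 → ℝ} (h : Adm K ψ) (hKL : K ⊆ L) : Adm L ψ :=
  ⟨h.1, h.2.1, h.2.2.trans hKL⟩

lemma jets (K : Set E3) (hK : IsCompact K) : ∃ D : Set (E3 → ℝ), D.Countable ∧ (∀ ψ ∈ D, Adm K ψ) ∧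
    ∀ ψ, Adm K ψ → ∀ ε > 0, ∃ χ ∈ D, ∀ x ∈ K, |ψ x - χ x| ≤ ε ∧ (∀ i, |pd i ψ x - pd i χ x| ≤ ε) ∧
      |lap ψ x - lap χ x| ≤ ε := by
  have : CompactSpace K := isCompact_iff_compactSpace.mp hK
  let W := ℝ × (Fin 3 → ℝ) × ℝ
  have hcont : ∀ ψ, Adm K ψ → Continuous (fun x : K => ((ψ x, fun i => pd i ψ x, lap ψ x) : W)) := by
    intro ψ hψ
    refine Continuous.prodMk (hψ.1.continuous.comp continuous_subtype_val) (Continuous.prodMk ?_ ?_)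
    · exact continuous_pi fun i => (hψ.pd i).1.continuous.comp continuous_subtype_val
    · exact hψ.lap.1.continuous.comp continuous_subtype_val
  let J : {ψ // Adm K ψ} → C(K, W) := fun ψ => ⟨_, hcont ψ.1 ψ.2⟩
  obtain ⟨D, hDs, hDc, hDd⟩ := (TopologicalSpace.IsSeparable.of_separableSpace (range J)).exists_countable_dense_subset
  have : Nonempty {ψ // Adm K ψ} := ⟨⟨fun _ => 0, contDiff_const, HasCompactSupport.zero, by simp [tsupport, Function.support]⟩⟩
  have hDs' : ∀ f, f ∈ D → ∃ ψ, J ψ = f := fun f hf => hDs hf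
  choose! g hg using hDs'
  refine ⟨(fun f => (g f).1) '' D, hDc.image _, ?_, ?_⟩
  · rintro _ ⟨f, hf, rfl⟩
    exact (g f).2
  · intro ψ hψ ε hε
    have h1 : J ⟨ψ, hψ⟩ ∈ closure D := hDd ⟨_, rfl⟩
    obtain ⟨f, hf, hd⟩ := Metric.mem_closure_iff.mp h1 ε hε
    refine ⟨_, ⟨f, hf, rfl⟩, fun x hx => ?_⟩
    have h2 := (ContinuousMap.dist_lt_iff hε).mp hd ⟨x, hx⟩
    rw [← hg f hf] at h2
    have h3 : dist ((ψ x, fun i => pd i ψ x, lap ψ x) : W) ((g f).1 x, fun i => pd i (g f).1 x, lap (g f).1 x) < ε := h2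
    rw [Prod.dist_eq, Prod.dist_eq, max_lt_iff, max_lt_iff] at h3
    obtain ⟨ha, hb, hc⟩ := h3
    refine ⟨ha.le, fun i => ?_, hc.le⟩
    exact ((dist_pi_lt_iff hε).mp hb i).le

lemma ext_dense (K : Set E3) (hK : MeasurableSet K) (f0 f2 : E3 → ℝ) (f1 : E3 → Fin 3 → ℝ) (h0 : IntegrableOn f0 K)
    (h1 : ∀ i, IntegrableOn (fun x => f1 x i) K) (h2 : IntegrableOn f2 K) (ψ : E3 → ℝ) (hψ : Adm K ψ)
    (h : ∀ ε > 0, ∃ χ, Adm K χ ∧ (∀ x ∈ K, |ψ x - χ x| ≤ ε ∧ (∀ i, |pd i ψ x - pd i χ x| ≤ ε) ∧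
      |lap ψ x - lap χ x| ≤ ε) ∧ ∫ x in K, (f0 x * χ x + (∑ i, f1 x i * pd i χ x) + f2 x * lap χ x) = 0) :
    ∫ x in K, (f0 x * ψ x + (∑ i, f1 x i * pd i ψ x) + f2 x * lap ψ x) = 0 := by
  have hint : ∀ χ, Adm K χ → IntegrableOn (fun x => f0 x * χ x + (∑ i, f1 x i * pd i χ x) + f2 x * lap χ x) K := by
    intro χ hχ
    have hb : ∀ {g : E3 → ℝ} {f : E3 → ℝ}, Adm K g → IntegrableOn f K → IntegrableOn (fun x => f x * g x) K := by
      intro g f hg hf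
      obtain ⟨C, hC⟩ := hg.2.1.exists_bound_of_continuous hg.1.continuous
      exact Integrable.mul_bdd (c := C) hf hg.1.continuous.aestronglyMeasurable (ae_of_all _ hC)
    refine ((hb hχ h0).add ?_).add (hb hχ.lap h2)
    exact integrable_finsetSum _ fun i _ => hb (hχ.pd i) (h1 i)
  set I := ∫ x in K, (|f0 x| + (∑ i, |f1 x i|) + |f2 x|) with hI
  have hIint : IntegrableOn (fun x => |f0 x| + (∑ i, |f1 x i|) + |f2 x|) K :=
    (h0.abs.add (integrable_finsetSum _ fun i _ => (h1 i).abs)).add h2.abs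
  have hIpos : 0 ≤ I := by
    apply integral_nonneg; intro x; dsimp only; positivity
  refine abs_eq_zero.mp (le_antisymm (le_of_forall_pos_le_add fun ε hε => ?_) (abs_nonneg _))
  obtain ⟨χ, hχ, hcl, hz⟩ := h (ε / (I + 1)) (by positivity)
  rw [zero_add, ← sub_zero (∫ x in K, _), ← hz, ← integral_sub (hint ψ hψ) (hint χ hχ), ← Real.norm_eq_abs]
  calc _ ≤ ∫ x in K, (ε / (I+1)) * (|f0 x| + (∑ i, |f1 x i|) + |f2 x|) := by
        refine norm_integral_le_of_norm_le (hIint.const_mul _) ?_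
        filter_upwards [ae_restrict_mem hK] with x hx
        obtain ⟨ha, hb, hc⟩ := hcl x hx
        have e : f0 x * ψ x + (∑ i, f1 x i * pd i ψ x) + f2 x * lap ψ x -
          (f0 x * χ x + (∑ i, f1 x i * pd i χ x) + f2 x * lap χ x) =
          f0 x * (ψ x - χ x) + (∑ i, f1 x i * (pd i ψ x - pd i χ x)) + f2 x * (lap ψ x - lap χ x) := by
          simp only [mul_sub, Finset.sum_sub_distrib]; ring
        rw [e, Real.norm_eq_abs]
        refine (abs_add_three _ _ _).trans ?_
        rw [mul_add, mul_add, Finset.mul_sum, abs_mul, abs_mul, mul_comm |f0 x|, mul_comm |f2 x|]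
        gcongr
        refine (Finset.abs_sum_le_sum_abs _ _).trans (Finset.sum_le_sum fun i _ => ?_)
        rw [abs_mul, mul_comm]
        gcongr
        exact hb i
    _ = (ε / (I+1)) * I := by rw [integral_const_mul]
    _ ≤ ε := by
        rw [div_mul_eq_mul_div, div_le_iff₀ (by positivity)]
        nlinarith

lemma slice_zero {Ω : Set E3} {T : ℝ} (f : ST → ℝ) (hf : IntegrableOn f (Ω ×ˢ Ioo 0 T))
    (h : ∀ θ : ℝ → ℝ, ContDiff ℝ smo θ → HasCompactSupport θ → tsupport θ ⊆ Ioo 0 T →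
      ∫ t in Ioo 0 T, θ t * ∫ x in Ω, f (x, t) = 0) :
    ∀ᵐ t ∂(volume.restrict (Ioo 0 T)), ∫ x in Ω, f (x, t) = 0 := by
  have e : (volume.restrict (Ω ×ˢ Ioo 0 T) : Measure (ST)) = (volume.restrict Ω).prod (volume.restrict (Ioo 0 T)) := by
    rw [Measure.prod_restrict]; rfl
  have hi : IntegrableOn (fun t => ∫ x in Ω, f (x, t)) (Ioo 0 T) := by
    have h1 : Integrable f ((volume.restrict Ω).prod (volume.restrict (Ioo 0 T))) := by rw [← e]; exact hf
    exact h1.integral_prod_right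
  rw [ae_restrict_iff' measurableSet_Ioo]
  refine isOpen_Ioo.ae_eq_zero_of_integral_contDiff_smul_eq_zero hi.locallyIntegrableOn ?_
  intro θ h1 h2 h3
  rw [← h θ h1 h2 h3]
  simp only [smul_eq_mul]
  symm
  apply setIntegral_eq_integral_of_forall_compl_eq_zero
  intro t ht
  rw [image_eq_zero_of_notMem_tsupport (fun hh => ht (h3 hh)), zero_mul]

lemma fub {Ω : Set E3} {I : Set ℝ} (f : ST → ℝ) (hf : IntegrableOn f (Ω ×ˢ I)) :
    ∫ z in Ω ×ˢ I, f z = ∫ t in I, ∫ x in Ω, f (x, t) := by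
  have e : (volume.restrict (Ω ×ˢ I) : Measure (ST)) = (volume.restrict Ω).prod (volume.restrict I) := by
    rw [Measure.prod_restrict]; rfl
  have h1 : Integrable f ((volume.restrict Ω).prod (volume.restrict I)) := by rw [← e]; exact hf
  rw [e, integral_prod_symm _ h1]
end

section
lemma hasFDerivAt_sep {θ : ℝ → ℝ} {ψ : E3 → ℝ} (hθ : ContDiff ℝ smo θ) (hψ : ContDiff ℝ smo ψ) (z : ST) (w : ST) :
    fderiv ℝ (fun z : ST => θ z.2 * ψ z.1) z w = θ z.2 * fderiv ℝ ψ z.1 w.1 + deriv θ z.2 * ψ z.1 * w.2 := by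
  have h1 : HasFDerivAt (fun z : ST => ψ z.1) ((fderiv ℝ ψ z.1).comp (ContinuousLinearMap.fst ℝ E3 ℝ)) z :=
    ((hψ.differentiable (by simp)) z.1).hasFDerivAt.comp z hasFDerivAt_fst
  have h2 : HasFDerivAt (fun z : ST => θ z.2) ((ContinuousLinearMap.toSpanSingleton ℝ (deriv θ z.2)).comp (ContinuousLinearMap.snd ℝ E3 ℝ)) z :=
    ((hθ.differentiable (by simp)) z.2).hasDerivAt.hasFDerivAt.comp z hasFDerivAt_snd
  have h3 : fderiv ℝ (fun z : ST => θ z.2 * ψ z.1) z = _ := (h2.mul h1).fderiv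
  rw [h3]
  simp
  ring

lemma sdz_sep {θ : ℝ → ℝ} {ψ : E3 → ℝ} (hθ : ContDiff ℝ smo θ) (hψ : ContDiff ℝ smo ψ) (z : ST) (i : Fin 3) :
    sdz (fun z : ST => θ z.2 * ψ z.1) i z = θ z.2 * pd i ψ z.1 := by
  rw [sdz, hasFDerivAt_sep hθ hψ]; simp [pd]

lemma tdz_sep {θ : ℝ → ℝ} {ψ : E3 → ℝ} (hθ : ContDiff ℝ smo θ) (hψ : ContDiff ℝ smo ψ) (z : ST) :
    tdz (fun z : ST => θ z.2 * ψ z.1) z = deriv θ z.2 * ψ z.1 := by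
  rw [tdz, hasFDerivAt_sep hθ hψ]; simp

lemma fderiv_coord {φ : ST → E3} (hφ : ContDiff ℝ smo φ) (z w : ST) (i : Fin 3) :
    fderiv ℝ φ z w i = fderiv ℝ (fun z => φ z i) z w := by
  have h := ((hφ.differentiable (by simp)) z).hasFDerivAt
  have := ((EuclideanSpace.proj i : E3 →L[ℝ] ℝ).hasFDerivAt.comp z h).fderiv
  change _ = fderiv ℝ ((EuclideanSpace.proj i : E3 →L[ℝ] ℝ) ∘ φ) z w
  rw [this]
  rfl

lemma sep_contDiff {θ : ℝ → ℝ} {ψ : E3 → ℝ} (hθ : ContDiff ℝ smo θ) (hψ : ContDiff ℝ smo ψ) :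
    ContDiff ℝ smo (fun z : ST => θ z.2 * ψ z.1) :=
  (hθ.comp contDiff_snd).mul (hψ.comp contDiff_fst)

lemma sep_tsupport {θ : ℝ → ℝ} {ψ : E3 → ℝ} :
    tsupport (fun z : ST => θ z.2 * ψ z.1) ⊆ tsupport ψ ×ˢ tsupport θ := by
  apply closure_minimal _ ((isClosed_tsupport _).prod (isClosed_tsupport _))
  intro z hz
  simp only [Function.mem_support] at hz
  exact ⟨subset_closure (right_ne_zero_of_mul hz), subset_closure (left_ne_zero_of_mul hz)⟩

lemma sep_compact {θ : ℝ → ℝ} {ψ : E3 → ℝ} (hθ : HasCompactSupport θ) (hψ : HasCompactSupport ψ) :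
    HasCompactSupport (fun z : ST => θ z.2 * ψ z.1) :=
  IsCompact.of_isClosed_subset (hψ.isCompact.prod hθ.isCompact) (isClosed_tsupport _) sep_tsupport

section sol
variable {Ω : Set E3} {T : ℝ} {v : ST → E3} {Dv : ST → Fin 3 → Fin 3 → ℝ} {p : ST → ℝ} {v₀ : E3 → E3}

lemma abs_coord_le (w : E3) (i : Fin 3) : |w i| ≤ ‖w‖ := by
  simpa using PiLp.norm_apply_le w i

lemma sq_le_sum (G : Fin 3 → Fin 3 → ℝ) (i j : Fin 3) : (G i j)^2 ≤ ∑ i, ∑ j, (G i j)^2 := by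
  refine le_trans ?_ (Finset.single_le_sum (f := fun i => ∑ j, (G i j)^2) (fun i _ => by positivity) (Finset.mem_univ i))
  exact Finset.single_le_sum (f := fun j => (G i j)^2) (fun i _ => by positivity) (Finset.mem_univ j)

lemma le_one_rpow (x : ℝ) (hx : 0 ≤ x) (q : ℝ) (hq : 1 ≤ q) : x ≤ 1 + x ^ q := by
  rcases le_total x 1 with h | h
  · have := Real.rpow_nonneg hx q; linarith
  · have := Real.rpow_le_rpow_of_exponent_le h hq
    rw [Real.rpow_one] at this; linarith

lemma ints (hsol : IsSuitableWeakSolution Ω T v Dv p v₀) (K : Set E3) (hK : IsCompact K) (hKΩ : K ⊆ Ω) :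
    (∀ j, IntegrableOn (fun z => v z j) (K ×ˢ Ioo 0 T)) ∧
    (∀ i j, IntegrableOn (fun z => Dv z i j) (K ×ˢ Ioo 0 T)) ∧
    (∀ i j k, IntegrableOn (fun z => v z k * Dv z i j) (K ×ˢ Ioo 0 T)) ∧
    IntegrableOn p (K ×ˢ Ioo 0 T) := by
  have hsub : K ×ˢ Ioo 0 T ⊆ Ω ×ˢ Ioo 0 T := prod_mono hKΩ subset_rfl
  have hfin : IsFiniteMeasure (volume.restrict (K ×ˢ Ioo (0:ℝ) T) : Measure (ST)) := by
    constructor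
    rw [Measure.restrict_apply_univ, Measure.volume_eq_prod, Measure.prod_prod]
    exact mul_lt_top hK.measure_lt_top (by simp)
  have h1 := hsol.v_l2_w12.mono_set hsub
  have h2 := hsol.p_l32.mono_set hsub
  have mv := hsol.meas_v
  have mD := hsol.meas_Dv
  have mp := hsol.meas_p
  have mvj : ∀ j, Measurable (fun z => v z j) := fun j => by fun_prop
  have mDj : ∀ i j, Measurable (fun z => Dv z i j) := fun i j => by fun_prop
  have hc : IntegrableOn (fun _ => (1:ℝ)) (K ×ˢ Ioo 0 T) (volume : Measure (ST)) := integrable_const _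
  have hD0 : ∀ z, 0 ≤ ∑ i, ∑ j, (Dv z i j)^2 := fun z => by positivity
  refine ⟨fun j => ?_, fun i j => ?_, fun i j k => ?_, ?_⟩
  · refine Integrable.mono' (hc.add h1) (mvj j).aestronglyMeasurable (ae_of_all _ fun z => ?_)
    have := abs_coord_le (v z) j
    have := hD0 z
    simp only [Pi.add_apply, Real.norm_eq_abs]
    nlinarith [sq_nonneg (‖v z‖ - 1), norm_nonneg (v z)]
  · refine Integrable.mono' (hc.add h1) (mDj i j).aestronglyMeasurable (ae_of_all _ fun z => ?_)
    have := sq_le_sum (Dv z) i j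
    simp only [Pi.add_apply, Real.norm_eq_abs]
    nlinarith [sq_nonneg (|Dv z i j| - 1), norm_nonneg (v z), sq_abs (Dv z i j)]
  · refine Integrable.mono' h1 ((mvj k).mul (mDj i j)).aestronglyMeasurable (ae_of_all _ fun z => ?_)
    have := sq_le_sum (Dv z) i j
    have := abs_coord_le (v z) k
    rw [Real.norm_eq_abs, abs_mul]
    nlinarith [sq_nonneg (|Dv z i j| - |v z k|), norm_nonneg (v z), sq_abs (Dv z i j), abs_nonneg (v z k), abs_nonneg (Dv z i j)]
  · refine Integrable.mono' (hc.add h2) mp.aestronglyMeasurable (ae_of_all _ fun z => ?_)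
    exact le_one_rpow _ (abs_nonneg _) _ (by norm_num)

lemma int_mul_adm {K : Set E3} {g : E3 → ℝ} {f : ST → ℝ} {I : Set ℝ} (hg : Adm K g) (hf : IntegrableOn f (K ×ˢ I)) :
    IntegrableOn (fun z => f z * g z.1) (K ×ˢ I) := by
  obtain ⟨C, hC⟩ := hg.2.1.exists_bound_of_continuous hg.1.continuous
  exact Integrable.mul_bdd (c := C) hf (hg.1.continuous.comp continuous_fst).aestronglyMeasurable (ae_of_all _ fun z => hC _)

lemma int_mul_adm' {K : Set E3} {g : E3 → ℝ} {f : E3 → ℝ} (hg : Adm K g) (hf : IntegrableOn f K) :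
    IntegrableOn (fun z => f z * g z) K := by
  obtain ⟨C, hC⟩ := hg.2.1.exists_bound_of_continuous hg.1.continuous
  exact Integrable.mul_bdd (c := C) hf hg.1.continuous.aestronglyMeasurable (ae_of_all _ fun z => hC _)

lemma int_mul_time {K : Set E3} {g : ℝ → ℝ} {f : ST → ℝ} {I : Set ℝ} (hg : Continuous g) (hc : HasCompactSupport g) (hf : IntegrableOn f (K ×ˢ I)) :
    IntegrableOn (fun z => g z.2 * f z) (K ×ˢ I) := by
  obtain ⟨C, hC⟩ := hc.exists_bound_of_continuous hg
  exact Integrable.bdd_mul (c := C) hf (hg.comp continuous_snd).aestronglyMeasurable (ae_of_all _ fun z => hC _)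

lemma Adm.zero {K : Set E3} {g : E3 → ℝ} (hg : Adm K g) {x : E3} (hx : x ∉ K) : g x = 0 :=
  image_eq_zero_of_notMem_tsupport (fun hh => hx (hg.2.2 hh))

lemma dv_one (hΩ : IsOpen Ω) (hsol : IsSuitableWeakSolution Ω T v Dv p v₀) (K : Set E3) (hK : IsCompact K) (hKΩ : K ⊆ Ω)
    (ψ : E3 → ℝ) (hψ : Adm K ψ) :
    ∀ᵐ t ∂(volume.restrict (Ioo 0 T)), ∫ x in K, ∑ i, v (x, t) i * pd i ψ x = 0 := by
  obtain ⟨iv, iD, iF, ip⟩ := ints hsol K hK hKΩ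
  have hi : IntegrableOn (fun z : ST => ∑ i, v z i * pd i ψ z.1) (K ×ˢ Ioo 0 T) :=
    integrable_finsetSum _ fun i _ => int_mul_adm (hψ.pd i) (iv i)
  refine slice_zero (fun z => ∑ i, v z i * pd i ψ z.1) hi ?_
  intro θ h1 h2 h3
  have hd := hsol.div_free (fun z => θ z.2 * ψ z.1) (sep_contDiff h1 hψ.1) (sep_compact h2 hψ.2.1)
    (sep_tsupport.trans (prod_mono (hψ.2.2.trans hKΩ) h3))
  simp only [sdz_sep h1 hψ.1] at hd
  rw [setIntegral_eq_of_subset_of_forall_sdiff_eq_zero (hΩ.measurableSet.prod measurableSet_Ioo)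
    (prod_mono hKΩ subset_rfl : K ×ˢ Ioo 0 T ⊆ Ω ×ˢ Ioo 0 T)] at hd
  · have e : ∀ z : ST, ∑ i, v z i * (θ z.2 * pd i ψ z.1) = θ z.2 * ∑ i, v z i * pd i ψ z.1 := by
      intro z; rw [Finset.mul_sum]; exact Finset.sum_congr rfl fun i _ => by ring
    simp only [e] at hd
    rw [fub _ (int_mul_time h1.continuous h2 hi)] at hd
    simpa only [integral_const_mul] using hd
  · intro z hz
    refine Finset.sum_eq_zero fun i _ => ?_
    rw [(hψ.pd i).zero (fun hx => hz.2 ⟨hx, hz.1.2⟩)]; simp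

lemma wg_one (hΩ : IsOpen Ω) (hsol : IsSuitableWeakSolution Ω T v Dv p v₀) (K : Set E3) (hKΩ : K ⊆ Ω)
    (ψ : E3 → ℝ) (hψ : Adm K ψ) :
    ∀ᵐ t ∂(volume.restrict (Ioo 0 T)), ∀ i j, ∫ x in K, v (x, t) j * pd i ψ x = - ∫ x in K, Dv (x, t) i j * ψ x := by
  filter_upwards [hsol.weak_grad ψ hψ.1 hψ.2.1 (hψ.2.2.trans hKΩ)] with t ht i j
  have := ht i j
  rw [setIntegral_eq_of_subset_of_forall_sdiff_eq_zero hΩ.measurableSet hKΩ,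
    setIntegral_eq_of_subset_of_forall_sdiff_eq_zero hΩ.measurableSet hKΩ] at this
  · exact this
  · intro z hz; rw [hψ.zero hz.2, mul_zero]
  · intro z hz
    have := (hψ.pd i).zero hz.2
    unfold pd at this
    rw [this, mul_zero]

lemma int_slice {K : Set E3} {I : Set ℝ} {f : ST → ℝ} (hf : IntegrableOn f (K ×ˢ I)) :
    ∀ᵐ t ∂(volume.restrict I), IntegrableOn (fun x => f (x, t)) K := by
  have e : (volume.restrict (K ×ˢ I) : Measure (ST)) = (volume.restrict K).prod (volume.restrict I) := by
    rw [Measure.prod_restrict]; rfl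
  have h1 : Integrable f ((volume.restrict K).prod (volume.restrict I)) := by rw [← e]; exact hf
  exact h1.prod_left_ae

/-- nonlinearity -/
def FF (u : E3) (G : Fin 3 → Fin 3 → ℝ) (i : Fin 3) : ℝ := ∑ j, u j * G j i

lemma pr_one (hΩ : IsOpen Ω) (hsol : IsSuitableWeakSolution Ω T v Dv p v₀) (K : Set E3) (hK : IsCompact K) (hKΩ : K ⊆ Ω)
    (ψ : E3 → ℝ) (hψ : Adm K ψ) :
    ∀ᵐ t ∂(volume.restrict (Ioo 0 T)), ∫ x in K, ((∑ i, (-FF (v (x, t)) (Dv (x, t)) i) * pd i ψ x) + p (x, t) * lap ψ x) = 0 := by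
  obtain ⟨iv, iD, iF, ip⟩ := ints hsol K hK hKΩ
  have iFF : ∀ i, IntegrableOn (fun z => FF (v z) (Dv z) i) (K ×ˢ Ioo 0 T) := fun i =>
    integrable_finsetSum _ fun j _ => iF j i j
  have hiA : IntegrableOn (fun z : ST => ∑ i, v z i * pd i ψ z.1) (K ×ˢ Ioo 0 T) :=
    integrable_finsetSum _ fun i _ => int_mul_adm (hψ.pd i) (iv i)
  have hi1 : IntegrableOn (fun z : ST => ∑ i, FF (v z) (Dv z) i * pd i ψ z.1) (K ×ˢ Ioo 0 T) :=
    integrable_finsetSum _ fun i _ => int_mul_adm (hψ.pd i) (iFF i)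
  have hi2 : IntegrableOn (fun z : ST => ∑ i, ∑ j, Dv z j i * pd j (pd i ψ) z.1) (K ×ˢ Ioo 0 T) :=
    integrable_finsetSum _ fun i _ => integrable_finsetSum _ fun j _ => int_mul_adm ((hψ.pd i).pd j) (iD j i)
  have hi3 : IntegrableOn (fun z : ST => p z * lap ψ z.1) (K ×ˢ Ioo 0 T) := int_mul_adm hψ.lap ip
  have hdiv := dv_one hΩ hsol K hK hKΩ ψ hψ
  have hk : ∀ᵐ t ∂(volume.restrict (Ioo 0 T)), ∫ x in K, ((∑ i, FF (v (x, t)) (Dv (x, t)) i * pd i ψ x)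
      + (∑ i, ∑ j, Dv (x, t) j i * pd j (pd i ψ) x) - p (x, t) * lap ψ x) = 0 := by
    refine slice_zero (fun z : ST => (∑ i, FF (v z) (Dv z) i * pd i ψ z.1)
      + (∑ i, ∑ j, Dv z j i * pd j (pd i ψ) z.1) - p z * lap ψ z.1) ((hi1.add hi2).sub hi3) ?_
    intro θ h1 h2 h3
    set φ : ST → E3 := fun z => WithLp.toLp 2 (fun i => θ z.2 * pd i ψ z.1) with hφ
    have hφi : ∀ i, (fun z => φ z i) = fun z : ST => θ z.2 * pd i ψ z.1 := fun i => rfl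
    have hφc : ContDiff ℝ smo φ := by
      rw [contDiff_euclidean]
      intro i
      exact sep_contDiff h1 (hψ.pd i).1
    have hsup : tsupport φ ⊆ tsupport ψ ×ˢ tsupport θ := by
      apply closure_minimal _ ((isClosed_tsupport _).prod (isClosed_tsupport _))
      intro z hz
      by_contra hcon
      apply hz
      ext i
      rw [mem_prod, not_and_or] at hcon
      change θ z.2 * pd i ψ z.1 = 0
      rcases hcon with h | h
      · rw [image_eq_zero_of_notMem_tsupport (fun hh => h (tsupport_pd i ψ hh)), mul_zero]
      · rw [image_eq_zero_of_notMem_tsupport h, zero_mul]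
    have hw := hsol.weak_nse φ hφc (IsCompact.of_isClosed_subset (hψ.2.1.isCompact.prod h2.isCompact) (isClosed_tsupport _) hsup)
      (hsup.trans (prod_mono (hψ.2.2.trans hKΩ) (h3.trans Ioo_subset_Iio_self)))
    have e1 : ∀ z i, tdz φ z i = deriv θ z.2 * pd i ψ z.1 := by
      intro z i
      rw [tdz, fderiv_coord hφc, hφi i]
      exact tdz_sep h1 (hψ.pd i).1 z
    have e2 : ∀ z i j, sdz φ j z i = θ z.2 * pd j (pd i ψ) z.1 := by
      intro z i j
      rw [sdz, fderiv_coord hφc, hφi i]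
      exact sdz_sep h1 (hψ.pd i).1 z j
    have e3 : ∀ z i, φ z i = θ z.2 * pd i ψ z.1 := fun z i => rfl
    have e0 : θ 0 = 0 := image_eq_zero_of_notMem_tsupport (fun hh => by have := (h3 hh).1; simp at this)
    have e4 : ∀ z : ST, (-(∑ i, v z i * tdz φ z i) + (∑ i, ∑ j, v z j * Dv z j i * φ z i)
          + (∑ i, ∑ j, Dv z j i * sdz φ j z i) - p z * ∑ i, sdz φ i z i) =
        (-deriv θ z.2) * (∑ i, v z i * pd i ψ z.1) + θ z.2 * ((∑ i, FF (v z) (Dv z) i * pd i ψ z.1)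
      + (∑ i, ∑ j, Dv z j i * pd j (pd i ψ) z.1) - p z * lap ψ z.1) := by
      intro z
      simp only [e1, e2, e3, FF, lap, Fin.sum_univ_three]
      ring
    simp only [e4] at hw
    simp only [e3, e0, zero_mul, mul_zero, Finset.sum_const_zero, integral_zero] at hw
    rw [setIntegral_eq_of_subset_of_forall_sdiff_eq_zero (hΩ.measurableSet.prod measurableSet_Ioo)
      (prod_mono hKΩ subset_rfl : K ×ˢ Ioo 0 T ⊆ Ω ×ˢ Ioo 0 T)] at hw
    · have h1' : Continuous (fun t => -deriv θ t) := (contDiff_deriv' h1).continuous.neg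
      have h2' : HasCompactSupport (fun t => -deriv θ t) := h2.deriv.neg
      have hA := int_mul_time h1' h2' hiA
      have hB : IntegrableOn (fun z : ST => θ z.2 * ((∑ i, FF (v z) (Dv z) i * pd i ψ z.1)
        + (∑ i, ∑ j, Dv z j i * pd j (pd i ψ) z.1) - p z * lap ψ z.1)) (K ×ˢ Ioo 0 T) :=
        int_mul_time h1.continuous h2 ((hi1.add hi2).sub hi3)
      rw [integral_add hA hB, fub _ hA] at hw
      have hz : ∫ t in Ioo 0 T, ∫ x in K, -deriv θ t * ∑ i, v (x, t) i * pd i ψ x = 0 := by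
        apply integral_eq_zero_of_ae
        filter_upwards [hdiv] with t ht
        rw [integral_const_mul, ht, mul_zero]; rfl
      simp only at hw
      rw [hz, zero_add, fub _ hB] at hw
      simpa only [integral_const_mul] using hw
    · intro z hz
      have hx : z.1 ∉ K := fun hx => hz.2 ⟨hx, hz.1.2⟩
      simp [(hψ.pd _).zero hx, ((hψ.pd _).pd _).zero hx, hψ.lap.zero hx]
  have hdl := dv_one hΩ hsol K hK hKΩ _ hψ.lap
  have hwg : ∀ᵐ t ∂(volume.restrict (Ioo 0 T)), ∀ a b : Fin 3, ∀ i j,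
      ∫ x in K, v (x, t) j * pd i (pd a (pd b ψ)) x = - ∫ x in K, Dv (x, t) i j * pd a (pd b ψ) x := by
    rw [ae_all_iff]; intro a; rw [ae_all_iff]; intro b
    exact wg_one hΩ hsol K hKΩ _ ((hψ.pd b).pd a)
  have hs1 : ∀ᵐ t ∂(volume.restrict (Ioo 0 T)), ∀ i j, IntegrableOn (fun x => Dv (x, t) i j) K := by
    rw [ae_all_iff]; intro a; rw [ae_all_iff]; intro b
    exact int_slice (iD a b)
  have hs2 : ∀ᵐ t ∂(volume.restrict (Ioo 0 T)), ∀ i, IntegrableOn (fun x => v (x, t) i) K := by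
    rw [ae_all_iff]; intro a
    exact int_slice (iv a)
  filter_upwards [hk, hdl, hwg, hs1, hs2, int_slice hi1, int_slice hi3] with t tk tdl twg ts1 ts2 ti1 ti3
  have hz : ∫ x in K, ∑ i, ∑ j, Dv (x, t) j i * pd j (pd i ψ) x = 0 := by
    have hcomm : ∀ i j, pd j (pd j (pd i ψ)) = pd i (pd j (pd j ψ)) := by
      intro i j
      rw [pd_comm hψ.1 j i, pd_comm (hψ.pd j).1 j i]
    have hpl : ∀ i x, pd i (lap ψ) x = ∑ j, pd i (pd j (pd j ψ)) x := by
      intro i x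
      unfold lap
      rw [pd, fderiv_fun_sum (fun j _ => (((hψ.pd j).pd j).1.differentiable (by simp)).differentiableAt)]
      simp [pd]
    have e : ∫ x in K, ∑ i, v (x, t) i * pd i (lap ψ) x = ∑ i, ∑ j, ∫ x in K, v (x, t) i * pd i (pd j (pd j ψ)) x := by
      simp only [hpl, Finset.mul_sum]
      rw [integral_finsetSum _ (fun i _ => integrable_finsetSum _ fun j _ => int_mul_adm' (((hψ.pd j).pd j).pd i) (ts2 i))]
      refine Finset.sum_congr rfl fun i _ => ?_
      rw [integral_finsetSum _ (fun j _ => int_mul_adm' (((hψ.pd j).pd j).pd i) (ts2 i))]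
    rw [tdl] at e
    rw [integral_finsetSum _ (fun i _ => integrable_finsetSum _ fun j _ => int_mul_adm' ((hψ.pd i).pd j) (ts1 j i)), ← neg_eq_zero, e, ← Finset.sum_neg_distrib]
    refine Finset.sum_congr rfl fun i _ => ?_
    rw [integral_finsetSum _ (fun j _ => int_mul_adm' ((hψ.pd i).pd j) (ts1 j i)), ← Finset.sum_neg_distrib]
    refine Finset.sum_congr rfl fun j _ => ?_
    rw [← twg j i j i, hcomm]
  have hi2t : IntegrableOn (fun x => ∑ i, ∑ j, Dv (x, t) j i * pd j (pd i ψ) x) K :=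
    integrable_finsetSum _ fun i _ => integrable_finsetSum _ fun j _ => int_mul_adm' ((hψ.pd i).pd j) (ts1 j i)
  have ti12 : IntegrableOn (fun x => (∑ i, FF (v (x, t)) (Dv (x, t)) i * pd i ψ x) + ∑ i, ∑ j, Dv (x, t) j i * pd j (pd i ψ) x) K := ti1.add hi2t
  rw [integral_sub ti12 ti3, integral_add ti1 hi2t, hz] at tk
  have ti1n : IntegrableOn (fun x => -∑ i, FF (v (x, t)) (Dv (x, t)) i * pd i ψ x) K := ti1.neg
  simp only [neg_mul, Finset.sum_neg_distrib]
  rw [integral_add ti1n ti3, integral_neg]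
  linarith

lemma ae_slices (hΩ : IsOpen Ω) (hsol : IsSuitableWeakSolution Ω T v Dv p v₀) (K : Set E3) (hK : IsCompact K) (hKΩ : K ⊆ Ω) :
    ∀ᵐ t ∂(volume.restrict (Ioo 0 T)), (∀ j, IntegrableOn (fun x => v (x, t) j) K) ∧ IntegrableOn (fun x => p (x, t)) K ∧ ∀ ψ, Adm K ψ →
      (∀ i j, ∫ x, v (x, t) j * pd i ψ x = - ∫ x, Dv (x, t) i j * ψ x) ∧
      (∫ x, ∑ i, v (x, t) i * pd i ψ x = 0) ∧
      ∫ x, p (x, t) * lap ψ x = ∫ x, ∑ i, FF (v (x, t)) (Dv (x, t)) i * pd i ψ x := by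
  obtain ⟨iv, iD, iF, ip⟩ := ints hsol K hK hKΩ
  obtain ⟨D, hDc, hDa, hDd⟩ := jets K hK
  have a1 : ∀ᵐ t ∂(volume.restrict (Ioo 0 T)), ∀ ψ ∈ D, ∀ i j, ∫ x in K, v (x, t) j * pd i ψ x = - ∫ x in K, Dv (x, t) i j * ψ x :=
    (ae_ball_iff hDc).mpr fun ψ h => wg_one hΩ hsol K hKΩ ψ (hDa ψ h)
  have a2 : ∀ᵐ t ∂(volume.restrict (Ioo 0 T)), ∀ ψ ∈ D, ∫ x in K, ∑ i, v (x, t) i * pd i ψ x = 0 :=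
    (ae_ball_iff hDc).mpr fun ψ h => dv_one hΩ hsol K hK hKΩ ψ (hDa ψ h)
  have a3 : ∀ᵐ t ∂(volume.restrict (Ioo 0 T)), ∀ ψ ∈ D, ∫ x in K, ((∑ i, (-FF (v (x, t)) (Dv (x, t)) i) * pd i ψ x) + p (x, t) * lap ψ x) = 0 :=
    (ae_ball_iff hDc).mpr fun ψ h => pr_one hΩ hsol K hK hKΩ ψ (hDa ψ h)
  have hs1 : ∀ᵐ t ∂(volume.restrict (Ioo 0 T)), ∀ i j, IntegrableOn (fun x => Dv (x, t) i j) K := by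
    rw [ae_all_iff]; intro a; rw [ae_all_iff]; intro b
    exact int_slice (iD a b)
  have hs2 : ∀ᵐ t ∂(volume.restrict (Ioo 0 T)), ∀ i, IntegrableOn (fun x => v (x, t) i) K := by
    rw [ae_all_iff]; intro a
    exact int_slice (iv a)
  have hs3 : ∀ᵐ t ∂(volume.restrict (Ioo 0 T)), ∀ i, IntegrableOn (fun x => FF (v (x, t)) (Dv (x, t)) i) K := by
    rw [ae_all_iff]; intro a
    exact int_slice (f := fun z => FF (v z) (Dv z) a) (integrable_finsetSum _ fun j _ => iF j a j)
  filter_upwards [a1, a2, a3, hs1, hs2, hs3, int_slice ip] with t t1 t2 t3 ti1 ti2 ti3 ti4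
  refine ⟨ti2, ti4, fun ψ hψ => ?_⟩
  have full : ∀ {f : E3 → ℝ}, (∀ x, x ∉ K → f x = 0) → ∫ x, f x = ∫ x in K, f x := by
    intro f hf
    exact (setIntegral_eq_integral_of_forall_compl_eq_zero hf).symm
  have z0 : IntegrableOn (fun _ : E3 => (0:ℝ)) K := integrable_zero _ _ _
  refine ⟨fun i j => ?_, ?_, ?_⟩
  · rw [full (fun x hx => by rw [(hψ.pd i).zero hx, mul_zero]), full (fun x hx => by rw [hψ.zero hx, mul_zero])]
    have e : ∀ χ x, Dv (x, t) i j * χ x + (∑ k, (if k = i then v (x, t) j else 0) * pd k χ x) + 0 * lap χ x =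
      Dv (x, t) i j * χ x + v (x, t) j * pd i χ x := by intro χ x; simp
    have := ext_dense K hK.measurableSet (fun x => Dv (x, t) i j) (fun _ => 0) (fun x k => if k = i then v (x, t) j else 0) (ti1 i j)
      (fun k => by by_cases hk : k = i <;> simp [hk, ti2 j]) z0 ψ hψ (fun ε hε => by
        obtain ⟨χ, hχ, hc⟩ := hDd ψ hψ ε hε
        refine ⟨χ, hDa χ hχ, hc, ?_⟩
        simp only [e]
        rw [integral_add (int_mul_adm' (hDa χ hχ) (ti1 i j)) (int_mul_adm' ((hDa χ hχ).pd i) (ti2 j)), t1 χ hχ i j, add_neg_cancel])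
    simp only [e] at this
    rw [integral_add (int_mul_adm' hψ (ti1 i j)) (int_mul_adm' (hψ.pd i) (ti2 j))] at this
    linarith
  · rw [full (fun x hx => by simp [(hψ.pd _).zero hx])]
    have := ext_dense K hK.measurableSet (fun _ => 0) (fun _ => 0) (fun x k => v (x, t) k) z0
      ti2 z0 ψ hψ (fun ε hε => by
        obtain ⟨χ, hχ, hc⟩ := hDd ψ hψ ε hε
        refine ⟨χ, hDa χ hχ, hc, ?_⟩
        simpa using t2 χ hχ)
    simpa using this
  · rw [full (fun x hx => by simp [hψ.lap.zero hx]), full (fun x hx => by simp [(hψ.pd _).zero hx])]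
    have := ext_dense K hK.measurableSet (fun _ => 0) (fun x => p (x, t)) (fun x k => -FF (v (x, t)) (Dv (x, t)) k) z0
      (fun i => (ti3 i).neg) ti4 ψ hψ (fun ε hε => by
        obtain ⟨χ, hχ, hc⟩ := hDd ψ hψ ε hε
        refine ⟨χ, hDa χ hχ, hc, ?_⟩
        simpa using t3 χ hχ)
    simp only [zero_mul, zero_add, neg_mul, Finset.sum_neg_distrib] at this
    have i1 : IntegrableOn (fun x => ∑ i, FF (v (x, t)) (Dv (x, t)) i * pd i ψ x) K :=
      integrable_finsetSum _ fun i _ => int_mul_adm' (hψ.pd i) (ti3 i)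
    have i1n : IntegrableOn (fun x => -∑ i, FF (v (x, t)) (Dv (x, t)) i * pd i ψ x) K := i1.neg
    rw [integral_add i1n (int_mul_adm' hψ.lap ti4), integral_neg] at this
    linarith

end sol
end

section
lemma sdz_contDiff {φ : ST → ℝ} (hφ : ContDiff ℝ smo φ) (i : Fin 3) : ContDiff ℝ smo (fun w => sdz φ i w) :=
  (hφ.fderiv_right (m := smo) (by simp)).clm_apply contDiff_const

lemma sdz_eq_pd {φ : ST → ℝ} (hφ : ContDiff ℝ smo φ) (i : Fin 3) (x : E3) (t : ℝ) :
    sdz φ i (x, t) = pd i (fun y => φ (y, t)) x := by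
  have h := ((hφ.differentiable (by simp)) (x, t)).hasFDerivAt.comp x (hasFDerivAt_prodMk_left (𝕜 := ℝ) x t)
  have h' : fderiv ℝ (fun y => φ (y, t)) x = _ := h.fderiv
  rw [pd, h']
  simp [sdz]

lemma tdz_eq_deriv {φ : ST → ℝ} (hφ : ContDiff ℝ smo φ) (x : E3) (t : ℝ) :
    tdz φ (x, t) = deriv (fun s => φ (x, s)) t := by
  have h := ((hφ.differentiable (by simp)) (x, t)).hasFDerivAt.comp t (hasFDerivAt_prodMk_right (𝕜 := ℝ) x t)
  have h' : fderiv ℝ (fun y => φ (x, y)) t = _ := h.fderiv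
  rw [← fderiv_apply_one_eq_deriv, h']
  simp [tdz]

/-- cutoff profile -/
def be (y : ℝ) : ℝ := Real.smoothTransition ((1/16 - y) * (64/3))

lemma be_contDiff : ContDiff ℝ smo be :=
  Real.smoothTransition.contDiff.comp ((contDiff_const.sub contDiff_id).mul contDiff_const)

lemma be_nonneg (y : ℝ) : 0 ≤ be y := Real.smoothTransition.nonneg _
lemma be_le_one (y : ℝ) : be y ≤ 1 := Real.smoothTransition.le_one _
lemma be_one {y : ℝ} (h : y ≤ 1/64) : be y = 1 := Real.smoothTransition.one_of_one_le (by linarith)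
lemma be_zero {y : ℝ} (h : 1/16 ≤ y) : be y = 0 := Real.smoothTransition.zero_of_nonpos (by linarith)

lemma be'_zero {y : ℝ} (h : y < 1/64 ∨ 1/16 < y) : deriv be y = 0 := by
  rcases h with h | h
  · have : be =ᶠ[nhds y] fun _ => 1 := by
      filter_upwards [gt_mem_nhds h] with t ht using be_one (le_of_lt ht)
    rw [this.deriv_eq, deriv_const]
  · have : be =ᶠ[nhds y] fun _ => 0 := by
      filter_upwards [lt_mem_nhds h] with t ht using be_zero (le_of_lt ht)
    rw [this.deriv_eq, deriv_const]

lemma be''_zero {y : ℝ} (h : y < 1/64 ∨ 1/16 < y) : deriv (deriv be) y = 0 := by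
  have : deriv be =ᶠ[nhds y] fun _ => 0 := by
    rcases h with h | h
    · filter_upwards [gt_mem_nhds h] with t ht using be'_zero (Or.inl ht)
    · filter_upwards [lt_mem_nhds h] with t ht using be'_zero (Or.inr ht)
  rw [this.deriv_eq, deriv_const]

lemma be_bounds : ∃ B, 0 < B ∧ ∀ y, |deriv be y| ≤ B ∧ |deriv (deriv be) y| ≤ B := by
  have c1 := (contDiff_deriv' be_contDiff)
  have c2 := (contDiff_deriv' c1).continuous
  obtain ⟨C, hC⟩ := (isCompact_Icc (a := (1/64:ℝ)) (b := 1/16)).exists_bound_of_continuousOn c1.continuous.continuousOn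
  obtain ⟨C', hC'⟩ := (isCompact_Icc (a := (1/64:ℝ)) (b := 1/16)).exists_bound_of_continuousOn c2.continuousOn
  refine ⟨max 1 (max C C'), by positivity, fun y => ?_⟩
  by_cases h : y ∈ Icc (1/64:ℝ) (1/16)
  · exact ⟨(hC y h).trans (by simp), (hC' y h).trans (by simp)⟩
  · have : y < 1/64 ∨ 1/16 < y := by
      rw [mem_Icc, not_and_or, not_le, not_le] at h; exact h
    rw [be'_zero this, be''_zero this]
    simp

lemma deriv_mul_exp {g : ℝ → ℝ} (hg : ContDiff ℝ smo g) (c : ℝ) :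
    deriv (fun s => g s * Real.exp (-(s / c))) = fun s => (deriv g s - g s / c) * Real.exp (-(s / c)) := by
  funext s
  have h := (hasDerivAt_of_smooth hg s).mul (((hasDerivAt_id s).div_const c).neg.exp)
  refine HasDerivAt.deriv (f := fun s => g s * Real.exp (-(s / c))) (h.congr_deriv ?_)
  simp only [id, Pi.neg_apply]
  ring

lemma deriv2_mul_exp {g : ℝ → ℝ} (hg : ContDiff ℝ smo g) (c : ℝ) :
    deriv (deriv (fun s => g s * Real.exp (-(s / c)))) =
      fun s => (deriv (deriv g) s - 2 * deriv g s / c + g s / c ^ 2) * Real.exp (-(s / c)) := by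
  have h1 := contDiff_deriv' hg
  rw [deriv_mul_exp hg, deriv_mul_exp (g := fun s => deriv g s - g s / c) (h1.sub (hg.div_const c))]
  funext s
  have : deriv (fun s => deriv g s - g s / c) s = deriv (deriv g) s - deriv g s / c :=
    ((hasDerivAt_of_smooth h1 s).sub ((hasDerivAt_of_smooth hg s).div_const c)).deriv
  rw [this]
  ring

lemma exp_cube {y : ℝ} (hy : 0 ≤ y) : (1 + 4 * y) ^ 3 * Real.exp (-y) ≤ 1728 := by
  have h1 : 1 + y / 3 ≤ Real.exp (y / 3) := by have := Real.add_one_le_exp (y/3); linarith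
  have h2 : (1 + y / 3) ^ 3 ≤ Real.exp y := by
    calc _ ≤ Real.exp (y/3) ^ 3 := by gcongr
      _ = Real.exp y := by rw [← Real.exp_nat_mul]; congr 1; push_cast; ring
  have h3 : (1 + 4 * y) ^ 3 ≤ (12 * (1 + y / 3)) ^ 3 := by gcongr; linarith
  rw [Real.exp_neg, ← div_eq_mul_inv, div_le_iff₀ (Real.exp_pos _)]
  nlinarith

/-- Gaussian-type kernel -/
def PP (τ s : ℝ) : ℝ := ((Real.sqrt τ)⁻¹) ^ 3 * Real.exp (-(s / (4 * τ)))

lemma PP_nonneg (τ s : ℝ) : 0 ≤ PP τ s := by unfold PP; positivity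

lemma PP_bound {τ s : ℝ} (hτ : 0 < τ) (hs : 0 ≤ s) :
    ((s + τ) / τ) * PP τ s ≤ 1728 * ((Real.sqrt (s + τ))⁻¹) ^ 3 := by
  have hw : 0 < s + τ := by positivity
  set ρ := Real.sqrt τ with hρ
  set w := Real.sqrt (s + τ) with hw'
  have hρ0 : 0 < ρ := Real.sqrt_pos.2 hτ
  have hw0 : 0 < w := Real.sqrt_pos.2 hw
  have e1 : ρ ^ 2 = τ := Real.sq_sqrt hτ.le
  have e2 : w ^ 2 = s + τ := Real.sq_sqrt hw.le
  have hle : 1 ≤ w / ρ := by rw [one_le_div hρ0]; exact Real.sqrt_le_sqrt (by linarith)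
  have h := exp_cube (y := s / (4 * τ)) (by positivity)
  have e3 : 1 + 4 * (s / (4 * τ)) = (w / ρ) ^ 2 := by
    rw [div_pow, e1, e2]; field_simp; ring
  have e4 : (s + τ) / τ = (w/ρ) ^ 2 := by rw [div_pow, e1, e2]
  have e5 : (ρ⁻¹) ^ 3 = (w/ρ) ^ 3 * (w⁻¹) ^ 3 := by field_simp
  rw [e3] at h
  rw [e4, PP, ← hρ, e5]
  calc _ = ((w / ρ) ^ 5 * Real.exp (-(s / (4 * τ)))) * (w⁻¹) ^ 3 := by ring
    _ ≤ (((w / ρ) ^ 2) ^ 3 * Real.exp (-(s / (4 * τ)))) * (w⁻¹) ^ 3 := by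
        rw [← pow_mul]
        gcongr
        norm_num
    _ ≤ _ := by gcongr

lemma PP_bound' {τ s a : ℝ} (hτ : 0 < τ) (hs : 0 ≤ s) (ha : 0 < a) (h : a ^ 2 ≤ s + τ) :
    PP τ s ≤ 1728 * (a ^ 3)⁻¹ ∧ (s / τ) * PP τ s ≤ 1728 * (a ^ 3)⁻¹ ∧
    Real.sqrt s / τ * PP τ s ≤ 1728 * (a ^ 4)⁻¹ := by
  have hb := PP_bound hτ hs
  have hP := PP_nonneg τ s
  have h1 : a ≤ Real.sqrt (s + τ) := Real.le_sqrt_of_sq_le h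
  have h2 : ((Real.sqrt (s + τ))⁻¹) ^ 3 ≤ (a ^ 3)⁻¹ := by
    rw [← inv_pow]; gcongr
  have hst : s / τ + 1 = (s + τ) / τ := by field_simp
  have hq : 0 ≤ s / τ := by positivity
  rw [← hst] at hb
  refine ⟨by nlinarith, by nlinarith, ?_⟩
  have hw : 0 < Real.sqrt (s + τ) := ha.trans_le h1
  have h3 : Real.sqrt s / τ ≤ (s / τ + 1) * (Real.sqrt (s + τ))⁻¹ := by
    rw [hst, div_mul_eq_mul_div]
    gcongr
    rw [← div_eq_mul_inv, Real.div_sqrt]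
    exact Real.sqrt_le_sqrt (by linarith)
  calc _ ≤ (s / τ + 1) * (Real.sqrt (s + τ))⁻¹ * PP τ s := by gcongr
    _ = ((s / τ + 1) * PP τ s) * (Real.sqrt (s + τ))⁻¹ := by ring
    _ ≤ (1728 * (a ^ 3)⁻¹) * a⁻¹ := by
        have h5 : (s / τ + 1) * PP τ s ≤ 1728 * (a ^ 3)⁻¹ := by linarith
        have h6 : (Real.sqrt (s + τ))⁻¹ ≤ a⁻¹ := by gcongr
        exact mul_le_mul h5 h6 (by positivity) (by positivity)
    _ = _ := by rw [mul_assoc, ← mul_inv]; ring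

/-- time variable -/
def tau (r t0 t : ℝ) : ℝ := r ^ 2 * ll (1 + (t0 - t) / r ^ 2)

lemma tau_pos {r : ℝ} (hr : 0 < r) (t0 t : ℝ) : 0 < tau r t0 t := mul_pos (by positivity) (ll_pos _)

lemma tau_eq {r t0 t : ℝ} (hr : 0 < r) (h : t ≤ t0) : tau r t0 t = r ^ 2 + (t0 - t) := by
  rw [tau, ll_of_one_le]
  · field_simp
  · have : 0 ≤ (t0 - t) / r ^ 2 := div_nonneg (by linarith) (by positivity)
    linarith

lemma tau_contDiff (r t0 : ℝ) : ContDiff ℝ smo (tau r t0) :=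
  contDiff_const.mul (ll_contDiff.comp (contDiff_const.add ((contDiff_const.sub contDiff_id).div_const _)))

/-- time cutoff -/
def bt (R t0 t : ℝ) : ℝ := be ((t - t0) ^ 2 / R ^ 4)

lemma bt_contDiff (R t0 : ℝ) : ContDiff ℝ smo (bt R t0) :=
  be_contDiff.comp (((contDiff_id.sub contDiff_const).pow 2).div_const _)

lemma bt_zero {R t0 t : ℝ} (hR : 0 < R) (h : R ^ 2 / 4 ≤ |t - t0|) : bt R t0 t = 0 := by
  apply be_zero
  rw [le_div_iff₀ (by positivity), ← sq_abs (t - t0)]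
  calc _ = (R^2/4)^2 := by ring
    _ ≤ _ := by gcongr

lemma bt_one {R t0 t : ℝ} (hR : 0 < R) (h : |t - t0| ≤ R ^ 2 / 8) : bt R t0 t = 1 := by
  apply be_one
  rw [div_le_iff₀ (by positivity), ← sq_abs (t - t0)]
  calc _ ≤ (R^2/8)^2 := by gcongr
    _ = _ := by ring

lemma bt_deriv {B : ℝ} (hB : ∀ y, |deriv be y| ≤ B) {R t0 t : ℝ} (hR : 0 < R) :
    |deriv (bt R t0) t| ≤ B * (R ^ 2)⁻¹ ∧ (|t - t0| < R ^ 2 / 8 → deriv (bt R t0) t = 0) := by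
  have h : deriv (bt R t0) t = deriv be ((t - t0) ^ 2 / R ^ 4) * (2 * (t - t0) / R ^ 4) := by
    have h1 : HasDerivAt (fun t => (t - t0) ^ 2 / R ^ 4) (2 * (t - t0) / R ^ 4) t := by
      have := (((hasDerivAt_id t).sub_const t0).pow 2).div_const (R ^ 4)
      refine this.congr_deriv ?_
      simp
    exact ((hasDerivAt_of_smooth be_contDiff _).comp t h1).deriv
  have hB0 : 0 ≤ B := (abs_nonneg _).trans (hB 0)
  constructor
  · rw [h, abs_mul]
    by_cases hc : |t - t0| ≤ R ^ 2 / 4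
    · have : |2 * (t - t0) / R ^ 4| ≤ (R^2)⁻¹ := by
        rw [abs_div, abs_mul, abs_of_pos (by positivity : (0:ℝ) < R^4), div_le_iff₀ (by positivity)]
        simp only [abs_two]
        calc 2 * |t - t0| ≤ 2 * (R^2/4) := by gcongr
          _ ≤ R ^ 2 := by nlinarith [sq_nonneg R]
          _ = _ := by field_simp
      gcongr
      exact hB _
    · rw [be'_zero (Or.inr _)]
      · simp; positivity
      · rw [lt_div_iff₀ (by positivity), ← sq_abs (t - t0)]
        calc _ = (R^2/4)^2 := by ring
          _ < _ := by push Not at hc; gcongr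
  · intro hc
    rw [h, be'_zero (Or.inl _), zero_mul]
    rw [div_lt_iff₀ (by positivity), ← sq_abs (t - t0)]
    calc _ < (R^2/8)^2 := by gcongr
      _ = _ := by ring
end

section
/-- radial profile -/
def gk (b e r r' τ s : ℝ) : ℝ := 16 * ((Real.sqrt τ)⁻¹) ^ 3 * (b * be (s / r ^ 2) - e * be (s / r' ^ 2))
/-- radial profile with Gaussian factor -/
def hk (b e r r' τ s : ℝ) : ℝ := gk b e r r' τ s * Real.exp (-(s / (4 * τ)))

lemma be_div_contDiff (a b : ℝ) : ContDiff ℝ smo (fun s => a * be (s / b)) :=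
  contDiff_const.mul (be_contDiff.comp (contDiff_id.div_const _))

lemma gk_contDiff (b e r r' τ : ℝ) : ContDiff ℝ smo (gk b e r r' τ) :=
  contDiff_const.mul ((be_div_contDiff _ _).sub (be_div_contDiff _ _))

lemma hk_contDiff (b e r r' τ : ℝ) : ContDiff ℝ smo (hk b e r r' τ) :=
  (gk_contDiff _ _ _ _ _).mul ((contDiff_id.div_const _).neg.exp)

lemma deriv_gk (b e r r' τ s : ℝ) : deriv (gk b e r r' τ) s = 16 * ((Real.sqrt τ)⁻¹) ^ 3 *
    (b * (r ^ 2)⁻¹ * deriv be (s / r ^ 2) - e * (r' ^ 2)⁻¹ * deriv be (s / r' ^ 2)) := by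
  have h1 := hasDerivAt_of_smooth (be_div_contDiff b (r ^ 2)) s
  have h2 := hasDerivAt_of_smooth (be_div_contDiff e (r' ^ 2)) s
  rw [deriv_comp_div be_contDiff] at h1 h2
  exact ((h1.sub h2).const_mul _).deriv

lemma deriv2_gk0 (b r r' τ s : ℝ) : deriv (deriv (gk b 0 r r' τ)) s = 16 * ((Real.sqrt τ)⁻¹) ^ 3 *
    (b * (r ^ 2)⁻¹ * (r ^ 2)⁻¹ * deriv (deriv be) (s / r ^ 2)) := by
  have h : deriv (gk b 0 r r' τ) = fun s => (16 * ((Real.sqrt τ)⁻¹) ^ 3 * (b * (r ^ 2)⁻¹)) * deriv be (s / r ^ 2) := by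
    funext s
    rw [deriv_gk]; ring
  rw [h, deriv_comp_div (contDiff_deriv' be_contDiff)]
  ring

lemma be'_sqrt {B : ℝ} (hB : ∀ y, |deriv be y| ≤ B) {r s : ℝ} (hr : 0 < r) (hs : 0 ≤ s) :
    Real.sqrt s * ((r ^ 2)⁻¹ * |deriv be (s / r ^ 2)|) ≤ B * r⁻¹ := by
  have hB0 : 0 ≤ B := (abs_nonneg _).trans (hB 0)
  by_cases h : s ≤ r ^ 2
  · have h1 : Real.sqrt s ≤ r := Real.sqrt_le_iff.mpr ⟨hr.le, h⟩
    calc _ ≤ r * ((r ^ 2)⁻¹ * B) := by gcongr; exact hB _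
      _ = _ := by field_simp
  · rw [be'_zero (Or.inr _)]
    · simp; positivity
    · push Not at h
      rw [lt_div_iff₀ (by positivity)]; nlinarith [sq_nonneg r]

lemma grad_slice : ∃ C : ℝ, 0 < C ∧ ∀ θ, 0 < θ → θ ≤ 1 → ∀ r b e τ s, 0 < r → 0 ≤ b → b ≤ 1 → 0 ≤ e → e ≤ 1 → 0 < τ →
    0 ≤ s → (s + τ < (θ * r / 8) ^ 2 → b = e) →
    2 * Real.sqrt s * |deriv (hk b e r (θ * r) τ) s| ≤ C * (θ ^ 4)⁻¹ * (r ^ 4)⁻¹ := by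
  obtain ⟨B, hB, hBb⟩ := be_bounds
  have hB1 : ∀ y, |deriv be y| ≤ B := fun y => (hBb y).1
  refine ⟨32 * 1728 * (2 * B * 512 + 1024), by positivity, ?_⟩
  intro θ hθ hθ1 r b e τ s hr hb hb1 he he1 hτ hs hbe
  have hd : deriv (hk b e r (θ * r) τ) s = (deriv (gk b e r (θ * r) τ) s - gk b e r (θ * r) τ s / (4 * τ)) * Real.exp (-(s / (4 * τ))) := by
    have := deriv_mul_exp (gk_contDiff b e r (θ * r) τ) (4 * τ)
    exact congrFun this s
  rw [hd, deriv_gk, gk]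
  set ρ := ((Real.sqrt τ)⁻¹) ^ 3 with hρ
  have hρ0 : 0 ≤ ρ := by positivity
  have hθr : 0 < θ * r := by positivity
  by_cases hc : s + τ < (θ * r / 8) ^ 2
  · have h1 : s / (θ * r) ^ 2 < 1 / 64 := by rw [div_lt_iff₀ (by positivity)]; nlinarith
    have h2 : s / r ^ 2 < 1 / 64 := by
      refine lt_of_le_of_lt ?_ h1
      gcongr
      nlinarith
    rw [be'_zero (Or.inl h1), be'_zero (Or.inl h2), be_one h1.le, be_one h2.le, hbe hc]
    simp; positivity
  · push Not at hc
    obtain ⟨p1, p2, p3⟩ := PP_bound' hτ hs (by positivity) hc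
    have hP : PP τ s = ρ * Real.exp (-(s / (4 * τ))) := rfl
    have q1 := be'_sqrt hB1 hr hs
    have q2 := be'_sqrt hB1 hθr hs
    have hX : |b * be (s / r ^ 2) - e * be (s / (θ * r) ^ 2)| ≤ 1 := by
      have a1 := mul_nonneg hb (be_nonneg (s / r ^ 2))
      have a2 := mul_nonneg he (be_nonneg (s / (θ * r) ^ 2))
      have a3 := mul_le_one₀ hb1 (be_nonneg (s / r ^ 2)) (be_le_one _)
      have a4 := mul_le_one₀ he1 (be_nonneg (s / (θ * r) ^ 2)) (be_le_one _)
      rw [abs_le]; constructor <;> linarith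
    set X := b * be (s / r ^ 2) - e * be (s / (θ * r) ^ 2) with hXdef
    set D1 := deriv be (s / r ^ 2)
    set D2 := deriv be (s / (θ * r) ^ 2)
    have hS := Real.sqrt_nonneg s
    set S := Real.sqrt s
    have hPn := PP_nonneg τ s
    have hgr : S * |b * (r ^ 2)⁻¹ * D1 - e * ((θ * r) ^ 2)⁻¹ * D2| ≤ 2 * B * (θ * r)⁻¹ := by
      calc _ ≤ S * (|b * (r ^ 2)⁻¹ * D1| + |e * ((θ * r) ^ 2)⁻¹ * D2|) := by gcongr; exact abs_sub _ _
        _ = b * (S * ((r ^ 2)⁻¹ * |D1|)) + e * (S * (((θ * r) ^ 2)⁻¹ * |D2|)) := by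
            rw [abs_mul, abs_mul, abs_mul, abs_mul, abs_of_nonneg hb, abs_of_nonneg he,
              abs_of_nonneg (by positivity : 0 ≤ (r^2)⁻¹), abs_of_nonneg (by positivity : 0 ≤ ((θ * r)^2)⁻¹)]
            ring
        _ ≤ 1 * (B * r⁻¹) + 1 * (B * (θ * r)⁻¹) := by gcongr
        _ ≤ 1 * (B * (θ * r)⁻¹) + 1 * (B * (θ * r)⁻¹) := by gcongr; nlinarith
        _ = _ := by ring
    calc _ = 32 * (S * |(b * (r ^ 2)⁻¹ * D1 - e * ((θ * r) ^ 2)⁻¹ * D2) - X / (4 * τ)|) * PP τ s := by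
          rw [hP, show 16 * ρ * (b * (r ^ 2)⁻¹ * D1 - e * ((θ * r) ^ 2)⁻¹ * D2) - 16 * ρ * X / (4 * τ) =
            (16 * ρ) * ((b * (r ^ 2)⁻¹ * D1 - e * ((θ * r) ^ 2)⁻¹ * D2) - X / (4 * τ)) by ring, abs_mul, abs_mul,
            abs_of_nonneg (by positivity : 0 ≤ 16 * ρ), abs_of_pos (Real.exp_pos _)]
          ring
      _ ≤ 32 * (S * |(b * (r ^ 2)⁻¹ * D1 - e * ((θ * r) ^ 2)⁻¹ * D2)| + S * |X / (4 * τ)|) * PP τ s := by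
          rw [← mul_add]; gcongr; exact abs_sub _ _
      _ ≤ 32 * (2 * B * (θ * r)⁻¹ + (S / τ) / 4) * PP τ s := by
          gcongr
          rw [abs_div, abs_of_pos (by positivity : 0 < 4 * τ)]
          calc _ ≤ S * (1 / (4 * τ)) := by gcongr
            _ = _ := by field_simp
      _ = 32 * (2 * B * (θ * r)⁻¹ * PP τ s + (S / τ * PP τ s) / 4) := by ring
      _ ≤ 32 * (2 * B * (θ * r)⁻¹ * (1728 * ((θ * r / 8) ^ 3)⁻¹) + (1728 * ((θ * r / 8) ^ 4)⁻¹) / 4) := by gcongr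
      _ = _ := by field_simp; ring

lemma heat_slice : ∃ C : ℝ, 0 < C ∧ ∀ R r t0 t s, 0 < R → 0 < r → t < t0 → 0 ≤ s →
    deriv (fun t => hk (bt R t0 t) 0 R R (tau r t0 t) s) t + (6 * deriv (hk (bt R t0 t) 0 R R (tau r t0 t)) s +
      4 * s * deriv (deriv (hk (bt R t0 t) 0 R R (tau r t0 t))) s) ≤ C * (R ^ 5)⁻¹ := by
  obtain ⟨B, hB, hBb⟩ := be_bounds
  have hB1 : ∀ y, |deriv be y| ≤ B := fun y => (hBb y).1
  refine ⟨16 * (13 * B * (1728 * 512)), by positivity, ?_⟩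
  intro R r t0 t s hR hr ht hs
  set τ := tau r t0 t with hτ
  have hτ0 : 0 < τ := tau_pos hr _ _
  have hd1 : deriv (hk (bt R t0 t) 0 R R τ) s = _ := congrFun (deriv_mul_exp (gk_contDiff (bt R t0 t) 0 R R τ) (4 * τ)) s
  have hd2 : deriv (deriv (hk (bt R t0 t) 0 R R τ)) s = _ := congrFun (deriv2_mul_exp (gk_contDiff (bt R t0 t) 0 R R τ) (4 * τ)) s
  have hdt : HasDerivAt (fun t => hk (bt R t0 t) 0 R R (tau r t0 t) s)
      (16 * be (s / R ^ 2) * (deriv (bt R t0) t + bt R t0 t * (3 / (2 * τ) - s / (4 * τ ^ 2))) * PP τ s) t := by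
    have htau : HasDerivAt (tau r t0) (-1) t := by
      have h1 : tau r t0 =ᶠ[nhds t] fun t => r ^ 2 + (t0 - t) := by
        filter_upwards [gt_mem_nhds ht] with u hu using tau_eq hr (le_of_lt hu)
      exact (((hasDerivAt_id t).const_sub t0).const_add _).congr_of_eventuallyEq h1
    have h2 := ((htau.sqrt hτ0.ne').inv (Real.sqrt_pos.2 hτ0).ne').pow 3
    have h3 : HasDerivAt (fun t => -(s / (4 * tau r t0 t))) (-(s / (4 * τ ^ 2))) t := by
      have := ((hasDerivAt_const t s).div (htau.const_mul 4) (by positivity)).neg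
      refine this.congr_deriv ?_
      rw [← hτ]
      field_simp; ring
    have h4 := (hasDerivAt_of_smooth (bt_contDiff R t0) t).mul (h2.mul h3.exp)
    have h5 := h4.const_mul (16 * be (s / R ^ 2))
    have e : (fun t => hk (bt R t0 t) 0 R R (tau r t0 t) s) = fun t => 16 * be (s / R ^ 2) *
      (bt R t0 * (((Real.sqrt ∘ (tau r t0))⁻¹ ^ 3) * fun t => Real.exp (-(s / (4 * tau r t0 t))))) t := by
      funext u
      simp only [hk, gk, Pi.mul_apply, Pi.pow_apply, Pi.inv_apply, Function.comp]
      ring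
    rw [e]
    refine (h5.congr_deriv ?_)
    simp only [← hτ, Pi.mul_apply, Pi.pow_apply, Pi.inv_apply, PP]
    have hsq : Real.sqrt τ ^ 2 = τ := Real.sq_sqrt hτ0.le
    have hs0 := Real.sqrt_pos.2 hτ0
    set ρ := Real.sqrt τ
    clear_value ρ τ
    rw [← hsq]
    norm_num
    field_simp
    ring
  rw [hdt.deriv, hd1, hd2, deriv2_gk0, deriv_gk, gk]
  have hP : PP τ s = ((Real.sqrt τ)⁻¹) ^ 3 * Real.exp (-(s / (4 * τ))) := rfl
  have hPn := PP_nonneg τ s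
  obtain ⟨t1, t2⟩ := bt_deriv hB1 (t0 := t0) (t := t) hR
  have hb0 : 0 ≤ bt R t0 t := be_nonneg _
  have hb1 : bt R t0 t ≤ 1 := be_le_one _
  have hb0' := be_nonneg (s / R ^ 2)
  have hb1' := be_le_one (s / R ^ 2)
  obtain ⟨u1, u2⟩ := hBb (s / R ^ 2)
  have hy : 0 ≤ s / R ^ 2 := by positivity
  have hv : |s / R ^ 2 * deriv (deriv be) (s / R ^ 2)| ≤ B := by
    by_cases h : s / R ^ 2 ≤ 1
    · rw [abs_mul, abs_of_nonneg hy]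
      calc _ ≤ 1 * B := by gcongr
        _ = B := one_mul B
    · push Not at h
      rw [be''_zero (Or.inr (by linarith))]; simp; positivity
  have hzero : s < (R / 8) ^ 2 → deriv be (s / R ^ 2) = 0 ∧ deriv (deriv be) (s / R ^ 2) = 0 := by
    intro h
    have : s / R ^ 2 < 1 / 64 := by rw [div_lt_iff₀ (by positivity)]; nlinarith
    exact ⟨be'_zero (Or.inl this), be''_zero (Or.inl this)⟩
  have htau' : τ = r ^ 2 + (t0 - t) := tau_eq hr ht.le
  have htabs : |t - t0| = t0 - t := by rw [abs_of_neg (by linarith)]; ring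
  set b := bt R t0 t
  set b' := deriv (bt R t0) t
  set β := be (s / R ^ 2)
  set D1 := deriv be (s / R ^ 2)
  set D2 := deriv (deriv be) (s / R ^ 2)
  have key : 16 * β * (b' + b * (3 / (2 * τ) - s / (4 * τ ^ 2))) * PP τ s +
      (6 * ((16 * (Real.sqrt τ)⁻¹ ^ 3 * (b * (R ^ 2)⁻¹ * D1 - 0 * (R ^ 2)⁻¹ * D1) - 16 * (Real.sqrt τ)⁻¹ ^ 3 * (b * β - 0 * β) / (4 * τ)) *
        Real.exp (-(s / (4 * τ)))) + 4 * s * ((16 * (Real.sqrt τ)⁻¹ ^ 3 * (b * (R ^ 2)⁻¹ * (R ^ 2)⁻¹ * D2) -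
        2 * (16 * (Real.sqrt τ)⁻¹ ^ 3 * (b * (R ^ 2)⁻¹ * D1 - 0 * (R ^ 2)⁻¹ * D1)) / (4 * τ) +
        16 * (Real.sqrt τ)⁻¹ ^ 3 * (b * β - 0 * β) / (4 * τ) ^ 2) * Real.exp (-(s / (4 * τ))))) =
      16 * ((β * b' + (R ^ 2)⁻¹ * b * (6 * D1 + 4 * (s / R ^ 2 * D2))) * PP τ s - (R ^ 2)⁻¹ * b * (2 * D1) * (s / τ * PP τ s)) := by
    rw [hP]
    field_simp
    ring
  rw [key]
  by_cases hc : s + τ < (R / 8) ^ 2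
  · obtain ⟨z1, z2⟩ := hzero (by linarith)
    have z3 : b' = 0 := by
      apply t2
      rw [htabs]
      nlinarith [sq_nonneg r, sq_nonneg R]
    rw [z1, z2, z3]
    simp; positivity
  · push Not at hc
    obtain ⟨p1, p2, -⟩ := PP_bound' hτ0 hs (by positivity) hc
    have hR2 : 0 < (R ^ 2)⁻¹ := by positivity
    have n2 : 0 ≤ s / τ * PP τ s := by positivity
    have m1 : β * b' + (R ^ 2)⁻¹ * b * (6 * D1 + 4 * (s / R ^ 2 * D2)) ≤ 11 * B * (R ^ 2)⁻¹ := by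
      have w1 : β * b' ≤ 1 * (B * (R ^ 2)⁻¹) := (mul_le_mul_of_nonneg_left (le_of_abs_le t1) hb0').trans (by gcongr)
      have w2 : 6 * D1 + 4 * (s / R ^ 2 * D2) ≤ 10 * B := by linarith [le_of_abs_le u1, le_of_abs_le hv]
      have w3 : (R ^ 2)⁻¹ * b * (6 * D1 + 4 * (s / R ^ 2 * D2)) ≤ (R ^ 2)⁻¹ * 1 * (10 * B) :=
        (mul_le_mul_of_nonneg_left w2 (by positivity)).trans (by gcongr)
      linarith
    have m2 : -((R ^ 2)⁻¹ * b * (2 * D1)) ≤ 2 * B * (R ^ 2)⁻¹ := by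
      have w2 : -(2 * D1) ≤ 2 * B := by linarith [neg_le_of_abs_le u1]
      have w3 : (R ^ 2)⁻¹ * b * (-(2 * D1)) ≤ (R ^ 2)⁻¹ * 1 * (2 * B) :=
        (mul_le_mul_of_nonneg_left w2 (by positivity)).trans (by gcongr)
      linarith
    calc _ = 16 * ((β * b' + (R ^ 2)⁻¹ * b * (6 * D1 + 4 * (s / R ^ 2 * D2))) * PP τ s + (-((R ^ 2)⁻¹ * b * (2 * D1))) * (s / τ * PP τ s)) := by ring
      _ ≤ 16 * ((11 * B * (R ^ 2)⁻¹) * PP τ s + (2 * B * (R ^ 2)⁻¹) * (s / τ * PP τ s)) := by gcongr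
      _ ≤ 16 * ((11 * B * (R ^ 2)⁻¹) * (1728 * ((R / 8) ^ 3)⁻¹) + (2 * B * (R ^ 2)⁻¹) * (1728 * ((R / 8) ^ 3)⁻¹)) := by gcongr
      _ = _ := by field_simp; ring
end

section
lemma hk_zero {b e r r' τ s : ℝ} (hr : 0 < r) (hr' : 0 < r') (hrr : r' ≤ r) (h : (r / 4) ^ 2 ≤ s) :
    hk b e r r' τ s = 0 := by
  have h1 : be (s / r ^ 2) = 0 := be_zero (by rw [le_div_iff₀ (by positivity)]; linarith)
  have h2 : be (s / r' ^ 2) = 0 := be_zero (by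
    rw [le_div_iff₀ (by positivity)]
    have : r' ^ 2 ≤ r ^ 2 := by gcongr
    linarith)
  simp [hk, gk, h1, h2]

/-- the test function -/
def tf (x0 : E3) (t0 R r : ℝ) (z : ST) : ℝ := hk (bt R t0 z.2) 0 R R (tau r t0 z.2) (‖z.1 - x0‖ ^ 2)
/-- its dyadic pieces -/
def tk (x0 : E3) (t0 R θ : ℝ) (n k : ℕ) (t : ℝ) (x : E3) : ℝ :=
  hk (bt (θ ^ k * R) t0 t) (if k + 1 < n then bt (θ ^ (k + 1) * R) t0 t else 0) (θ ^ k * R) (θ * (θ ^ k * R))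
    (tau (θ ^ n * R) t0 t) (‖x - x0‖ ^ 2)

lemma tf_contDiff {x0 : E3} {t0 R r : ℝ} (hr : 0 < r) : ContDiff ℝ smo (tf x0 t0 R r) := by
  have e : tf x0 t0 R r = fun z : ST => 16 * ((Real.sqrt (tau r t0 z.2))⁻¹) ^ 3 * (bt R t0 z.2 * be (‖z.1 - x0‖ ^ 2 / R ^ 2)) *
      Real.exp (-(‖z.1 - x0‖ ^ 2 / (4 * tau r t0 z.2))) := by
    funext z; simp only [tf, hk, gk]; ring
  rw [e]
  have ht : ContDiff ℝ smo (fun z : ST => tau r t0 z.2) := (tau_contDiff r t0).comp contDiff_snd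
  have hs : ContDiff ℝ smo (fun z : ST => ‖z.1 - x0‖ ^ 2) := (contDiff_fst.sub contDiff_const).norm_sq ℝ
  have hb : ContDiff ℝ smo (fun z : ST => bt R t0 z.2) := (bt_contDiff R t0).comp contDiff_snd
  refine ((contDiff_const.mul (((ht.sqrt fun z => (tau_pos hr _ _).ne').inv
    fun z => (Real.sqrt_pos.2 (tau_pos hr _ _)).ne').pow 3)).mul
    (hb.mul (be_contDiff.comp (hs.div_const _)))).mul ?_
  exact (hs.div (contDiff_const.mul ht) fun z => (mul_pos four_pos (tau_pos hr _ _)).ne').neg.exp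

lemma tf_nonneg (x0 : E3) (t0 R r : ℝ) (z) : 0 ≤ tf x0 t0 R r z := by
  unfold tf hk gk
  have := be_nonneg ((z.2 - t0) ^ 2 / R ^ 4)
  have := be_nonneg (‖z.1 - x0‖ ^ 2 / R ^ 2)
  simp only [zero_mul, sub_zero, bt]; positivity

lemma tf_supp {x0 : E3} {t0 R r : ℝ} (hR : 0 < R) : tsupport (tf x0 t0 R r) ⊆
    closedBall x0 (R / 4) ×ˢ Icc (t0 - R ^ 2 / 4) (t0 + R ^ 2 / 4) := by
  refine closure_minimal ?_ (isClosed_closedBall.prod isClosed_Icc)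
  intro z hz
  rw [Function.mem_support] at hz
  by_contra hc
  apply hz
  simp only [mem_prod, mem_closedBall, dist_eq_norm, mem_Icc, not_and_or, not_le] at hc
  rcases hc with hc | hc
  · exact hk_zero hR hR le_rfl (by gcongr)
  · have : bt R t0 z.2 = 0 := bt_zero hR (by
      rcases hc with hc | hc
      · rw [abs_of_nonpos (by nlinarith)]; linarith
      · rw [abs_of_nonneg (by nlinarith)]; linarith)
    simp [tf, hk, gk, this]

lemma tf_lower {x0 : E3} {t0 R r : ℝ} (hr : 0 < r) (hrR : r ≤ R / 8) {x : E3} {t : ℝ}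
    (hx : x ∈ ball x0 r) (ht : t ∈ Icc (t0 - r ^ 2) t0) : (r ^ 3)⁻¹ ≤ tf x0 t0 R r (x, t) := by
  rw [mem_ball, dist_eq_norm] at hx
  have hR : 0 < R := by linarith
  have hr2 : r ^ 2 ≤ R ^ 2 / 64 := by calc r ^ 2 ≤ (R/8)^2 := by gcongr
                                       _ = _ := by ring
  have hs : ‖x - x0‖ ^ 2 ≤ r ^ 2 := by gcongr
  have h1 : be (‖x - x0‖ ^ 2 / R ^ 2) = 1 := be_one (by rw [div_le_iff₀ (by positivity)]; linarith)
  have h2 : bt R t0 t = 1 := bt_one hR (by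
    rw [abs_of_nonpos (by linarith [ht.2])]; nlinarith [ht.1])
  have h3 : tau r t0 t = r ^ 2 + (t0 - t) := tau_eq hr ht.2
  have h4 : r ^ 2 ≤ tau r t0 t := by linarith [ht.2]
  have h5 : tau r t0 t ≤ (2 * r) ^ 2 := by nlinarith [ht.1]
  have hp := tau_pos hr t0 t
  simp only [tf, hk, gk, h1, h2]
  have h6 : Real.sqrt (tau r t0 t) ≤ 2 * r := Real.sqrt_le_iff.mpr ⟨by positivity, h5⟩
  have h7 : ((2 * r)⁻¹) ≤ (Real.sqrt (tau r t0 t))⁻¹ := inv_anti₀ (Real.sqrt_pos.2 hp) h6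
  have h8 : ‖x - x0‖ ^ 2 / (4 * tau r t0 t) ≤ 1 / 4 := by
    rw [div_le_iff₀ (by positivity)]; linarith
  have h9 : 3 / 4 ≤ Real.exp (-(‖x - x0‖ ^ 2 / (4 * tau r t0 t))) := by
    have := Real.add_one_le_exp (-(‖x - x0‖ ^ 2 / (4 * tau r t0 t))); linarith
  calc (r ^ 3)⁻¹ ≤ 16 * ((2 * r)⁻¹) ^ 3 * (1 * 1) * (3 / 4) := by
        have : 16 * ((2 * r)⁻¹) ^ 3 * (1 * 1) * (3 / 4) = 3 / 2 * (r ^ 3)⁻¹ := by field_simp; norm_num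
        rw [this]
        have : 0 < (r ^ 3)⁻¹ := by positivity
        linarith
    _ ≤ 16 * ((Real.sqrt (tau r t0 t))⁻¹) ^ 3 * (1 * 1) * Real.exp (-(‖x - x0‖ ^ 2 / (4 * tau r t0 t))) := by gcongr
    _ = _ := by ring

lemma tf_heat : ∃ C : ℝ, 0 < C ∧ ∀ (x0 : E3) (t0 R r : ℝ), 0 < R → 0 < r → ∀ x t, t < t0 →
    tdz (tf x0 t0 R r) (x, t) + ∑ i, sdz (fun w => sdz (tf x0 t0 R r) i w) i (x, t) ≤ C * (R ^ 5)⁻¹ := by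
  obtain ⟨C, hC, h⟩ := heat_slice
  refine ⟨C, hC, fun x0 t0 R r hR hr x t ht => ?_⟩
  have hc := tf_contDiff (x0 := x0) (t0 := t0) (R := R) hr
  have e : ∀ i, sdz (fun w => sdz (tf x0 t0 R r) i w) i (x, t) =
      pd i (pd i (fun y => hk (bt R t0 t) 0 R R (tau r t0 t) (‖y - x0‖ ^ 2))) x := by
    intro i
    rw [sdz_eq_pd (sdz_contDiff hc i)]
    have : (fun y => sdz (tf x0 t0 R r) i (y, t)) = pd i (fun y => hk (bt R t0 t) 0 R R (tau r t0 t) (‖y - x0‖ ^ 2)) := by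
      funext y
      rw [sdz_eq_pd hc]; simp only [tf]
    rw [this]
  simp only [e]
  rw [tdz_eq_deriv hc, lap_radial (hk_contDiff _ _ _ _ _)]
  simp only [tf]
  exact h R r t0 t _ hR hr ht (by positivity)

lemma tk_adm {x0 : E3} {t0 R θ : ℝ} (hθ : 0 < θ) (hθ1 : θ ≤ 1) (hR : 0 < R) (n k : ℕ) (t : ℝ) :
    Adm (closedBall x0 (θ ^ k * R / 4)) (tk x0 t0 R θ n k t) := by
  have hr : 0 < θ ^ k * R := by positivity
  have hsub : tsupport (tk x0 t0 R θ n k t) ⊆ closedBall x0 (θ ^ k * R / 4) := by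
    refine closure_minimal ?_ isClosed_closedBall
    intro x hx
    rw [Function.mem_support] at hx
    by_contra hc
    apply hx
    rw [mem_closedBall, dist_eq_norm, not_le] at hc
    exact hk_zero hr (by positivity) (by nlinarith) (by gcongr)
  exact ⟨contDiff_radial (hk_contDiff _ _ _ _ _) x0,
    (isCompact_closedBall _ _).of_isClosed_subset (isClosed_tsupport _) hsub, hsub⟩

lemma tk_zero {x0 : E3} {t0 R θ : ℝ} (hθ : 0 < θ) (hθ1 : θ ≤ 1) (hR : 0 < R) (n k : ℕ) (t : ℝ)
    (h : (θ ^ k * R) ^ 2 / 4 ≤ |t - t0|) (x : E3) : tk x0 t0 R θ n k t x = 0 := by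
  have hr : 0 < θ ^ k * R := by positivity
  have h1 : bt (θ ^ k * R) t0 t = 0 := bt_zero hr h
  have h2 : bt (θ ^ (k + 1) * R) t0 t = 0 := bt_zero (by positivity) (by
    refine le_trans ?_ h
    have : θ ^ (k + 1) * R ≤ θ ^ k * R := by rw [pow_succ]; nlinarith [pow_pos hθ k, mul_pos (pow_pos hθ k) hR]
    gcongr)
  simp [tk, hk, gk, h1, h2]

lemma tk_sum {x0 : E3} {t0 R θ : ℝ} (n : ℕ) (hn : 1 ≤ n) (t : ℝ) (x : E3) :
    tf x0 t0 R (θ ^ n * R) (x, t) = ∑ k ∈ Finset.range n, tk x0 t0 R θ n k t x := by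
  set τ := tau (θ ^ n * R) t0 t with hτ
  set s := ‖x - x0‖ ^ 2 with hs
  set Y : ℕ → ℝ := fun k => (if k < n then bt (θ ^ k * R) t0 t else 0) * be (s / (θ ^ k * R) ^ 2) with hY
  have h1 : ∀ k ∈ Finset.range n, tk x0 t0 R θ n k t x =
      (Y k - Y (k + 1)) * (16 * ((Real.sqrt τ)⁻¹) ^ 3 * Real.exp (-(s / (4 * τ)))) := by
    intro k hk'
    rw [Finset.mem_range] at hk'
    have e : θ * (θ ^ k * R) = θ ^ (k + 1) * R := by ring
    simp only [tk, hk, gk, ← hτ, ← hs, hY, hk', if_true, e]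
    ring
  rw [Finset.sum_congr rfl h1, ← Finset.sum_mul, Finset.sum_range_sub']
  have h0 : Y 0 = bt R t0 t * be (s / R ^ 2) := by simp [hY, show 0 < n from hn]
  have hn' : Y n = 0 := by simp [hY]
  rw [h0, hn']
  simp only [tf, hk, gk, ← hτ, ← hs]
  ring

lemma tk_sdz {x0 : E3} {t0 R θ : ℝ} (hθ : 0 < θ) (hR : 0 < R) (n : ℕ) (hn : 1 ≤ n) (i : Fin 3) (t : ℝ) (x : E3) :
    sdz (tf x0 t0 R (θ ^ n * R)) i (x, t) = ∑ k ∈ Finset.range n, pd i (tk x0 t0 R θ n k t) x := by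
  rw [sdz_eq_pd (tf_contDiff (by positivity))]
  have : (fun y => tf x0 t0 R (θ ^ n * R) (y, t)) = fun y => ∑ k ∈ Finset.range n, tk x0 t0 R θ n k t y :=
    funext fun y => tk_sum n hn t y
  rw [this, pd, fderiv_fun_sum]
  · simp [pd]
  · intro k _
    have : ContDiff ℝ smo (tk x0 t0 R θ n k t) := contDiff_radial (hk_contDiff _ _ _ _ _) x0
    exact this.differentiable (by simp) x

lemma tk_grad : ∃ C : ℝ, 0 < C ∧ ∀ (x0 : E3) (t0 R θ : ℝ), 0 < θ → θ ≤ 1 → 0 < R → ∀ (n k : ℕ), k < n → ∀ t ≤ t0,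
    ∀ i x, |pd i (tk x0 t0 R θ n k t) x| ≤ C * (θ ^ 4)⁻¹ * ((θ ^ k * R) ^ 4)⁻¹ := by
  obtain ⟨C, hC, h⟩ := grad_slice
  refine ⟨C, hC, fun x0 t0 R θ hθ hθ1 hR n k hk' t ht i x => ?_⟩
  have hr : 0 < θ ^ k * R := by positivity
  have hrn : 0 < θ ^ n * R := by positivity
  have e : pd i (tk x0 t0 R θ n k t) x = _ := congrFun (pd_radial (hk_contDiff (bt (θ ^ k * R) t0 t)
    (if k + 1 < n then bt (θ ^ (k + 1) * R) t0 t else 0) (θ ^ k * R) (θ * (θ ^ k * R))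
    (tau (θ ^ n * R) t0 t)) x0 i) x
  rw [e]
  have h1 : |(x - x0) i| ≤ Real.sqrt (‖x - x0‖ ^ 2) := by
    rw [Real.sqrt_sq (norm_nonneg _)]; exact abs_coord_le _ _
  have hτ : tau (θ ^ n * R) t0 t = _ := tau_eq hrn ht
  refine le_trans ?_ (h θ hθ hθ1 (θ ^ k * R) (bt (θ ^ k * R) t0 t) (if k + 1 < n then bt (θ ^ (k + 1) * R) t0 t else 0)
    (tau (θ ^ n * R) t0 t) (‖x - x0‖ ^ 2) hr (be_nonneg _) (be_le_one _) ?_ ?_ (tau_pos hrn _ _) (by positivity) ?_)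
  · rw [abs_mul, abs_mul, abs_two]; gcongr
  · split_ifs
    exacts [be_nonneg _, le_rfl]
  · split_ifs
    exacts [be_le_one _, zero_le_one]
  · intro hlt
    have hx0 : 0 ≤ ‖x - x0‖ ^ 2 := by positivity
    have hlt' : (θ ^ n * R) ^ 2 + (t0 - t) < (θ * (θ ^ k * R) / 8) ^ 2 := by linarith
    have ee : θ * (θ ^ k * R) = θ ^ (k + 1) * R := by ring
    rw [ee] at hlt'
    by_cases hkn : k + 1 < n
    · rw [if_pos hkn]
      have hab : |t - t0| ≤ (θ ^ (k + 1) * R) ^ 2 / 8 := by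
        rw [abs_of_nonpos (by linarith)]; nlinarith [sq_nonneg (θ ^ n * R)]
      rw [bt_one (by positivity) hab, bt_one hr]
      refine hab.trans ?_
      have : θ ^ (k + 1) * R ≤ θ ^ k * R := by rw [pow_succ]; nlinarith [pow_pos hθ k, mul_pos (pow_pos hθ k) hR]
      gcongr
    · exfalso
      have : k + 1 = n := by omega
      rw [this] at hlt'
      nlinarith [sq_nonneg (θ ^ n * R)]
end

section
/-- good slice -/
def SG (K : Set E3) (u : E3 → E3) (G : E3 → Fin 3 → Fin 3 → ℝ) (q : E3 → ℝ) : Prop :=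
  (∀ j, IntegrableOn (fun x => u x j) K) ∧ IntegrableOn (fun x => q x) K ∧ ∀ ψ, Adm K ψ →
    (∀ i j, ∫ x, u x j * pd i ψ x = - ∫ x, G x i j * ψ x) ∧ (∫ x, ∑ i, u x i * pd i ψ x = 0) ∧
    ∫ x, q x * lap ψ x = ∫ x, ∑ i, FF (u x) (G x) i * pd i ψ x

lemma SG.wg {K : Set E3} {u : E3 → E3} {G : E3 → Fin 3 → Fin 3 → ℝ} {q : E3 → ℝ} (h : SG K u G q) {x0 : E3} {r : ℝ}
    (hK : closedBall x0 r ⊆ K) : WG x0 r u G := fun ψ h1 h2 h3 i j =>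
  (h.2.2 ψ ⟨h1, h2, h3.trans (ball_subset_closedBall.trans hK)⟩).1 i j

lemma SG.pe {K : Set E3} {u : E3 → E3} {G : E3 → Fin 3 → Fin 3 → ℝ} {q : E3 → ℝ} (h : SG K u G q) {x0 : E3} {r : ℝ}
    (hK : closedBall x0 r ⊆ K) : PE x0 r q (fun x => FF (u x) (G x)) := fun ψ h1 h2 h3 =>
  (h.2.2 ψ ⟨h1, h2, h3.trans (ball_subset_closedBall.trans hK)⟩).2.2

/-- slice flux bound -/
def HH (C a r : ℝ) (m g : ℝ≥0∞) : ℝ≥0∞ := oR (C * a * r ^ hlf) * g +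
  oR (C * a ^ 2 * r ^ (-(1 / 2) : ℝ)) * g ^ hlf +
  6 * (m ^ (11 / 16 : ℝ) * (oR (C * a ^ (6 / 5 : ℝ) * r ^ (1 / 5 : ℝ)) * (g + oR (a ^ 2 / r ^ 2))) ^ (5 / 16 : ℝ))

lemma fluxS : ∃ C : ℝ, 0 < C ∧ ∀ (x0 : E3) (r : ℝ), 0 < r → ∀ (K : Set E3), closedBall x0 r ⊆ K →
    ∀ (u : E3 → E3) (G : E3 → Fin 3 → Fin 3 → ℝ) (q : E3 → ℝ) (a : ℝ) (m : ℝ≥0∞), 0 ≤ a →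
    Measurable u → Measurable G → Measurable q → SG K u G q →
    ∫⁻ x in ball x0 r, ‖u x‖ₑ ^ 2 ≤ oR (a ^ 2) →
    ∫⁻ x in ball x0 r, gn (G x) ≠ ∞ →
    (∃ c, ∫⁻ x in ball x0 r, ‖q x - c‖ₑ ^ r16 ≤ m) →
    ∃ c : ℝ, ∀ (φ : E3 → ℝ) (L : ℝ), 0 ≤ L → Adm (closedBall x0 (r / 4)) φ → (∀ i x, |pd i φ x| ≤ L) →
      ∫⁻ x, ‖(‖u x‖ ^ 2 + 2 * q x - c) * ∑ i, u x i * pd i φ x‖ₑ ≤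
        oR L * HH C a r m (∫⁻ x in ball x0 r, gn (G x)) := by
  obtain ⟨C1, hC1, h1⟩ := sliceV1
  obtain ⟨C2, hC2, h2⟩ := sliceV2
  refine ⟨3 * C1 + C2, by positivity, fun x0 r hr K hK u G q a m ha hu hG hq hS hua hg hm => ?_⟩
  obtain ⟨c1, hc1⟩ := h1 x0 r hr u G a ha hu hG hua hg (hS.wg hK)
  have hv2 := h2 x0 r hr u G a ha hu hG hua hg (hS.wg hK)
  obtain ⟨c2, hc2⟩ := hm
  set g := ∫⁻ x in ball x0 r, gn (G x)
  refine ⟨‖c1‖ ^ 2 + 2 * c2, fun φ L hL hφ hφL => ?_⟩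
  have hsup : ∀ x, x ∉ ball x0 (r / 2) → ∀ i, pd i φ x = 0 := fun x hx i =>
    (hφ.pd i).zero (fun hh => hx (closedBall_subset_ball (by linarith) hh))
  have hpt : ∀ x, ‖(‖u x‖ ^ 2 + 2 * q x - (‖c1‖ ^ 2 + 2 * c2)) * ∑ i, u x i * pd i φ x‖ₑ ≤
      (ball x0 (r / 2)).indicator (fun x => oR (3 * L) *
        (‖‖u x‖ ^ 2 - ‖c1‖ ^ 2‖ₑ * ‖u x‖ₑ + 2 * (‖q x - c2‖ₑ * ‖u x‖ₑ))) x := by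
    intro x
    by_cases hx : x ∈ ball x0 (r / 2)
    · rw [indicator_of_mem hx]
      have e1 : ‖∑ i, u x i * pd i φ x‖ₑ ≤ oR (3 * L) * ‖u x‖ₑ := by
        rw [← ofReal_norm, ← ofReal_norm, ← ofReal_mul (by positivity)]
        apply ofReal_le_ofReal
        calc _ ≤ ∑ i, ‖u x i * pd i φ x‖ := norm_sum_le _ _
          _ ≤ ∑ i : Fin 3, ‖u x‖ * L := by
              refine Finset.sum_le_sum fun i _ => ?_
              rw [norm_mul, Real.norm_eq_abs, Real.norm_eq_abs]
              gcongr
              exacts [abs_coord_le _ _, hφL i x]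
          _ = _ := by simp; ring
      have e2 : ‖‖u x‖ ^ 2 + 2 * q x - (‖c1‖ ^ 2 + 2 * c2)‖ₑ ≤ ‖‖u x‖ ^ 2 - ‖c1‖ ^ 2‖ₑ + 2 * ‖q x - c2‖ₑ := by
        have : ‖u x‖ ^ 2 + 2 * q x - (‖c1‖ ^ 2 + 2 * c2) = (‖u x‖ ^ 2 - ‖c1‖ ^ 2) + 2 * (q x - c2) := by ring
        rw [this]
        refine (enorm_add_le _ _).trans ?_
        rw [enorm_mul]
        have : ‖(2:ℝ)‖ₑ = 2 := by rw [← ofReal_norm]; simp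
        rw [this]
      rw [enorm_mul]
      calc _ ≤ (‖‖u x‖ ^ 2 - ‖c1‖ ^ 2‖ₑ + 2 * ‖q x - c2‖ₑ) * (oR (3 * L) * ‖u x‖ₑ) := by gcongr
        _ = _ := by ring
    · rw [indicator_of_notMem hx]
      simp [hsup x hx]
  refine (lintegral_mono hpt).trans ?_
  have hm1 : Measurable (fun x => ‖‖u x‖ ^ 2 - ‖c1‖ ^ 2‖ₑ * ‖u x‖ₑ) := by fun_prop
  have hm2 : Measurable (fun x => ‖q x - c2‖ₑ) := by fun_prop
  rw [lintegral_indicator isOpen_ball.measurableSet, lintegral_const_mul' _ _ ofReal_ne_top,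
    lintegral_add_left hm1, lintegral_const_mul' _ _ (by simp)]
  have hh : ∫⁻ x in ball x0 (r / 2), ‖q x - c2‖ₑ * ‖u x‖ₑ ≤ m ^ (11 / 16 : ℝ) *
      (oR (C2 * a ^ (6 / 5 : ℝ) * r ^ (1 / 5 : ℝ)) * (g + oR (a ^ 2 / r ^ 2))) ^ (5 / 16 : ℝ) := by
    have hc : Real.HolderConjugate r16 (16 / 5) := by rw [Real.holderConjugate_iff]; norm_num
    have := lintegral_mul_le_Lp_mul_Lq (volume.restrict (ball x0 (r / 2))) hc
      hm2.aemeasurable hu.enorm.aemeasurable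
    simp only [Pi.mul_apply] at this
    refine this.trans ?_
    rw [show (1 / (16 / 11) : ℝ) = 11 / 16 by norm_num, show (1 / (16 / 5) : ℝ) = 5 / 16 by norm_num]
    gcongr
    exact (lintegral_mono_set (ball_subset_ball (by linarith))).trans hc2
  calc _ ≤ oR (3 * L) * ((oR (C1 * a * r ^ hlf) * g +
        oR (C1 * a ^ 2 * r ^ (-(1 / 2) : ℝ)) * g ^ hlf) + 2 * (m ^ (11 / 16 : ℝ) *
      (oR (C2 * a ^ (6 / 5 : ℝ) * r ^ (1 / 5 : ℝ)) * (g + oR (a ^ 2 / r ^ 2))) ^ (5 / 16 : ℝ))) := by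
        gcongr
    _ = oR L * (oR (3 * C1 * a * r ^ hlf) * g +
        oR (3 * C1 * a ^ 2 * r ^ (-(1 / 2) : ℝ)) * g ^ hlf + 6 * (m ^ (11 / 16 : ℝ) *
      (oR (C2 * a ^ (6 / 5 : ℝ) * r ^ (1 / 5 : ℝ)) * (g + oR (a ^ 2 / r ^ 2))) ^ (5 / 16 : ℝ))) := by
        generalize (m ^ (11 / 16 : ℝ) * (oR (C2 * a ^ (6 / 5 : ℝ) * r ^ (1 / 5 : ℝ)) *
          (g + oR (a ^ 2 / r ^ 2))) ^ (5 / 16 : ℝ)) = W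
        have e1 : oR (3 * L) = 3 * oR L := by
          rw [ofReal_mul (by norm_num)]; simp
        have e2 : ∀ y, oR (3 * C1 * a * y) = 3 * oR (C1 * a * y) := fun y => by
          rw [show 3 * C1 * a * y = 3 * (C1 * a * y) by ring, ofReal_mul (by norm_num)]; simp
        have e3 : ∀ y, oR (3 * C1 * a ^ 2 * y) = 3 * oR (C1 * a ^ 2 * y) := fun y => by
          rw [show 3 * C1 * a ^ 2 * y = 3 * (C1 * a ^ 2 * y) by ring, ofReal_mul (by norm_num)]; simp
        rw [e1, e2, e3]
        ring
    _ ≤ _ := by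
        unfold HH
        gcongr <;> linarith

lemma hold_time {I : Set ℝ} {g : ℝ → ℝ≥0∞} (hg : Measurable g) {e : ℝ} (he : 0 < e) (he1 : e < 1) :
    ∫⁻ t in I, g t ^ e ≤ (∫⁻ t in I, g t) ^ e * (volume I) ^ (1 - e) := by
  have := lintegral_mul_norm_pow_le (μ := volume.restrict I) (f := g) (g := fun _ => 1) hg.aemeasurable
    aemeasurable_const he.le (by linarith : 0 ≤ 1 - e) (by ring)
  simpa using this

/-- nonlinear flux size -/
def Psi (α η π : ℝ) : ℝ := α ^ hlf * η + α * η ^ hlf + π * (α + η) ^ hlf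

lemma Psi_nonneg {α η π : ℝ} (hα : 0 ≤ α) (hη : 0 ≤ η) (hπ : 0 ≤ π) : 0 ≤ Psi α η π := by unfold Psi; positivity

lemma HH_time {C : ℝ} (hC : 0 < C) : ∃ C' : ℝ, 0 < C' ∧ ∀ (r α η π : ℝ), 0 < r → 0 ≤ α → 0 ≤ η → 0 ≤ π → ∀ (I : Set ℝ)
    (m g : ℝ → ℝ≥0∞), Measurable m → Measurable g → volume I = oR (r ^ 2) →
    ∫⁻ t in I, g t ≤ oR (η * r) → ∫⁻ t in I, m t ≤ oR (π ^ r16 * r ^ (23 / 11 : ℝ)) →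
    ∫⁻ t in I, HH C (Real.sqrt (α * r)) r (m t) (g t) ≤ oR (C' * r ^ 2 * Psi α η π) := by
  refine ⟨C + 6 * C ^ (5 / 16 : ℝ), by positivity, fun r α η π hr hα hη hπ I m g hm hg hI hgI hmI => ?_⟩
  set a := Real.sqrt (α * r) with hadef
  have ha : 0 ≤ a := Real.sqrt_nonneg _
  have ha2 : a ^ 2 = α * r := Real.sq_sqrt (by positivity)
  have har : a = α ^ hlf * r ^ hlf := by rw [hadef, Real.sqrt_eq_rpow, Real.mul_rpow hα hr.le]
  unfold HH
  have hmeas1 : Measurable fun t => oR (C * a * r ^ hlf) * g t := hg.const_mul _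
  have hmeas2 : Measurable fun t => oR (C * a ^ 2 * r ^ (-(1 / 2) : ℝ)) * g t ^ hlf := (hg.pow_const _).const_mul _
  have hmeas3 : Measurable fun t => oR (C * a * r ^ hlf) * g t +
    oR (C * a ^ 2 * r ^ (-(1 / 2) : ℝ)) * g t ^ hlf := hmeas1.add hmeas2
  rw [lintegral_add_left hmeas3, lintegral_add_left hmeas1, lintegral_const_mul' _ _ ofReal_ne_top,
    lintegral_const_mul' _ _ ofReal_ne_top, lintegral_const_mul' _ _ (by simp)]
  have rr1 : r ^ hlf * r ^ hlf = r := by rw [← Real.rpow_add hr]; norm_num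
  have rr2 : r ^ (-(1 / 2) : ℝ) * r ^ hlf = 1 := by rw [← Real.rpow_add hr]; norm_num
  have t1 : oR (C * a * r ^ hlf) * ∫⁻ t in I, g t ≤ oR (C * r ^ 2 * (α ^ hlf * η)) := by
    calc _ ≤ oR (C * a * r ^ hlf) * oR (η * r) := by gcongr
      _ = _ := by
        rw [← ofReal_mul (by positivity)]
        congr 1
        rw [har]
        linear_combination (C * α ^ hlf * η * r) * rr1
  have t2 : oR (C * a ^ 2 * r ^ (-(1 / 2) : ℝ)) * ∫⁻ t in I, g t ^ hlf ≤
      oR (C * r ^ 2 * (α * η ^ hlf)) := by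
    calc _ ≤ oR (C * a ^ 2 * r ^ (-(1 / 2) : ℝ)) * (oR (η * r) ^ hlf *
          oR (r ^ 2) ^ hlf) := by
            gcongr
            refine (hold_time hg (by norm_num) (by norm_num)).trans ?_
            rw [hI, show (1 - 1 / 2 : ℝ) = 1 / 2 by norm_num]
            gcongr
      _ = _ := by
        rw [sqrt_ofReal_sq hr.le, ofReal_rpow_of_nonneg (by positivity) (by norm_num),
          ← ofReal_mul (by positivity), ← ofReal_mul (by positivity), ha2, Real.mul_rpow hη hr.le]
        congr 1
        linear_combination (C * α * η ^ hlf * r ^ 2) * rr2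
  have t3 : 6 * ∫⁻ t in I, (m t ^ (11 / 16 : ℝ) * (oR (C * a ^ (6 / 5 : ℝ) * r ^ (1 / 5 : ℝ)) *
      (g t + oR (a ^ 2 / r ^ 2))) ^ (5 / 16 : ℝ)) ≤
      oR (6 * C ^ (5 / 16 : ℝ) * r ^ 2 * (π * (α + η) ^ hlf)) := by
    have hw : ∫⁻ t in I, (oR (C * a ^ (6 / 5 : ℝ) * r ^ (1 / 5 : ℝ)) * (g t + oR (a ^ 2 / r ^ 2))) ≤
        oR (C * a ^ (6 / 5 : ℝ) * r ^ (1 / 5 : ℝ) * ((α + η) * r)) := by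
      rw [lintegral_const_mul' _ _ ofReal_ne_top, lintegral_add_left hg, lintegral_const,
        Measure.restrict_apply_univ, hI, ofReal_mul (q := (α + η) * r) (by positivity),
        ← ofReal_mul (by positivity), ha2]
      gcongr
      refine (add_le_add hgI le_rfl).trans ?_
      rw [← ofReal_add (by positivity) (by positivity)]
      apply le_of_eq; congr 1; field_simp; ring
    have hh := lintegral_mul_norm_pow_le (μ := volume.restrict I) (f := m)
      (g := fun t => oR (C * a ^ (6 / 5 : ℝ) * r ^ (1 / 5 : ℝ)) * (g t + oR (a ^ 2 / r ^ 2)))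
      hm.aemeasurable ((hg.add measurable_const).const_mul _).aemeasurable (p := 11 / 16) (q := 5 / 16) (by norm_num) (by norm_num) (by norm_num)
    calc _ ≤ 6 * (oR (π ^ r16 * r ^ (23 / 11 : ℝ)) ^ (11 / 16 : ℝ) *
          oR (C * a ^ (6 / 5 : ℝ) * r ^ (1 / 5 : ℝ) * ((α + η) * r)) ^ (5 / 16 : ℝ)) := by
          gcongr
          refine hh.trans ?_
          gcongr
      _ = oR (6 * ((π ^ r16 * r ^ (23 / 11 : ℝ)) ^ (11 / 16 : ℝ) *
          (C * a ^ (6 / 5 : ℝ) * r ^ (1 / 5 : ℝ) * ((α + η) * r)) ^ (5 / 16 : ℝ))) := by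
          rw [ofReal_rpow_of_nonneg (by positivity) (by norm_num), ofReal_rpow_of_nonneg (by positivity) (by norm_num),
            ← ofReal_mul (by positivity), ofReal_mul (by norm_num : (0:ℝ) ≤ 6)]
          simp
      _ ≤ _ := by
          apply ofReal_le_ofReal
          have q1 : (π ^ r16 * r ^ (23 / 11 : ℝ)) ^ (11 / 16 : ℝ) = π * r ^ (23 / 16 : ℝ) := by
            rw [Real.mul_rpow (by positivity) (by positivity), ← Real.rpow_mul hπ, ← Real.rpow_mul hr.le]; norm_num
          have q2 : (C * a ^ (6 / 5 : ℝ) * r ^ (1 / 5 : ℝ) * ((α + η) * r)) ^ (5 / 16 : ℝ) =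
              C ^ (5 / 16 : ℝ) * (α ^ (3 / 16 : ℝ) * r ^ (3 / 16 : ℝ)) * r ^ (1 / 16 : ℝ) * ((α + η) ^ (5 / 16 : ℝ) * r ^ (5 / 16 : ℝ)) := by
            rw [Real.mul_rpow (by positivity) (by positivity), Real.mul_rpow (by positivity) (by positivity),
              Real.mul_rpow (by positivity) (by positivity), Real.mul_rpow (by positivity) hr.le, ← Real.rpow_mul ha,
              ← Real.rpow_mul hr.le, har, Real.mul_rpow (by positivity) (by positivity), ← Real.rpow_mul hα, ← Real.rpow_mul hr.le]
            norm_num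
          have q3 : r ^ (23 / 16 : ℝ) * r ^ (3 / 16 : ℝ) * r ^ (1 / 16 : ℝ) * r ^ (5 / 16 : ℝ) = r ^ 2 := by
            rw [← Real.rpow_add hr, ← Real.rpow_add hr, ← Real.rpow_add hr, ← Real.rpow_natCast]; norm_num
          have q4 : α ^ (3 / 16 : ℝ) * (α + η) ^ (5 / 16 : ℝ) ≤ (α + η) ^ hlf := by
            calc _ ≤ (α + η) ^ (3 / 16 : ℝ) * (α + η) ^ (5 / 16 : ℝ) := by gcongr; linarith
              _ = _ := by rw [← Real.rpow_add_of_nonneg (by positivity) (by norm_num) (by norm_num)]; norm_num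
          rw [q1, q2]
          calc _ = 6 * C ^ (5 / 16 : ℝ) * (r ^ (23 / 16 : ℝ) * r ^ (3 / 16 : ℝ) * r ^ (1 / 16 : ℝ) * r ^ (5 / 16 : ℝ)) *
                (π * (α ^ (3 / 16 : ℝ) * (α + η) ^ (5 / 16 : ℝ))) := by ring
            _ ≤ _ := by rw [q3]; gcongr
  refine (add_le_add (add_le_add t1 t2) t3).trans ?_
  rw [← ofReal_add (by positivity) (by positivity), ← ofReal_add (by positivity) (by positivity)]
  apply ofReal_le_ofReal
  unfold Psi
  have : 0 ≤ C * r ^ 2 * (π * (α + η) ^ hlf) := by positivity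
  have : 0 ≤ 6 * C ^ (5 / 16 : ℝ) * r ^ 2 * (α ^ hlf * η + α * η ^ hlf) := by positivity
  nlinarith
end

section
variable {K : Set E3} {v : ST → E3} {Dv : ST → Fin 3 → Fin 3 → ℝ} {p : ST → ℝ}

/-- time interval of a cylinder -/
def TI (z : ST) (r : ℝ) : Set ℝ := Ioo (z.2 - r ^ 2) z.2

/-- velocity bound -/
def VB (v : ST → E3) (z : ST) (r α : ℝ) : Prop :=
  ∀ᵐ t ∂(volume.restrict (TI z r)), ∫⁻ x in ball z.1 r, ‖v (x, t)‖ₑ ^ 2 ≤ oR (α * r)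
/-- gradient bound -/
def GB (Dv : ST → Fin 3 → Fin 3 → ℝ) (z : ST) (r η : ℝ) : Prop :=
  ∫⁻ t in TI z r, ∫⁻ x in ball z.1 r, gn (Dv (x, t)) ≤ oR (η * r)
/-- pressure bound -/
def PB (p : ST → ℝ) (z : ST) (r π : ℝ) : Prop := ∃ m : ℝ → ℝ≥0∞, Measurable m ∧
  ∫⁻ t in TI z r, m t ≤ oR (π ^ r16 * r ^ (23 / 11 : ℝ)) ∧
  ∀ᵐ t ∂(volume.restrict (TI z r)), ∃ c : ℝ, ∫⁻ x in ball z.1 r, ‖p (x, t) - c‖ₑ ^ r16 ≤ m t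
/-- all slices good -/
def SL (K : Set E3) (v : ST → E3) (Dv : ST → Fin 3 → Fin 3 → ℝ) (p : ST → ℝ) (t : ℝ) : Prop :=
  SG K (fun x => v (x, t)) (fun x => Dv (x, t)) (fun x => p (x, t))

lemma vol_TI (z : ST) (r : ℝ) : volume (TI z r) = oR (r ^ 2) := by
  simp [TI, Real.volume_Ioo]

lemma meas_gt (hDv : Measurable Dv) (B : Set E3) : Measurable fun t => ∫⁻ x in B, gn (Dv (x, t)) :=
  (measurable_gn.comp hDv).lintegral_prod_left' (μ := volume.restrict B)

lemma gfin (hDv : Measurable Dv) {z : ST} {r η : ℝ} (hG : GB Dv z r η) :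
    ∀ᵐ t ∂(volume.restrict (TI z r)), ∫⁻ x in ball z.1 r, gn (Dv (x, t)) ≠ ∞ := by
  filter_upwards [ae_lt_top (meas_gt hDv (ball z.1 r)) (ne_top_of_le_ne_top ofReal_ne_top hG)] with t ht using ht.ne

lemma flux : ∃ C : ℝ, 0 < C ∧ ∀ {K : Set E3} {v : ST → E3} {Dv : ST → Fin 3 → Fin 3 → ℝ} {p : ST → ℝ},
    Measurable v → Measurable Dv → Measurable p → ∀ (z : ST) (r α η π : ℝ), 0 < r → 0 ≤ α → 0 ≤ η → 0 ≤ π →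
    closedBall z.1 r ⊆ K → (∀ᵐ t ∂(volume.restrict (TI z r)), SL K v Dv p t) → VB v z r α → GB Dv z r η → PB p z r π →
    ∃ H : ℝ → ℝ≥0∞, Measurable H ∧ ∫⁻ t in TI z r, H t ≤ oR (C * r ^ 2 * Psi α η π) ∧
    ∀ᵐ t ∂(volume.restrict (TI z r)), ∃ c : ℝ, ∀ (φ : E3 → ℝ) (L : ℝ), 0 ≤ L →
      Adm (closedBall z.1 (r / 4)) φ → (∀ i x, |pd i φ x| ≤ L) →
      ∫⁻ x, ‖(‖v (x, t)‖ ^ 2 + 2 * p (x, t) - c) * ∑ i, v (x, t) i * pd i φ x‖ₑ ≤ oR L * H t := by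
  obtain ⟨C, hC, h⟩ := fluxS
  obtain ⟨C', hC', h'⟩ := HH_time hC
  refine ⟨C', hC', fun {K v Dv p} hv hDv hp z r α η π hr hα hη hπ hK hS hV hG hP => ?_⟩
  obtain ⟨m, hm, hmI, hmc⟩ := hP
  have hg := meas_gt hDv (ball z.1 r)
  refine ⟨fun t => HH C (Real.sqrt (α * r)) r (m t) (∫⁻ x in ball z.1 r, gn (Dv (x, t))), ?_,
    h' r α η π hr hα hη hπ (TI z r) m _ hm hg (vol_TI z r) hG hmI, ?_⟩
  · unfold HH; fun_prop
  · filter_upwards [hS, hV, gfin hDv hG, hmc] with t h1 h2 h3 h4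
    refine h z.1 r hr K hK (fun x => v (x, t)) (fun x => Dv (x, t)) (fun x => p (x, t)) _ (m t) (Real.sqrt_nonneg _)
      (by fun_prop) (by fun_prop) (by fun_prop) h1 ?_ h3 h4
    rwa [Real.sq_sqrt (by positivity)]

lemma TI_mono {z : ST} {r θ : ℝ} (hr : 0 < r) (h0 : 0 < θ) (h1 : θ ≤ 1) : TI z (θ * r) ⊆ TI z r := by
  apply Ioo_subset_Ioo_left
  have : (θ * r) ^ 2 ≤ r ^ 2 := by
    have : θ * r ≤ r := by nlinarith
    gcongr
  linarith

lemma FF_le (u : E3) (G : Fin 3 → Fin 3 → ℝ) : ∑ i, ‖FF u G i‖ₑ ≤ 9 * (‖u‖ₑ * gn G ^ hlf) := by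
  have h : ∀ i, ‖FF u G i‖ₑ ≤ 3 * (‖u‖ₑ * gn G ^ hlf) := by
    intro i
    calc ‖FF u G i‖ₑ ≤ ∑ j, ‖u j * G j i‖ₑ := enorm_sum_le _ _
      _ ≤ ∑ j : Fin 3, ‖u‖ₑ * gn G ^ hlf := by
        refine Finset.sum_le_sum fun j _ => ?_
        rw [enorm_mul]
        gcongr
        exacts [coord_enorm_le _ _, enorm_le_gn _ _ _]
      _ = _ := by simp
  calc _ ≤ ∑ i : Fin 3, 3 * (‖u‖ₑ * gn G ^ hlf) := Finset.sum_le_sum fun i _ => h i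
    _ = _ := by simp; ring

lemma pstep : ∃ C : ℝ, 0 < C ∧ ∀ θ, 0 < θ → θ ≤ 1 / 2 → ∃ D : ℝ, 0 < D ∧
    ∀ {K : Set E3} {v : ST → E3} {Dv : ST → Fin 3 → Fin 3 → ℝ} {p : ST → ℝ},
    Measurable v → Measurable Dv → Measurable p → ∀ (z : ST) (r α η π : ℝ), 0 < r → 0 ≤ α → 0 ≤ η → 0 ≤ π →
    closedBall z.1 r ⊆ K → (∀ᵐ t ∂(volume.restrict (TI z r)), SL K v Dv p t) → VB v z r α → GB Dv z r η → PB p z r π →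
    PB p z (θ * r) (C * θ ^ (13 / 8 : ℝ) * π + D * (α * η) ^ hlf) := by
  obtain ⟨C, hC, h⟩ := sliceP
  refine ⟨C + 1, by positivity, fun θ hθ hθ1 => ⟨(C * 9 ^ r16 + 1) * θ ^ (-(23 / 16) : ℝ), by positivity, ?_⟩⟩
  intro K v Dv p hv hDv hp z r α η π hr hα hη hπ hK hS hV hG hP
  obtain ⟨m, hm, hmI, hmc⟩ := hP
  set g : ℝ → ℝ≥0∞ := fun t => ∫⁻ x in ball z.1 r, gn (Dv (x, t)) with hgdef
  have hg : Measurable g := meas_gt hDv (ball z.1 r)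
  have hsub : TI z (θ * r) ⊆ TI z r := TI_mono hr hθ (by linarith)
  set A := oR (α * r) ^ hlf with hA
  have hAtop : A ≠ ∞ := rpow_ne_top_of_nonneg (by norm_num) ofReal_ne_top
  refine ⟨fun t => oR (C * θ ^ (49 / 11 : ℝ)) * m t + oR (C * r ^ (1 / 11 : ℝ)) *
    (9 * (A * g t ^ hlf)) ^ r16, by fun_prop, ?_, ?_⟩
  · refine (lintegral_mono_set hsub).trans ?_
    rw [lintegral_add_left (by fun_prop), lintegral_const_mul' _ _ ofReal_ne_top,
      lintegral_const_mul' _ _ ofReal_ne_top]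
    have e : ∀ t, (9 * (A * g t ^ hlf)) ^ r16 = oR (9 ^ r16 * (α * r) ^ (8 / 11 : ℝ)) * g t ^ (8 / 11 : ℝ) := by
      intro t
      rw [mul_rpow_of_nonneg _ _ (by norm_num), mul_rpow_of_nonneg _ _ (by norm_num), hA, ← rpow_mul,
        ← rpow_mul, ofReal_mul (p := 9 ^ r16) (by positivity), ← ofReal_rpow_of_nonneg (by norm_num : (0:ℝ) ≤ 9) (by norm_num),
        ← ofReal_rpow_of_nonneg (by positivity : 0 ≤ α * r) (by norm_num), mul_assoc]
      norm_num
    simp only [e]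
    rw [lintegral_const_mul' _ _ ofReal_ne_top]
    have hh := hold_time (I := TI z r) hg (e := 8 / 11) (by norm_num) (by norm_num)
    rw [vol_TI, show (1 - 8 / 11 : ℝ) = 3 / 11 by norm_num] at hh
    calc _ ≤ oR (C * θ ^ (49 / 11 : ℝ)) * oR (π ^ r16 * r ^ (23 / 11 : ℝ)) +
          oR (C * r ^ (1 / 11 : ℝ)) * (oR (9 ^ r16 * (α * r) ^ (8 / 11 : ℝ)) *
            (oR (η * r) ^ (8 / 11 : ℝ) * oR (r ^ 2) ^ (3 / 11 : ℝ))) := by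
          gcongr
          refine hh.trans ?_
          gcongr
          exact hG
      _ = oR (C * θ ^ (49 / 11 : ℝ) * (π ^ r16 * r ^ (23 / 11 : ℝ)) + C * r ^ (1 / 11 : ℝ) *
          (9 ^ r16 * (α * r) ^ (8 / 11 : ℝ) * ((η * r) ^ (8 / 11 : ℝ) * (r ^ 2) ^ (3 / 11 : ℝ)))) := by
          rw [ofReal_add (by positivity) (by positivity), ofReal_mul (by positivity : 0 ≤ C * θ ^ (49 / 11 : ℝ)),
            ofReal_mul (by positivity : 0 ≤ C * r ^ (1 / 11 : ℝ)),
            ofReal_mul (by positivity : 0 ≤ 9 ^ r16 * (α * r) ^ (8 / 11 : ℝ)),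
            ofReal_mul (by positivity : 0 ≤ (η * r) ^ (8 / 11 : ℝ)),
            ofReal_rpow_of_nonneg (by positivity : 0 ≤ η * r) (by norm_num),
            ofReal_rpow_of_nonneg (by positivity : 0 ≤ r ^ 2) (by norm_num)]
      _ ≤ _ := by
          apply ofReal_le_ofReal
          set X := (C + 1) * θ ^ (13 / 8 : ℝ) * π
          set Y := (C * 9 ^ r16 + 1) * θ ^ (-(23 / 16) : ℝ) * (α * η) ^ hlf
          have hX : 0 ≤ X := by positivity
          have hY : 0 ≤ Y := by positivity
          have hpow : ∀ c : ℝ, 0 ≤ c → c ≤ (c + 1) ^ r16 := fun c hc =>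
            (by linarith : c ≤ c + 1).trans (Real.self_le_rpow_of_one_le (by linarith) (by norm_num))
          have hXq : C * (θ ^ (26 / 11 : ℝ) * π ^ r16) ≤ X ^ r16 := by
            have : X ^ r16 = (C + 1) ^ r16 * (θ ^ (26 / 11 : ℝ) * π ^ r16) := by
              rw [Real.mul_rpow (by positivity) hπ, Real.mul_rpow (by positivity) (by positivity), ← Real.rpow_mul hθ.le]
              norm_num [mul_assoc]
            rw [this]
            gcongr
            exact hpow C hC.le
          have hYq : C * 9 ^ r16 * (θ ^ (-(23 / 11) : ℝ) * (α ^ (8 / 11 : ℝ) * η ^ (8 / 11 : ℝ))) ≤ Y ^ r16 := by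
            have : Y ^ r16 = (C * 9 ^ r16 + 1) ^ r16 * (θ ^ (-(23 / 11) : ℝ) * (α ^ (8 / 11 : ℝ) * η ^ (8 / 11 : ℝ))) := by
              rw [Real.mul_rpow (by positivity) (by positivity), Real.mul_rpow (by positivity) (by positivity), ← Real.rpow_mul hθ.le,
                ← Real.rpow_mul (by positivity), ← Real.mul_rpow hα hη]
              norm_num [mul_assoc]
            rw [this]
            gcongr
            exact hpow _ (by positivity)
          have hsum : X ^ r16 + Y ^ r16 ≤ (X + Y) ^ r16 :=
            Real.add_rpow_le_rpow_add hX hY (by norm_num)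
          have r1 : (θ * r) ^ (23 / 11 : ℝ) = θ ^ (23 / 11 : ℝ) * r ^ (23 / 11 : ℝ) := Real.mul_rpow hθ.le hr.le
          have r2 : θ ^ (49 / 11 : ℝ) = θ ^ (26 / 11 : ℝ) * θ ^ (23 / 11 : ℝ) := by rw [← Real.rpow_add hθ]; norm_num
          have r3 : θ ^ (-(23 / 11) : ℝ) * θ ^ (23 / 11 : ℝ) = 1 := by rw [← Real.rpow_add hθ]; norm_num
          have r4 : r ^ (1 / 11 : ℝ) * r ^ (8 / 11 : ℝ) * r ^ (8 / 11 : ℝ) * (r ^ 2) ^ (3 / 11 : ℝ) = r ^ (23 / 11 : ℝ) := by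
            rw [← Real.rpow_natCast, ← Real.rpow_mul hr.le, ← Real.rpow_add hr, ← Real.rpow_add hr, ← Real.rpow_add hr]; norm_num
          rw [r1, Real.mul_rpow hα hr.le, Real.mul_rpow hη hr.le]
          calc _ = (C * (θ ^ (26 / 11 : ℝ) * π ^ r16) +
                C * 9 ^ r16 * (θ ^ (-(23 / 11) : ℝ) * (α ^ (8 / 11 : ℝ) * η ^ (8 / 11 : ℝ)))) * (θ ^ (23 / 11 : ℝ) * r ^ (23 / 11 : ℝ)) := by
                rw [r2, ← r4]
                linear_combination (-(C * 9 ^ r16 * α ^ (8 / 11 : ℝ) * η ^ (8 / 11 : ℝ) * (r ^ (1 / 11 : ℝ) * r ^ (8 / 11 : ℝ) * r ^ (8 / 11 : ℝ) * (r ^ 2) ^ (3 / 11 : ℝ)))) * r3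
            _ ≤ _ := by gcongr; linarith
  · have hmfin : ∀ᵐ t ∂(volume.restrict (TI z r)), m t < ∞ :=
      ae_lt_top hm (ne_top_of_le_ne_top ofReal_ne_top hmI)
    apply ae_restrict_of_ae_restrict_of_subset hsub
    filter_upwards [hS, hV, gfin hDv hG, hmc, hmfin] with t h1 h2 h3 h4 h5
    obtain ⟨c0, hc0⟩ := h4
    have hF : ∫⁻ x in ball z.1 r, ∑ i, ‖FF (v (x, t)) (Dv (x, t)) i‖ₑ ≤ 9 * (A * g t ^ hlf) := by
      refine (lintegral_mono fun x => FF_le _ _).trans ?_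
      have m1 : Measurable fun x => ‖v (x, t)‖ₑ := by fun_prop
      have m2 : Measurable fun x => gn (Dv (x, t)) ^ hlf := (measurable_gn.comp (by fun_prop)).pow_const _
      rw [lintegral_const_mul' _ _ (by simp)]
      gcongr
      refine (hold2 _ m1.aemeasurable m2.aemeasurable).trans ?_
      have e : ∀ x, (gn (Dv (x, t)) ^ hlf) ^ 2 = gn (Dv (x, t)) := fun x => by
        rw [← rpow_natCast]; exact gn_rpow _
      simp only [e]
      rw [hA]
      gcongr
    obtain ⟨c, hc⟩ := h θ hθ hθ1 z.1 r hr (fun x => p (x, t)) (fun x => FF (v (x, t)) (Dv (x, t))) c0 (by fun_prop)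
      (by unfold FF; fun_prop) (ne_top_of_le_ne_top h5.ne hc0)
      (ne_top_of_le_ne_top (mul_ne_top (by simp) (mul_ne_top hAtop
        (rpow_ne_top_of_nonneg (by norm_num) h3))) hF) (h1.pe hK)
    refine ⟨c, hc.trans ?_⟩
    gcongr
end

section
section
variable {Ω K : Set E3} {T : ℝ} {v : ST → E3} {Dv : ST → Fin 3 → Fin 3 → ℝ} {p : ST → ℝ} {v₀ : E3 → E3}

/-- local energy inequality at a time -/
def LEn (Ω : Set E3) (T : ℝ) (v : ST → E3) (Dv : ST → Fin 3 → Fin 3 → ℝ) (p : ST → ℝ) (t : ℝ) : Prop :=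
  ∀ φ : ST → ℝ, ContDiff ℝ smo φ → HasCompactSupport φ → tsupport φ ⊆ Ω ×ˢ Ioo 0 T → (∀ z, 0 ≤ φ z) →
    (∫ x in Ω, ‖v (x, t)‖ ^ 2 * φ (x, t)) + 2 * ∫ z in Ω ×ˢ Ioo 0 t, (∑ i, ∑ j, (Dv z i j) ^ 2) * φ z
      ≤ ∫ z in Ω ×ˢ Ioo 0 t, (‖v z‖ ^ 2 * (tdz φ z + ∑ i, sdz (fun w => sdz φ i w) i z)
            + (‖v z‖ ^ 2 + 2 * p z) * ∑ i, v z i * sdz φ i z)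

/-- good times -/
def Good (Ω : Set E3) (T : ℝ) (v : ST → E3) (Dv : ST → Fin 3 → Fin 3 → ℝ) (p : ST → ℝ) (t : ℝ) : Prop :=
  t ∈ Ioo 0 T ∧ LEn Ω T v Dv p t ∧ ∫⁻ x in Ω, ‖v (x, t)‖ₑ ^ 2 ≠ ∞

lemma linf (hsol : IsSuitableWeakSolution Ω T v Dv p v₀) : ∃ A : ℝ, 0 ≤ A ∧
    ∀ᵐ t ∂(volume.restrict (Ioo 0 T)), ∫⁻ x in Ω, ‖v (x, t)‖ₑ ^ 2 ≤ oR A := by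
  have h := hsol.v_linf_l2
  simp only [MemMixed, mixedNorm, if_true] at h
  refine ⟨(essSup (fun t => eLpNorm (fun x => v (x, t)) 2 (volume.restrict Ω)) (volume.restrict (Ioo 0 T))).toReal ^ 2, by positivity, ?_⟩
  filter_upwards [ae_le_essSup (fun t => eLpNorm (fun x => v (x, t)) 2 (volume.restrict Ω)) (μ := volume.restrict (Ioo 0 T))] with t ht
  rw [ofReal_pow toReal_nonneg, ofReal_toReal h.ne]
  refine le_trans (le_of_eq ?_) (pow_le_pow_left' ht 2)
  rw [eLpNorm_eq_lintegral_rpow_enorm_toReal (by simp) (by simp), ← rpow_natCast, ← rpow_mul]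
  simp

lemma ae_good (hsol : IsSuitableWeakSolution Ω T v Dv p v₀) : ∀ᵐ t ∂(volume.restrict (Ioo 0 T)), Good Ω T v Dv p t := by
  obtain ⟨A, hA, h⟩ := linf hsol
  filter_upwards [h, hsol.local_energy, ae_restrict_mem measurableSet_Ioo] with t h1 h2 h3
  exact ⟨h3, h2, ne_top_of_le_ne_top ofReal_ne_top h1⟩

lemma lfub {A : Set E3} {I : Set ℝ} {f : ST → ℝ≥0∞} (hf : Measurable f) :
    ∫⁻ z in A ×ˢ I, f z = ∫⁻ t in I, ∫⁻ x in A, f (x, t) := by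
  have e : (volume.restrict (A ×ˢ I) : Measure (ST)) = (volume.restrict A).prod (volume.restrict I) := by
    rw [Measure.prod_restrict]; rfl
  rw [e, lintegral_prod_symm' _ hf]

lemma ofReal_int_le {X : Type*} [MeasurableSpace X] {μ : Measure X} {f : X → ℝ} (hf : Integrable f μ) :
    oR (∫ x, f x ∂μ) ≤ ∫⁻ x, oR (f x) ∂μ := by
  rw [integral_eq_lintegral_pos_part_sub_lintegral_neg_part hf]
  refine (ofReal_le_ofReal (sub_le_self _ toReal_nonneg)).trans ofReal_toReal_le

lemma slice_flux (hv : Measurable v) (hp : Measurable p) {t : ℝ} (hS : SL K v Dv p t) (n : ℕ) (φ : ℕ → E3 → ℝ) (c : ℕ → ℝ)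
    (hφ : ∀ k, Adm K (φ k)) :
    ‖∫ x, (‖v (x, t)‖ ^ 2 + 2 * p (x, t)) * ∑ i, v (x, t) i * ∑ k ∈ Finset.range n, pd i (φ k) x‖ₑ ≤
      ∑ k ∈ Finset.range n, ∫⁻ x, ‖(‖v (x, t)‖ ^ 2 + 2 * p (x, t) - c k) * ∑ i, v (x, t) i * pd i (φ k) x‖ₑ := by
  by_cases hi : Integrable fun x => (‖v (x, t)‖ ^ 2 + 2 * p (x, t)) * ∑ i, v (x, t) i * ∑ k ∈ Finset.range n, pd i (φ k) x
  swap
  · rw [integral_undef hi]; simp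
  have hw : ∀ k, Integrable fun x => c k * ∑ i, v (x, t) i * pd i (φ k) x := by
    intro k
    refine Integrable.const_mul (integrable_finsetSum _ fun i _ => ?_) _
    refine (integrableOn_iff_integrable_of_support_subset ?_).mp (int_mul_adm' ((hφ k).pd i) (hS.1 i))
    intro x hx
    exact ((hφ k).pd i).2.2 (subset_tsupport _ (right_ne_zero_of_mul hx))
  have h0 : ∫ x, ∑ k ∈ Finset.range n, c k * ∑ i, v (x, t) i * pd i (φ k) x = 0 := by
    rw [integral_finsetSum _ fun k _ => hw k]
    refine Finset.sum_eq_zero fun k _ => ?_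
    rw [integral_const_mul, (hS.2.2 _ (hφ k)).2.1, mul_zero]
  have hm : ∀ k, Measurable fun x => ‖(‖v (x, t)‖ ^ 2 + 2 * p (x, t) - c k) * ∑ i, v (x, t) i * pd i (φ k) x‖ₑ := by
    intro k
    have h1 : ∀ i, Measurable (pd i (φ k)) := fun i => (contDiff_pd (hφ k).1).continuous.measurable
    have h2 : Measurable fun x => v (x, t) := by fun_prop
    fun_prop
  rw [← sub_zero (∫ x, _), ← h0, ← integral_sub hi (integrable_finsetSum _ fun k _ => hw k)]
  refine (enorm_integral_le_lintegral_enorm _).trans ?_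
  rw [← lintegral_finsetSum _ fun k _ => hm k]
  refine lintegral_mono fun x => ?_
  refine le_trans (le_of_eq ?_) (enorm_sum_le _ _)
  congr 1
  simp only [Finset.mul_sum, sub_mul, Finset.sum_sub_distrib]
  congr 1
  rw [Finset.sum_comm]
end
end

section
section
variable {Ω K : Set E3} {T : ℝ} {v : ST → E3} {Dv : ST → Fin 3 → Fin 3 → ℝ} {p : ST → ℝ} {v₀ : E3 → E3}

lemma v2_int (hsol : IsSuitableWeakSolution Ω T v Dv p v₀) : IntegrableOn (fun z => ‖v z‖ ^ 2) (Ω ×ˢ Ioo 0 T) := by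
  refine Integrable.mono' hsol.v_l2_w12 (hsol.meas_v.norm.pow_const 2).aestronglyMeasurable (ae_of_all _ fun z => ?_)
  rw [Real.norm_of_nonneg (by positivity)]
  have : 0 ≤ ∑ i, ∑ j, (Dv z i j) ^ 2 := by positivity
  linarith

lemma D2_int (hsol : IsSuitableWeakSolution Ω T v Dv p v₀) : IntegrableOn (fun z => ∑ i, ∑ j, (Dv z i j) ^ 2) (Ω ×ˢ Ioo 0 T) := by
  have hm := hsol.meas_Dv
  refine Integrable.mono' hsol.v_l2_w12 (Measurable.aestronglyMeasurable (by fun_prop)) (ae_of_all _ fun z => ?_)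
  rw [Real.norm_of_nonneg (by positivity)]
  have : 0 ≤ ‖v z‖ ^ 2 := by positivity
  linarith

/-- heat operator -/
def heat (φ : ST → ℝ) (z : ST) : ℝ := tdz φ z + ∑ i, sdz (fun w => sdz φ i w) i z

lemma heat_cont {φ : ST → ℝ} (hφ : ContDiff ℝ smo φ) : Continuous (heat φ) := by
  have h1 : Continuous fun z => tdz φ z :=
    ((hφ.fderiv_right (m := smo) (by simp)).clm_apply contDiff_const).continuous
  have h2 : ∀ i, Continuous fun z => sdz (fun w => sdz φ i w) i z := fun i => (sdz_contDiff (sdz_contDiff hφ i) i).continuous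
  exact h1.add (continuous_finsetSum _ fun i _ => h2 i)

lemma sdz_out {φ : ST → ℝ} (i : Fin 3) {z : ST} (hz : z ∉ tsupport φ) : sdz φ i z = 0 := by
  have : z ∉ tsupport (fderiv ℝ φ) := fun h => hz (tsupport_fderiv_subset ℝ h)
  rw [sdz, image_eq_zero_of_notMem_tsupport this]; simp

lemma sdz_tsupp (φ : ST → ℝ) (i : Fin 3) : tsupport (fun w => sdz φ i w) ⊆ tsupport φ :=
  tsupport_fderiv_apply_subset ℝ _

lemma heat_out {φ : ST → ℝ} {z : ST} (hz : z ∉ tsupport φ) : heat φ z = 0 := by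
  have h1 : z ∉ tsupport (fderiv ℝ φ) := fun h => hz (tsupport_fderiv_subset ℝ h)
  have h2 : tdz φ z = 0 := by rw [tdz, image_eq_zero_of_notMem_tsupport h1]; simp
  rw [heat, h2, Finset.sum_eq_zero fun i _ => sdz_out i fun h => hz (sdz_tsupp φ i h), add_zero]

lemma heat_part : ∃ C : ℝ, 0 < C ∧ ∀ {Ω : Set E3} {T : ℝ} {v : ST → E3} {Dv : ST → Fin 3 → Fin 3 → ℝ} {p : ST → ℝ} {v₀ : E3 → E3},
    IsSuitableWeakSolution Ω T v Dv p v₀ → ∀ (z : ST) (R r α t : ℝ), 0 < R → 0 < r → 0 ≤ α → t ≤ z.2 → t ≤ T → VB v z R α →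
    IntegrableOn (fun w => ‖v w‖ ^ 2 * heat (tf z.1 z.2 R r) w) (Ω ×ˢ Ioo 0 t) ∧
    ∫ w in Ω ×ˢ Ioo 0 t, ‖v w‖ ^ 2 * heat (tf z.1 z.2 R r) w ≤ C * (R ^ 2)⁻¹ * α := by
  obtain ⟨C, hC, h⟩ := tf_heat
  refine ⟨C, hC, fun {Ω T v Dv p v₀} hsol z R r α t hR hr hα ht htT hV => ?_⟩
  have hcd : ContDiff ℝ smo (tf z.1 z.2 R r) := tf_contDiff hr
  have hsupp := tf_supp (x0 := z.1) (t0 := z.2) (r := r) hR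
  have hcs : HasCompactSupport (tf z.1 z.2 R r) :=
    HasCompactSupport.of_support_subset_isCompact ((isCompact_closedBall z.1 (R/4)).prod isCompact_Icc) ((subset_tsupport _).trans hsupp)
  have hb : ∃ B, ∀ w, ‖heat (tf z.1 z.2 R r) w‖ ≤ B := by
    refine HasCompactSupport.exists_bound_of_continuous ?_ (heat_cont hcd)
    refine HasCompactSupport.of_support_subset_isCompact hcs fun w hw => ?_
    by_contra hn
    exact hw (heat_out hn)
  obtain ⟨B, hB⟩ := hb
  have hint : IntegrableOn (fun w => ‖v w‖ ^ 2 * heat (tf z.1 z.2 R r) w) (Ω ×ˢ Ioo 0 t) :=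
    Integrable.mul_bdd (c := B) ((v2_int hsol).mono_set (prod_mono subset_rfl (Ioo_subset_Ioo_right htT)))
      (heat_cont hcd).aestronglyMeasurable (ae_of_all _ hB)
  refine ⟨hint, ?_⟩
  rw [← ofReal_le_ofReal_iff (by positivity)]
  refine (ofReal_int_le hint).trans ?_
  have hv := hsol.meas_v
  have hpt : ∀ w ∈ Ω ×ˢ Ioo 0 t, oR (‖v w‖ ^ 2 * heat (tf z.1 z.2 R r) w) ≤
      (ball z.1 R ×ˢ TI z R).indicator (fun w => oR (C * (R^5)⁻¹) * ‖v w‖ₑ ^ 2) w := by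
    intro w hw
    have hwt : w.2 < z.2 := hw.2.2.trans_le ht
    by_cases hm : w ∈ ball z.1 R ×ˢ TI z R
    · rw [indicator_of_mem hm, ← ofReal_norm, ← ofReal_pow (norm_nonneg _), ← ofReal_mul (by positivity)]
      apply ofReal_le_ofReal
      rw [mul_comm]
      gcongr
      exact h z.1 z.2 R r hR hr w.1 w.2 hwt
    · rw [indicator_of_notMem hm, heat_out, mul_zero, ofReal_zero]
      intro h'
      have := hsupp h'
      refine hm ⟨closedBall_subset_ball (by linarith) this.1, ?_, hwt⟩
      have := this.2.1
      nlinarith [sq_nonneg R, pow_pos hR 2]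
  have hmt : MeasurableSet (TI z R) := measurableSet_Ioo
  have hmm : MeasurableSet (ball z.1 R ×ˢ TI z R) := measurableSet_ball.prod hmt
  calc _ ≤ ∫⁻ w in Ω ×ˢ Ioo 0 t, (ball z.1 R ×ˢ TI z R).indicator (fun w => oR (C * (R^5)⁻¹) * ‖v w‖ₑ ^ 2) w :=
        setLIntegral_mono ((by fun_prop : Measurable fun w => oR (C * (R^5)⁻¹) * ‖v w‖ₑ ^ 2).indicator hmm) hpt
    _ ≤ ∫⁻ w, (ball z.1 R ×ˢ TI z R).indicator (fun w => oR (C * (R^5)⁻¹) * ‖v w‖ₑ ^ 2) w :=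
        setLIntegral_le_lintegral _ _
    _ = oR (C * (R^5)⁻¹) * ∫⁻ w in ball z.1 R ×ˢ TI z R, ‖v w‖ₑ ^ 2 := by
        rw [lintegral_indicator hmm, lintegral_const_mul' _ _ ofReal_ne_top]
    _ ≤ oR (C * (R^5)⁻¹) * ∫⁻ t in TI z R, oR (α * R) := by
        rw [lfub (by fun_prop)]
        exact mul_le_mul' le_rfl (lintegral_mono_ae hV)
    _ = oR (C * (R ^ 2)⁻¹ * α) := by
        rw [setLIntegral_const, vol_TI, ← ofReal_mul (by positivity), ← ofReal_mul (by positivity)]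
        congr 1
        field_simp

lemma flux_part : ∃ C : ℝ, 0 < C ∧ ∀ {Ω K : Set E3} {T : ℝ} {v : ST → E3} {Dv : ST → Fin 3 → Fin 3 → ℝ} {p : ST → ℝ} {v₀ : E3 → E3},
    IsSuitableWeakSolution Ω T v Dv p v₀ → ∀ (z : ST) (R θ t : ℝ) (n : ℕ) (α η π : ℕ → ℝ), 0 < R → 0 < θ → θ ≤ 1 → 1 ≤ n →
    (∀ k, 0 ≤ α k) → (∀ k, 0 ≤ η k) → (∀ k, 0 ≤ π k) → closedBall z.1 R ⊆ K → K ⊆ Ω → 0 ≤ z.2 - R ^ 2 → t ≤ z.2 → z.2 ≤ T →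
    (∀ᵐ t ∂(volume.restrict (Ioo 0 T)), SL K v Dv p t) →
    (∀ k < n, VB v z (θ ^ k * R) (α k) ∧ GB Dv z (θ ^ k * R) (η k) ∧ PB p z (θ ^ k * R) (π k)) →
    IntegrableOn (fun w => (‖v w‖ ^ 2 + 2 * p w) * ∑ i, v w i * sdz (tf z.1 z.2 R (θ ^ n * R)) i w) (Ω ×ˢ Ioo 0 t) →
    ∫ w in Ω ×ˢ Ioo 0 t, (‖v w‖ ^ 2 + 2 * p w) * ∑ i, v w i * sdz (tf z.1 z.2 R (θ ^ n * R)) i w ≤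
      C * (θ ^ 4)⁻¹ * ∑ k ∈ Finset.range n, ((θ ^ k * R) ^ 2)⁻¹ * Psi (α k) (η k) (π k) := by
  obtain ⟨C, hC, h⟩ := flux
  obtain ⟨C', hC', h'⟩ := tk_grad
  refine ⟨C' * C, by positivity, fun {Ω K T v Dv p v₀} hsol z R θ t n α η π hR hθ hθ1 hn hα hη hπ hBK hKΩ h0 ht hT hSL hB hint => ?_⟩
  have hPsi : ∀ k, 0 ≤ Psi (α k) (η k) (π k) := fun k => Psi_nonneg (hα k) (hη k) (hπ k)
  have hrk : ∀ k, 0 < θ ^ k * R := fun k => by positivity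
  have hrk1 : ∀ k, θ ^ k * R ≤ R := fun k => mul_le_of_le_one_left hR.le (pow_le_one₀ hθ.le hθ1)
  have hTI : ∀ k, TI z (θ ^ k * R) ⊆ Ioo 0 T := by
    intro k s hs
    have : (θ ^ k * R) ^ 2 ≤ R ^ 2 := by gcongr; exact hrk1 k
    have h1 := hs.1
    have h2 := hs.2
    constructor <;> linarith
  have hex : ∀ k : ℕ, ∃ H : ℝ → ℝ≥0∞, Measurable H ∧ (k < n → ∫⁻ t in TI z (θ ^ k * R), H t ≤ oR (C * (θ ^ k * R) ^ 2 * Psi (α k) (η k) (π k)) ∧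
      ∀ᵐ t ∂(volume.restrict (TI z (θ ^ k * R))), ∃ c : ℝ, ∀ (φ : E3 → ℝ) (L : ℝ), 0 ≤ L →
      Adm (closedBall z.1 ((θ ^ k * R) / 4)) φ → (∀ i x, |pd i φ x| ≤ L) →
      ∫⁻ x, ‖(‖v (x, t)‖ ^ 2 + 2 * p (x, t) - c) * ∑ i, v (x, t) i * pd i φ x‖ₑ ≤ oR L * H t) := by
    intro k
    by_cases hk : k < n
    · obtain ⟨h1, h2, h3⟩ := hB k hk
      obtain ⟨H, hH, hH1, hH2⟩ := h hsol.meas_v hsol.meas_Dv hsol.meas_p z _ _ _ _ (hrk k) (hα k) (hη k) (hπ k)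
        ((closedBall_subset_closedBall (hrk1 k)).trans hBK) (ae_restrict_of_ae_restrict_of_subset (hTI k) hSL) h1 h2 h3
      exact ⟨H, hH, fun _ => ⟨hH1, hH2⟩⟩
    · exact ⟨0, measurable_const, fun h => absurd h hk⟩
  choose H hHm hH using hex
  set L : ℕ → ℝ := fun k => C' * (θ ^ 4)⁻¹ * ((θ ^ k * R) ^ 4)⁻¹ with hL
  have hL0 : ∀ k, 0 ≤ L k := fun k => by positivity
  rw [← ofReal_le_ofReal_iff (by have := fun k => mul_nonneg (inv_nonneg.mpr (sq_nonneg (θ ^ k * R))) (hPsi k);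
                                         exact mul_nonneg (by positivity) (Finset.sum_nonneg fun k _ => this k))]
  rw [fub _ hint]
  refine (Real.ofReal_le_enorm _).trans ((enorm_integral_le_lintegral_enorm _).trans ?_)
  have hmT : ∀ k, MeasurableSet (TI z (θ ^ k * R)) := fun k => measurableSet_Ioo
  have hsl : ∀ᵐ s ∂(volume.restrict (Ioo 0 t)), ‖∫ x in Ω, (‖v (x, s)‖ ^ 2 + 2 * p (x, s)) * ∑ i, v (x, s) i * sdz (tf z.1 z.2 R (θ ^ n * R)) i (x, s)‖ₑ ≤
      ∑ k ∈ Finset.range n, (TI z (θ ^ k * R)).indicator (fun s => oR (L k) * H k s) s := by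
    have hall : ∀ᵐ s ∂(volume.restrict (Ioo 0 t)), ∀ k, k < n → s ∈ TI z (θ ^ k * R) → ∃ c : ℝ, ∀ (φ : E3 → ℝ) (L : ℝ), 0 ≤ L →
      Adm (closedBall z.1 ((θ ^ k * R) / 4)) φ → (∀ i x, |pd i φ x| ≤ L) →
      ∫⁻ x, ‖(‖v (x, s)‖ ^ 2 + 2 * p (x, s) - c) * ∑ i, v (x, s) i * pd i φ x‖ₑ ≤ oR L * H k s := by
      rw [ae_all_iff]
      intro k
      by_cases hk : k < n
      · filter_upwards [ae_restrict_of_ae ((ae_restrict_iff' (hmT k)).mp (hH k hk).2)] with s hs _ using hs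
      · exact ae_of_all _ fun s hk' => absurd hk' hk
    filter_upwards [hall, ae_restrict_of_ae_restrict_of_subset (Ioo_subset_Ioo_right (ht.trans hT)) hSL, ae_restrict_mem measurableSet_Ioo] with s hs hs2 hs3
    have hs0 : s < z.2 := hs3.2.trans_le ht
    have hcex : ∀ k, ∃ c : ℝ, k < n → ∫⁻ x, ‖(‖v (x, s)‖ ^ 2 + 2 * p (x, s) - c) * ∑ i, v (x, s) i * pd i (tk z.1 z.2 R θ n k s) x‖ₑ ≤
        (TI z (θ ^ k * R)).indicator (fun s => oR (L k) * H k s) s := by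
      intro k
      by_cases hk : k < n
      · by_cases hm : s ∈ TI z (θ ^ k * R)
        · obtain ⟨c, hc⟩ := hs k hk hm
          refine ⟨c, fun _ => ?_⟩
          rw [indicator_of_mem hm]
          exact hc _ (L k) (hL0 k) (tk_adm hθ hθ1 hR n k s) (h' z.1 z.2 R θ hθ hθ1 hR n k hk s hs0.le)
        · refine ⟨0, fun _ => ?_⟩
          have hz : tk z.1 z.2 R θ n k s = fun _ => 0 := by
            funext x
            refine tk_zero hθ hθ1 hR n k s ?_ x
            have : s ≤ z.2 - (θ ^ k * R) ^ 2 := by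
              by_contra hcon
              exact hm ⟨by linarith, hs0⟩
            rw [abs_sub_comm, abs_of_pos (by linarith)]
            nlinarith [sq_nonneg (θ ^ k * R)]
          rw [hz]
          simp [pd]
      · exact ⟨0, fun h => absurd h hk⟩
    choose c hc using hcex
    have hAdm : ∀ k, Adm K (tk z.1 z.2 R θ n k s) := fun k => (tk_adm hθ hθ1 hR n k s).mono
      ((closedBall_subset_closedBall (by linarith [hrk1 k])).trans hBK)
    have hfull : ∫ x in Ω, (‖v (x, s)‖ ^ 2 + 2 * p (x, s)) * ∑ i, v (x, s) i * sdz (tf z.1 z.2 R (θ ^ n * R)) i (x, s) =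
        ∫ x, (‖v (x, s)‖ ^ 2 + 2 * p (x, s)) * ∑ i, v (x, s) i * ∑ k ∈ Finset.range n, pd i (tk z.1 z.2 R θ n k s) x := by
      simp only [tk_sdz hθ hR n hn]
      refine setIntegral_eq_integral_of_forall_compl_eq_zero fun x hx => ?_
      have : ∀ i k, pd i (tk z.1 z.2 R θ n k s) x = 0 := fun i k =>
        image_eq_zero_of_notMem_tsupport fun hh => hx (hKΩ (((hAdm k).pd i).2.2 hh))
      simp [this]
    rw [hfull]
    refine (slice_flux hsol.meas_v hsol.meas_p hs2 n _ c hAdm).trans (Finset.sum_le_sum fun k hk => hc k (Finset.mem_range.mp hk))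
  calc _ ≤ ∫⁻ s in Ioo 0 t, ∑ k ∈ Finset.range n, (TI z (θ ^ k * R)).indicator (fun s => oR (L k) * H k s) s := lintegral_mono_ae hsl
    _ ≤ ∫⁻ s, ∑ k ∈ Finset.range n, (TI z (θ ^ k * R)).indicator (fun s => oR (L k) * H k s) s := setLIntegral_le_lintegral _ _
    _ = ∑ k ∈ Finset.range n, oR (L k) * ∫⁻ s in TI z (θ ^ k * R), H k s := by
        rw [lintegral_finsetSum _ fun k _ => ((hHm k).const_mul _).indicator (hmT k)]
        refine Finset.sum_congr rfl fun k _ => ?_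
        rw [lintegral_indicator (hmT k), lintegral_const_mul' _ _ ofReal_ne_top]
    _ ≤ ∑ k ∈ Finset.range n, oR (L k) * oR (C * (θ ^ k * R) ^ 2 * Psi (α k) (η k) (π k)) := by
        gcongr with k hk
        exact (hH k (Finset.mem_range.mp hk)).1
    _ = oR (C' * C * (θ ^ 4)⁻¹ * ∑ k ∈ Finset.range n, ((θ ^ k * R) ^ 2)⁻¹ * Psi (α k) (η k) (π k)) := by
        rw [Finset.mul_sum, ofReal_sum_of_nonneg]
        · refine Finset.sum_congr rfl fun k _ => ?_
          rw [← ofReal_mul (hL0 k)]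
          congr 1
          have := (hrk k).ne'
          simp only [hL]
          field_simp
        · intro k _
          have := hPsi k
          positivity
end
end

section
lemma lint_Ioo_sup {a b : ℝ} {g : ℝ → ℝ≥0∞} {G : Set ℝ} {c : ℝ≥0∞} (hab : a < b) (hG : ∀ᵐ t ∂(volume.restrict (Ioo a b)), t ∈ G)
    (h : ∀ t ∈ G, t ∈ Ioo a b → ∫⁻ s in Ioo a t, g s ≤ c) : ∫⁻ s in Ioo a b, g s ≤ c := by
  have hex : ∀ n : ℕ, ∃ t ∈ G, t ∈ Ioo a b ∧ b - 1 / ((n : ℝ) + 1) < t := by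
    intro n
    by_contra hcon
    push Not at hcon
    have hm : max a (b - 1 / ((n : ℝ) + 1)) < b := max_lt hab (by have : (0:ℝ) < 1 / ((n : ℝ) + 1) := by positivity
                                                                  linarith)
    have h1 : ∀ᵐ t ∂(volume.restrict (Ioo (max a (b - 1 / ((n : ℝ) + 1))) b)), False := by
      filter_upwards [ae_restrict_of_ae_restrict_of_subset (Ioo_subset_Ioo_left (le_max_left _ _)) hG, ae_restrict_mem measurableSet_Ioo] with t h2 h3
      have h4 := hcon t h2 ⟨(le_max_left _ _).trans_lt h3.1, h3.2⟩
      exact absurd ((le_max_right _ _).trans_lt h3.1) (not_lt.mpr h4)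
    rw [ae_iff] at h1
    simp at h1
    have hn0 : (0:ℝ) ≤ n := by positivity
    rcases h1 with h1 | h1 <;> linarith
  choose τ hτG hτI hτ using hex
  have hU : Ioo a b ⊆ ⋃ n : ℕ, Ioo a (b - 1 / ((n : ℝ) + 1)) := by
    intro s hs
    obtain ⟨n, hn⟩ := exists_nat_one_div_lt (sub_pos.mpr hs.2)
    exact mem_iUnion.mpr ⟨n, hs.1, by linarith⟩
  have hmono : Monotone fun n : ℕ => Ioo a (b - 1 / ((n : ℝ) + 1)) := by
    intro n m hnm
    apply Ioo_subset_Ioo_right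
    have : 1 / ((m : ℝ) + 1) ≤ 1 / ((n : ℝ) + 1) := by
      apply one_div_le_one_div_of_le (by positivity)
      have : (n : ℝ) ≤ m := by exact_mod_cast hnm
      linarith
    linarith
  calc _ ≤ ∫⁻ s in ⋃ n : ℕ, Ioo a (b - 1 / ((n : ℝ) + 1)), g s := lintegral_mono_set hU
    _ = ⨆ n : ℕ, ∫⁻ s in Ioo a (b - 1 / ((n : ℝ) + 1)), g s := setLIntegral_iUnion_of_directed _ hmono.directed_le
    _ ≤ c := iSup_le fun n => (lintegral_mono_set (Ioo_subset_Ioo_right (hτ n).le)).trans (h _ (hτG n) (hτI n))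

/-- energy quantity -/
def SS (C1 C2 R θ : ℝ) (n : ℕ) (α η π : ℕ → ℝ) : ℝ :=
  C1 * (R ^ 2)⁻¹ * α 0 + C2 * (θ ^ 4)⁻¹ * ∑ k ∈ Finset.range n, ((θ ^ k * R) ^ 2)⁻¹ * Psi (α k) (η k) (π k)

lemma energy : ∃ C1 : ℝ, 0 < C1 ∧ ∃ C2 : ℝ, 0 < C2 ∧ ∀ {Ω K : Set E3} {T : ℝ} {v : ST → E3} {Dv : ST → Fin 3 → Fin 3 → ℝ} {p : ST → ℝ} {v₀ : E3 → E3},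
    IsOpen Ω → IsSuitableWeakSolution Ω T v Dv p v₀ → ∀ (z : ST) (R θ : ℝ) (n : ℕ) (α η π : ℕ → ℝ), 0 < R → 0 < θ → θ ≤ 1 / 8 → 1 ≤ n →
    (∀ k, 0 ≤ α k) → (∀ k, 0 ≤ η k) → (∀ k, 0 ≤ π k) → closedBall z.1 R ⊆ K → K ⊆ Ω → 0 < z.2 - R ^ 2 → z.2 + R ^ 2 < T →
    (∀ᵐ t ∂(volume.restrict (Ioo 0 T)), SL K v Dv p t) →
    (∀ k < n, VB v z (θ ^ k * R) (α k) ∧ GB Dv z (θ ^ k * R) (η k) ∧ PB p z (θ ^ k * R) (π k)) →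
    ∀ t, Good Ω T v Dv p t → t ∈ Ioc (z.2 - (θ ^ n * R) ^ 2) z.2 →
    ∫⁻ x in ball z.1 (θ ^ n * R), ‖v (x, t)‖ₑ ^ 2 ≤ oR (SS C1 C2 R θ n α η π * (θ ^ n * R) ^ 3) ∧
    ∫⁻ s in Ioo (z.2 - (θ ^ n * R) ^ 2) t, ∫⁻ x in ball z.1 (θ ^ n * R), gn (Dv (x, s)) ≤
      oR (SS C1 C2 R θ n α η π * (θ ^ n * R) ^ 3) := by
  obtain ⟨C1, hC1, h1⟩ := heat_part
  obtain ⟨C2, hC2, h2⟩ := flux_part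
  refine ⟨C1, hC1, C2, hC2, fun {Ω K T v Dv p v₀} hΩ hsol z R θ n α η π hR hθ hθ1 hn hα hη hπ hBK hKΩ h0 hT hSL hB t htG ht => ?_⟩
  have hv := hsol.meas_v
  have hDv := hsol.meas_Dv
  set r := θ ^ n * R with hr
  have hr0 : 0 < r := by positivity
  have hrR : r ≤ R / 8 := by
    have : θ ^ n ≤ θ ^ 1 := pow_le_pow_of_le_one hθ.le (by linarith) hn
    rw [hr]; nlinarith
  have hR2 : 0 < R ^ 2 := by positivity
  have hrR2 : r ^ 2 ≤ R ^ 2 := by gcongr; linarith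
  obtain ⟨ht0, htE, htf⟩ := htG
  have hV0 : VB v z R (α 0) := by simpa using (hB 0 (by omega)).1
  obtain ⟨i1, b1⟩ := h1 hsol z R r (α 0) t hR hr0 (hα 0) ht.2 ht0.2.le hV0
  have b2 := h2 hsol z R θ t n α η π hR hθ (by linarith) hn hα hη hπ hBK hKΩ h0.le ht.2 (by linarith) hSL hB
  set φ := tf z.1 z.2 R r with hφ
  have hcd : ContDiff ℝ smo φ := tf_contDiff hr0
  have hsupp : tsupport φ ⊆ _ := tf_supp (x0 := z.1) (t0 := z.2) (r := r) hR
  have hlow : ∀ x ∈ ball z.1 r, ∀ s ∈ Icc (z.2 - r ^ 2) z.2, (r ^ 3)⁻¹ ≤ φ (x, s) := fun x hx s hs => tf_lower hr0 hrR hx hs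
  have hnn : ∀ w, 0 ≤ φ w := tf_nonneg _ _ _ _
  clear_value φ
  have hcs : HasCompactSupport φ :=
    HasCompactSupport.of_support_subset_isCompact ((isCompact_closedBall z.1 (R/4)).prod isCompact_Icc) ((subset_tsupport _).trans hsupp)
  have hE := htE φ hcd hcs (hsupp.trans (prod_mono ((closedBall_subset_closedBall (by linarith)).trans (hBK.trans hKΩ))
    (fun s hs => ⟨by linarith [hs.1], by linarith [hs.2]⟩))) hnn
  set S := SS C1 C2 R θ n α η π with hS
  have hPsi : 0 ≤ C2 * (θ ^ 4)⁻¹ * ∑ k ∈ Finset.range n, ((θ ^ k * R) ^ 2)⁻¹ * Psi (α k) (η k) (π k) :=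
    mul_nonneg (by positivity) (Finset.sum_nonneg fun k _ => mul_nonneg (by positivity) (Psi_nonneg (hα k) (hη k) (hπ k)))
  have hα0 := hα 0
  have hS0 : 0 ≤ S := add_nonneg (by positivity) hPsi
  have hRHS : (∫ x in Ω, ‖v (x, t)‖ ^ 2 * φ (x, t)) + 2 * (∫ w in Ω ×ˢ Ioo 0 t, (∑ i, ∑ j, (Dv w i j) ^ 2) * φ w) ≤ S := by
    refine hE.trans ?_
    change ∫ w in Ω ×ˢ Ioo 0 t, (‖v w‖ ^ 2 * heat φ w + (‖v w‖ ^ 2 + 2 * p w) * ∑ i, v w i * sdz φ i w) ≤ S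
    by_cases hi : IntegrableOn (fun w => (‖v w‖ ^ 2 + 2 * p w) * ∑ i, v w i * sdz φ i w) (Ω ×ˢ Ioo 0 t)
    · rw [integral_add i1 hi]
      exact add_le_add b1 (b2 hi)
    · rw [integral_undef]
      · exact hS0
      · intro hh
        apply hi
        refine (hh.sub i1).congr (ae_of_all _ fun w => ?_)
        simp
  obtain ⟨B, hBd⟩ := hcs.exists_bound_of_continuous hcd.continuous
  have iv : IntegrableOn (fun x => ‖v (x, t)‖ ^ 2 * φ (x, t)) Ω := by
    have hh : IntegrableOn (fun x => ‖v (x, t)‖ ^ 2) Ω := by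
      refine ⟨Measurable.aestronglyMeasurable (by fun_prop), ?_⟩
      refine lt_of_le_of_lt (le_of_eq ?_) (lt_top_iff_ne_top.mpr htf)
      refine lintegral_congr fun x => ?_
      rw [enorm_pow, enorm_norm]
    exact Integrable.mul_bdd (c := B) hh (hcd.continuous.comp (by fun_prop : Continuous fun x : E3 => (x, t))).aestronglyMeasurable (ae_of_all _ fun x => hBd _)
  have iD : IntegrableOn (fun w => (∑ i, ∑ j, (Dv w i j) ^ 2) * φ w) (Ω ×ˢ Ioo 0 t) :=
    Integrable.mul_bdd (c := B) ((D2_int hsol).mono_set (prod_mono subset_rfl (Ioo_subset_Ioo_right ht0.2.le))) hcd.continuous.aestronglyMeasurable (ae_of_all _ hBd)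
  have nv : ∀ x, 0 ≤ ‖v (x, t)‖ ^ 2 * φ (x, t) := fun x => mul_nonneg (by positivity) (hnn _)
  have nD : ∀ w, 0 ≤ (∑ i, ∑ j, (Dv w i j) ^ 2) * φ w := fun w => mul_nonneg (by positivity) (hnn _)
  have pv : 0 ≤ ∫ x in Ω, ‖v (x, t)‖ ^ 2 * φ (x, t) := integral_nonneg nv
  have pD : 0 ≤ ∫ w in Ω ×ˢ Ioo 0 t, (∑ i, ∑ j, (Dv w i j) ^ 2) * φ w := integral_nonneg nD
  have hmul : ∀ a y : ℝ, 0 ≤ a → (r ^ 3)⁻¹ ≤ y → oR a ≤ oR (r ^ 3) * oR (a * y) := by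
    intro a y ha hy
    rw [← ofReal_mul (by positivity)]
    apply ofReal_le_ofReal
    have : 1 ≤ r ^ 3 * y := by
      calc (1:ℝ) = r ^ 3 * (r ^ 3)⁻¹ := by field_simp
        _ ≤ _ := by gcongr
    nlinarith
  have hfin : ∀ I : ℝ, I ≤ S → oR (r ^ 3) * oR I ≤ oR (S * r ^ 3) := by
    intro I hI
    rw [← ofReal_mul (by positivity), mul_comm]
    apply ofReal_le_ofReal
    gcongr
  have hbΩ : ball z.1 r ⊆ Ω := (ball_subset_closedBall.trans (closedBall_subset_closedBall (by linarith))).trans (hBK.trans hKΩ)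
  constructor
  · calc _ ≤ ∫⁻ x in ball z.1 r, oR (r ^ 3) * oR (‖v (x, t)‖ ^ 2 * φ (x, t)) := by
          refine setLIntegral_mono' measurableSet_ball fun x hx => ?_
          rw [← ofReal_norm, ← ofReal_pow (norm_nonneg _)]
          exact hmul _ _ (by positivity) (hlow x hx t ⟨ht.1.le, ht.2⟩)
      _ ≤ oR (r ^ 3) * oR (∫ x in Ω, ‖v (x, t)‖ ^ 2 * φ (x, t)) := by
          rw [lintegral_const_mul' _ _ ofReal_ne_top, ofReal_integral_eq_lintegral_ofReal iv (ae_of_all _ nv)]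
          exact mul_le_mul' le_rfl (lintegral_mono_set hbΩ)
      _ ≤ _ := hfin _ (by linarith)
  · have hsub : ball z.1 r ×ˢ Ioo (z.2 - r ^ 2) t ⊆ Ω ×ˢ Ioo 0 t := prod_mono hbΩ (Ioo_subset_Ioo_left (by linarith))
    have hmg : Measurable fun w => gn (Dv w) := measurable_gn.comp hDv
    rw [← lfub hmg]
    calc _ ≤ ∫⁻ w in ball z.1 r ×ˢ Ioo (z.2 - r ^ 2) t, oR (r ^ 3) * oR ((∑ i, ∑ j, (Dv w i j) ^ 2) * φ w) := by
          refine setLIntegral_mono' (measurableSet_ball.prod measurableSet_Ioo) fun w hw => ?_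
          exact hmul _ _ (by positivity) (hlow w.1 hw.1 w.2 ⟨hw.2.1.le, (hw.2.2.trans_le ht.2).le⟩)
      _ ≤ oR (r ^ 3) * oR (∫ w in Ω ×ˢ Ioo 0 t, (∑ i, ∑ j, (Dv w i j) ^ 2) * φ w) := by
          rw [lintegral_const_mul' _ _ ofReal_ne_top, ofReal_integral_eq_lintegral_ofReal iD (ae_of_all _ nD)]
          exact mul_le_mul' le_rfl (lintegral_mono_set hsub)
      _ ≤ _ := hfin _ (by linarith)

/-- standing hypotheses -/
def Hyp (Ω K : Set E3) (T : ℝ) (v : ST → E3) (Dv : ST → Fin 3 → Fin 3 → ℝ) (p : ST → ℝ) (z : ST) (R : ℝ) : Prop :=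
  IsOpen Ω ∧ (∃ v₀, IsSuitableWeakSolution Ω T v Dv p v₀) ∧ 0 < R ∧ closedBall z.1 R ⊆ K ∧ K ⊆ Ω ∧ 0 < z.2 - R ^ 2 ∧ z.2 + R ^ 2 < T ∧
  ∀ᵐ t ∂(volume.restrict (Ioo 0 T)), SL K v Dv p t

lemma estep : ∃ C1 : ℝ, 0 < C1 ∧ ∃ C2 : ℝ, 0 < C2 ∧ ∀ {Ω K : Set E3} {T : ℝ} {v : ST → E3} {Dv : ST → Fin 3 → Fin 3 → ℝ} {p : ST → ℝ}
    (z : ST) (R θ : ℝ) (n : ℕ) (α η π : ℕ → ℝ), Hyp Ω K T v Dv p z R → 0 < θ → θ ≤ 1 / 8 → 1 ≤ n →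
    (∀ k, 0 ≤ α k) → (∀ k, 0 ≤ η k) → (∀ k, 0 ≤ π k) →
    (∀ k < n, VB v z (θ ^ k * R) (α k) ∧ GB Dv z (θ ^ k * R) (η k) ∧ PB p z (θ ^ k * R) (π k)) →
    VB v z (θ ^ n * R) (SS C1 C2 R θ n α η π * (θ ^ n * R) ^ 2) ∧ GB Dv z (θ ^ n * R) (SS C1 C2 R θ n α η π * (θ ^ n * R) ^ 2) ∧
    (Good Ω T v Dv p z.2 → ∫⁻ x in ball z.1 (θ ^ n * R), ‖v (x, z.2)‖ₑ ^ 2 ≤ oR (SS C1 C2 R θ n α η π * (θ ^ n * R) ^ 3)) := by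
  obtain ⟨C1, hC1, C2, hC2, h⟩ := energy
  refine ⟨C1, hC1, C2, hC2, fun {Ω K T v Dv p} z R θ n α η π hH hθ hθ1 hn hα hη hπ hB => ?_⟩
  obtain ⟨hΩ, ⟨v₀, hsol⟩, hR, hBK, hKΩ, h0, hT, hSL⟩ := hH
  have hE := h hΩ hsol z R θ n α η π hR hθ hθ1 hn hα hη hπ hBK hKΩ h0 hT hSL hB
  have hr0 : 0 < θ ^ n * R := by positivity
  have hrR : θ ^ n * R ≤ R := mul_le_of_le_one_left hR.le (pow_le_one₀ hθ.le (by linarith))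
  set r := θ ^ n * R with hr
  have hr2 : r ^ 2 ≤ R ^ 2 := by gcongr
  have hrp : 0 < r ^ 2 := by positivity
  have hsub : TI z r ⊆ Ioo 0 T := fun s hs => ⟨by linarith [hs.1], by linarith [hs.2, sq_nonneg R]⟩
  have hg := ae_restrict_of_ae_restrict_of_subset hsub (ae_good hsol)
  have e : SS C1 C2 R θ n α η π * r ^ 2 * r = SS C1 C2 R θ n α η π * r ^ 3 := by ring
  refine ⟨?_, ?_, fun hG => (hE _ hG ⟨by linarith, le_rfl⟩).1⟩
  · unfold VB
    rw [e]
    filter_upwards [hg, ae_restrict_mem measurableSet_Ioo] with t h1 h2 using (hE t h1 ⟨h2.1, h2.2.le⟩).1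
  · unfold GB
    rw [e]
    exact lint_Ioo_sup (G := {t | Good Ω T v Dv p t}) (by linarith) hg fun t h1 h2 => (hE t h1 ⟨h2.1, h2.2.le⟩).2
end

section
section
variable {Ω K : Set E3} {T : ℝ} {v : ST → E3} {Dv : ST → Fin 3 → Fin 3 → ℝ} {p : ST → ℝ}

lemma VB.mono {z : ST} {r a b : ℝ} (h : VB v z r a) (hr : 0 ≤ r) (hab : a ≤ b) : VB v z r b := by
  filter_upwards [h] with t ht using ht.trans (ofReal_le_ofReal (by gcongr))

lemma GB.mono {z : ST} {r a b : ℝ} (h : GB Dv z r a) (hr : 0 ≤ r) (hab : a ≤ b) : GB Dv z r b :=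
  h.trans (ofReal_le_ofReal (by gcongr))

lemma PB.mono {z : ST} {r a b : ℝ} (h : PB p z r a) (hr : 0 ≤ r) (ha : 0 ≤ a) (hab : a ≤ b) : PB p z r b := by
  obtain ⟨m, h1, h2, h3⟩ := h
  exact ⟨m, h1, h2.trans (ofReal_le_ofReal (by gcongr)), h3⟩

lemma Hyp.SLr {z : ST} {R r : ℝ} (h : Hyp Ω K T v Dv p z R) (hr : 0 < r) (hrR : r ≤ R) :
    closedBall z.1 r ⊆ K ∧ ∀ᵐ t ∂(volume.restrict (TI z r)), SL K v Dv p t := by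
  obtain ⟨hΩ, hsol, hR, hBK, hKΩ, h0, hT, hSL⟩ := h
  have hr2 : r ^ 2 ≤ R ^ 2 := by gcongr
  refine ⟨(closedBall_subset_closedBall hrR).trans hBK, ae_restrict_of_ae_restrict_of_subset (fun s hs => ?_) hSL⟩
  exact ⟨by linarith [hs.1], by linarith [hs.2, sq_nonneg R]⟩

lemma psi_bound {μ L s : ℝ} (hμ : 0 ≤ μ) (hL : 0 ≤ L) (hs : 0 ≤ s) :
    Psi (μ ^ 2 * s ^ 12) (μ ^ 2 * s ^ 12) (L * (μ ^ 2 * s ^ 12)) ≤ (2 + 2 * L) * μ ^ 3 * s ^ 18 := by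
  have h1 : (μ ^ 2 * s ^ 12) ^ hlf = μ * s ^ 6 := by
    rw [← Real.sqrt_eq_rpow, show μ ^ 2 * s ^ 12 = (μ * s ^ 6) ^ 2 by ring, Real.sqrt_sq (by positivity)]
  have h2 : (μ ^ 2 * s ^ 12 + μ ^ 2 * s ^ 12) ^ hlf ≤ 2 * (μ * s ^ 6) := by
    rw [← Real.sqrt_eq_rpow]
    apply Real.sqrt_le_iff.mpr
    constructor
    · positivity
    · have : 0 ≤ μ ^ 2 * s ^ 12 := by positivity
      nlinarith
  unfold Psi
  rw [h1]
  have : L * (μ ^ 2 * s ^ 12) * (μ ^ 2 * s ^ 12 + μ ^ 2 * s ^ 12) ^ hlf ≤ L * (μ ^ 2 * s ^ 12) * (2 * (μ * s ^ 6)) := by gcongr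
  nlinarith

lemma decay : ∃ θ : ℝ, 0 < θ ∧ θ < 1 ∧ ∃ m : ℝ, 0 < m ∧ ∃ A : ℝ, 0 < A ∧ ∀ {Ω K : Set E3} {T : ℝ} {v : ST → E3} {Dv : ST → Fin 3 → Fin 3 → ℝ} {p : ST → ℝ}
    (z : ST) (R : ℝ), Hyp Ω K T v Dv p z R → VB v z R m → GB Dv z R m → PB p z R m → Good Ω T v Dv p z.2 →
    ∀ n : ℕ, ∫⁻ x in ball z.1 (θ ^ (n + 1) * R), ‖v (x, z.2)‖ₑ ^ 2 ≤ oR (A * (R ^ 2)⁻¹ * (θ ^ (n + 1) * R) ^ 3) := by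
  obtain ⟨C1, hC1, C2, hC2, hE⟩ := estep
  obtain ⟨C, hC, hP⟩ := pstep
  obtain ⟨σ, hσ, hσ2, hσ3, hσ4⟩ : ∃ σ : ℝ, 0 < σ ∧ σ ≤ 1 / 2 ∧ C1 * σ ≤ 1 / 2 ∧ C * σ ≤ 1 / 2 := by
    refine ⟨1 / (2 + 2 * C1 + 2 * C), by positivity, ?_, ?_, ?_⟩
    · rw [div_le_div_iff₀ (by positivity) (by positivity)]; linarith
    · rw [mul_one_div, div_le_div_iff₀ (by positivity) (by positivity)]; linarith
    · rw [mul_one_div, div_le_div_iff₀ (by positivity) (by positivity)]; linarith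
  set θ := σ ^ 8 with hθ
  have hθ0 : 0 < θ := by positivity
  have hθ8 : θ ≤ 1 / 8 := by
    calc θ ≤ (1 / 2) ^ 8 := by rw [hθ]; gcongr
      _ ≤ 1 / 8 := by norm_num
  obtain ⟨D, hD, hP⟩ := hP θ hθ0 (by linarith)
  set L := 2 * D / σ ^ 12 with hL
  have hL0 : 0 < L := by positivity
  set Z := C2 * (θ ^ 4)⁻¹ * ((2 + 2 * L) * 2) with hZ
  have hZ0 : 0 < Z := by positivity
  set μ := 1 / (2 * Z) with hμ
  have hμ0 : 0 < μ := by positivity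
  have hμZ : Z * μ ≤ 1 / 2 := by rw [hμ]; apply le_of_eq; field_simp
  set A := C1 * μ ^ 2 + Z * μ ^ 3 with hA
  refine ⟨θ, hθ0, by linarith, min (μ ^ 2) (L * μ ^ 2), by positivity, A, by positivity, fun {Ω K T v Dv p} z R hH hV hG hPB hGood => ?_⟩
  have hR : 0 < R := hH.2.2.1
  obtain ⟨v₀, hsol⟩ := hH.2.1
  set α : ℕ → ℝ := fun k => μ ^ 2 * (σ ^ k) ^ 12 with hα
  set π : ℕ → ℝ := fun k => L * (μ ^ 2 * (σ ^ k) ^ 12) with hπ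
  have hα0 : ∀ k, 0 ≤ α k := fun k => by positivity
  have hπ0 : ∀ k, 0 ≤ π k := fun k => by positivity
  have hSS : ∀ n, SS C1 C2 R θ n α α π ≤ A * (R ^ 2)⁻¹ := by
    intro n
    have h1 : ∀ k ∈ Finset.range n, ((θ ^ k * R) ^ 2)⁻¹ * Psi (α k) (α k) (π k) ≤ (2 + 2 * L) * μ ^ 3 * (R ^ 2)⁻¹ * hlf ^ k := by
      intro k _
      have h2 := psi_bound hμ0.le hL0.le (pow_nonneg hσ.le k)
      calc _ ≤ ((θ ^ k * R) ^ 2)⁻¹ * ((2 + 2 * L) * μ ^ 3 * (σ ^ k) ^ 18) := by gcongr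
        _ = (2 + 2 * L) * μ ^ 3 * (R ^ 2)⁻¹ * (σ ^ k) ^ 2 := by
          have : θ ^ k = (σ ^ k) ^ 8 := by rw [hθ]; ring
          rw [this]
          have : σ ^ k ≠ 0 := by positivity
          field_simp
        _ ≤ _ := by
          gcongr
          calc (σ ^ k) ^ 2 ≤ (σ ^ k) ^ 1 := pow_le_pow_of_le_one (by positivity) (pow_le_one₀ hσ.le (by linarith)) (by norm_num)
            _ = σ ^ k := pow_one _
            _ ≤ _ := by gcongr
    have h2 : ∑ k ∈ Finset.range n, hlf ^ k ≤ 2 := by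
      have := sum_geometric_two_le n
      simpa using this
    unfold SS
    calc _ ≤ C1 * (R ^ 2)⁻¹ * α 0 + C2 * (θ ^ 4)⁻¹ * ((2 + 2 * L) * μ ^ 3 * (R ^ 2)⁻¹ * 2) := by
          gcongr
          refine (Finset.sum_le_sum h1).trans ?_
          rw [← Finset.mul_sum]
          gcongr
      _ = A * (R ^ 2)⁻¹ := by simp only [hα, hA, hZ]; ring
  have hA2 : A * σ ≤ μ ^ 2 := by
    have h1 : C1 * μ ^ 2 * σ ≤ μ ^ 2 / 2 := by nlinarith [pow_pos hμ0 2]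
    have h2 : Z * μ ^ 3 * σ ≤ μ ^ 2 / 2 := by
      calc Z * μ ^ 3 * σ = (Z * μ) * μ ^ 2 * σ := by ring
        _ ≤ (1 / 2) * μ ^ 2 * 1 := by gcongr; linarith
        _ = _ := by ring
    rw [hA]; linarith
  have hind : ∀ n, ∀ k < n, VB v z (θ ^ k * R) (α k) ∧ GB Dv z (θ ^ k * R) (α k) ∧ PB p z (θ ^ k * R) (π k) := by
    intro n
    induction n with
    | zero => intro k hk; omega
    | succ n ih =>
      intro k hk
      rcases Nat.lt_succ_iff_lt_or_eq.mp hk with hk | rfl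
      · exact ih k hk
      have hr0 : 0 < θ ^ k * R := by positivity
      rcases Nat.eq_zero_or_pos k with rfl | hk0
      · simp only [pow_zero, one_mul, hα, hπ, one_pow, mul_one]
        exact ⟨hV.mono hR.le (min_le_left _ _), hG.mono hR.le (min_le_left _ _), hPB.mono hR.le (by positivity) (min_le_right _ _)⟩
      have hle : SS C1 C2 R θ k α α π * (θ ^ k * R) ^ 2 ≤ α k := by
        calc _ ≤ A * (R ^ 2)⁻¹ * (θ ^ k * R) ^ 2 := by gcongr; exact hSS k
          _ = A * (σ ^ k) ^ 16 := by
            have : θ ^ k = (σ ^ k) ^ 8 := by rw [hθ]; ring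
            rw [this]; field_simp
          _ = A * (σ ^ k) ^ 4 * (σ ^ k) ^ 12 := by ring
          _ ≤ A * σ * (σ ^ k) ^ 12 := by
            have : (σ ^ k) ^ 4 ≤ σ := by
              rw [← pow_mul]
              exact (pow_le_pow_of_le_one hσ.le (by linarith) (by omega : 1 ≤ k * 4)).trans (pow_one _).le
            have hA0 : 0 ≤ A := by positivity
            gcongr
          _ ≤ _ := by simp only [hα]; gcongr
      obtain ⟨e1, e2, -⟩ := hE z R θ k α α π hH hθ0 hθ8 hk0 hα0 hα0 hπ0 ih
      refine ⟨e1.mono hr0.le hle, e2.mono hr0.le hle, ?_⟩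
      obtain ⟨j, rfl⟩ : ∃ j, k = j + 1 := ⟨k - 1, by omega⟩
      obtain ⟨f1, f2, f3⟩ := ih j (by omega)
      have hrj : 0 < θ ^ j * R := by positivity
      obtain ⟨s1, s2⟩ := hH.SLr hrj (mul_le_of_le_one_left hR.le (pow_le_one₀ hθ0.le (by linarith)))
      have := hP hsol.meas_v hsol.meas_Dv hsol.meas_p z (θ ^ j * R) (α j) (α j) (π j) hrj (hα0 j) (hα0 j) (hπ0 j) s1 s2 f1 f2 f3
      rw [show θ ^ (j + 1) * R = θ * (θ ^ j * R) by ring]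
      refine this.mono (by positivity) (by have := hπ0 j; have := hα0 j; positivity) ?_
      have t1 : θ ^ (13 / 8 : ℝ) = σ ^ 13 := by
        rw [hθ, ← Real.rpow_natCast, ← Real.rpow_natCast, ← Real.rpow_mul hσ.le]; norm_num
      have t2 : (α j * α j) ^ hlf = α j := by
        rw [← Real.sqrt_eq_rpow, Real.sqrt_mul_self (hα0 j)]
      rw [t1, t2]
      have t3 : D = L * σ ^ 12 / 2 := by rw [hL]; field_simp
      have t4 : π (j + 1) = L * σ ^ 12 * α j := by simp only [hα, hπ]; ring
      have t5 : C * σ ^ 13 * π j = (C * σ) * (L * σ ^ 12 * α j) := by simp only [hα, hπ]; ring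
      rw [t4, t5]
      have hX : 0 ≤ L * σ ^ 12 * α j := by have := hα0 j; positivity
      have : D * α j = L * σ ^ 12 * α j / 2 := by rw [t3]; ring
      rw [this]
      nlinarith
  intro n
  obtain ⟨-, -, e3⟩ := hE z R θ (n + 1) α α π hH hθ0 hθ8 (by omega) hα0 hα0 hπ0 (hind (n + 1))
  refine (e3 hGood).trans (ofReal_le_ofReal ?_)
  gcongr
  exact hSS _

lemma alg1 {c D e κ a π q w P : ℝ} (hc : 0 < c) (he0 : 0 < e) (he1 : e ≤ 1) (ha : 0 ≤ a) (hπ : 0 ≤ π) (hD : 0 < D)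
    (hq : q ≤ 1 / 16) (hw0 : 0 ≤ w) (hw : w ≤ 1 / 4) (hP : P ≤ a * e ^ 2 + a ^ 2 * e + π * (a + e))
    (h2 : 16 * c * e ≤ 1) (h3 : 16 * (32 * c ^ 2 * D ^ 2) * e ≤ 1) (h4 : (1 / 16 + 4 * c ^ 2) * e ≤ κ) :
    q * a ^ 2 + c * P + 32 * c ^ 2 * (w * π + D * (a * e)) ^ 2 ≤ (a ^ 2 + 32 * c ^ 2 * π ^ 2) / 2 + κ := by
  have ha2 := sq_nonneg a
  have u1 : q * a ^ 2 ≤ a ^ 2 / 16 := by nlinarith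
  have w1 : c * (a * e ^ 2) ≤ a ^ 2 / 16 + 4 * c ^ 2 * e ^ 4 := by nlinarith [sq_nonneg (a / 4 - 2 * c * e ^ 2)]
  have w2 : c * (a ^ 2 * e) ≤ a ^ 2 / 16 := by nlinarith
  have w3 : c * (π * a) ≤ a ^ 2 / 16 + 4 * c ^ 2 * π ^ 2 := by nlinarith [sq_nonneg (a / 4 - 2 * c * π)]
  have w4 : c * (π * e) ≤ e ^ 2 / 16 + 4 * c ^ 2 * π ^ 2 := by nlinarith [sq_nonneg (e / 4 - 2 * c * π)]
  have w5 := mul_le_mul_of_nonneg_left hP hc.le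
  have u3 : (w * π + D * (a * e)) ^ 2 ≤ π ^ 2 / 8 + 2 * D ^ 2 * (a ^ 2 * e ^ 2) := by
    have w1 : w * π ≤ π / 4 := by nlinarith
    calc _ ≤ (π / 4 + D * (a * e)) ^ 2 := by gcongr
      _ ≤ 2 * (π / 4) ^ 2 + 2 * (D * (a * e)) ^ 2 := by nlinarith [sq_nonneg (π / 4 - D * (a * e))]
      _ = _ := by ring
  have u6 := mul_le_mul_of_nonneg_left u3 (by positivity : 0 ≤ 32 * c ^ 2)
  have hee : e ^ 2 ≤ e := by nlinarith
  have u4 : 32 * c ^ 2 * (2 * D ^ 2 * (a ^ 2 * e ^ 2)) ≤ a ^ 2 / 8 := by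
    have h5 : 16 * (32 * c ^ 2 * D ^ 2) * e ^ 2 ≤ 1 := le_trans (by gcongr) h3
    have := mul_le_mul_of_nonneg_right h5 ha2
    linarith
  have u5 : e ^ 2 / 16 + 4 * c ^ 2 * e ^ 4 ≤ κ := by
    have h4' : e ^ 4 ≤ e := by
      calc e ^ 4 ≤ e ^ 1 := pow_le_pow_of_le_one he0.le he1 (by norm_num)
        _ = e := pow_one e
    have := mul_le_mul_of_nonneg_left h4' (by positivity : 0 ≤ 4 * c ^ 2)
    linarith
  have u9 : 0 ≤ c ^ 2 * π ^ 2 := by positivity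
  linarith

lemma small_scale (m : ℝ) (hm : 0 < m) : ∃ ε : ℝ, 0 < ε ∧ ∀ {Ω K : Set E3} {T : ℝ} {v : ST → E3} {Dv : ST → Fin 3 → Fin 3 → ℝ} {p : ST → ℝ}
    (z : ST) (R α₀ π₀ : ℝ), Hyp Ω K T v Dv p z R → 0 ≤ α₀ → 0 ≤ π₀ → VB v z R α₀ → PB p z R π₀ → (∀ r, 0 < r → r ≤ R → GB Dv z r ε) →
    ∃ r, 0 < r ∧ r ≤ R ∧ VB v z r m ∧ GB Dv z r m ∧ PB p z r m := by
  obtain ⟨C1, hC1, C2, hC2, hE⟩ := estep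
  obtain ⟨C, hC, hP⟩ := pstep
  obtain ⟨θ, hθ, hθ8, hθ3, hθ4⟩ : ∃ θ : ℝ, 0 < θ ∧ θ ≤ 1 / 8 ∧ C1 * θ ≤ 1 / 16 ∧ C * θ ≤ 1 / 4 := by
    refine ⟨1 / (8 + 16 * C1 + 4 * C), by positivity, ?_, ?_, ?_⟩
    · rw [div_le_div_iff₀ (by positivity) (by positivity)]; linarith
    · rw [mul_one_div, div_le_div_iff₀ (by positivity) (by positivity)]; linarith
    · rw [mul_one_div, div_le_div_iff₀ (by positivity) (by positivity)]; linarith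
  obtain ⟨D, hD, hP⟩ := hP θ hθ (by linarith)
  set c := C2 * (θ ^ 4)⁻¹ * θ ^ 2 with hc
  have hc0 : 0 < c := by positivity
  set B := 32 * c ^ 2 with hB
  have hB0 : 0 < B := by positivity
  set κ := min m (B * m ^ 2) / 4 with hκ
  have hκ0 : 0 < κ := by positivity
  obtain ⟨e, he0, he1, he2, he3, he4, he5⟩ : ∃ e : ℝ, 0 < e ∧ e ≤ 1 ∧ 16 * c * e ≤ 1 ∧ 16 * (B * D ^ 2) * e ≤ 1 ∧ (1 / 16 + 4 * c ^ 2) * e ≤ κ ∧ e ≤ m := by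
    refine ⟨1 / (1 + 16 * c + 16 * (B * D ^ 2) + (1 / 16 + 4 * c ^ 2) / κ + 1 / m), by positivity, ?_, ?_, ?_, ?_, ?_⟩
    all_goals set Y := 1 + 16 * c + 16 * (B * D ^ 2) + (1 / 16 + 4 * c ^ 2) / κ + 1 / m with hY
    all_goals have hY0 : 0 < Y := by positivity
    all_goals have q1 : 0 < (1 / 16 + 4 * c ^ 2) / κ := by positivity
    all_goals have q2 : 0 < 1 / m := by positivity
    all_goals have q3 : 0 < B * D ^ 2 := by positivity
    · rw [div_le_one hY0]; linarith
    · rw [mul_one_div, div_le_one hY0]; linarith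
    · rw [mul_one_div, div_le_one hY0]; linarith
    · rw [mul_one_div, div_le_iff₀ hY0]
      have : (1 / 16 + 4 * c ^ 2) / κ ≤ Y := by linarith
      rw [div_le_iff₀ hκ0] at this
      linarith
    · rw [div_le_iff₀ hY0]
      have : 1 / m ≤ Y := by linarith
      rw [div_le_iff₀ hm] at this
      linarith
  have hee : e ^ 2 ≤ e := by nlinarith
  refine ⟨e ^ 2, by positivity, fun {Ω K T v Dv p} z R α₀ π₀ hH hα₀ hπ₀ hV hPB hG => ?_⟩
  have hR : 0 < R := hH.2.2.1
  obtain ⟨v₀, hsol⟩ := hH.2.1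
  have key : ∀ j : ℕ, ∃ α π : ℝ, 0 ≤ α ∧ 0 ≤ π ∧ VB v z (θ ^ j * R) α ∧ PB p z (θ ^ j * R) π ∧
      α + B * π ^ 2 ≤ (1 / 2) ^ j * (α₀ + B * π₀ ^ 2) + 2 * κ := by
    intro j
    induction j with
    | zero => exact ⟨α₀, π₀, hα₀, hπ₀, by simpa using hV, by simpa using hPB, by simp; linarith⟩
    | succ j ih =>
      obtain ⟨α, π, hα, hπ, hVj, hPj, hy⟩ := ih
      set r := θ ^ j * R with hr
      have hr0 : 0 < r := by positivity
      have hrR : r ≤ R := mul_le_of_le_one_left hR.le (pow_le_one₀ hθ.le (by linarith))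
      have hGj := hG r hr0 hrR
      obtain ⟨s1, s2⟩ := hH.SLr hr0 hrR
      have hHr : Hyp Ω K T v Dv p z r := by
        obtain ⟨h1, h2, h3, h4, h5, h6, h7, h8⟩ := hH
        have : r ^ 2 ≤ R ^ 2 := by gcongr
        exact ⟨h1, h2, hr0, s1, h5, by linarith, by linarith, h8⟩
      have hpi := hP hsol.meas_v hsol.meas_Dv hsol.meas_p z r α (e ^ 2) π hr0 hα (by positivity) hπ s1 s2 hVj hGj hPj
      obtain ⟨e1, -, -⟩ := hE z r θ 1 (fun _ => α) (fun _ => e ^ 2) (fun _ => π) hHr hθ hθ8 le_rfl (fun _ => hα) (fun _ => by positivity) (fun _ => hπ)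
        (fun k hk => by
          obtain rfl : k = 0 := by omega
          simpa using ⟨hVj, hGj, hPj⟩)
      have hα' : SS C1 C2 r θ 1 (fun _ => α) (fun _ => e ^ 2) (fun _ => π) * (θ ^ 1 * r) ^ 2 = C1 * θ ^ 2 * α + c * Psi α (e ^ 2) π := by
        simp [SS, hc]
        field_simp
      rw [hα'] at e1
      rw [pow_one] at e1
      rw [show θ ^ (j + 1) * R = θ * r by rw [hr]; ring]
      have hPs0 := Psi_nonneg hα (by positivity : 0 ≤ e ^ 2) hπ
      refine ⟨_, _, by positivity, by positivity, e1, hpi, ?_⟩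
      -- algebra
      set a := Real.sqrt α with ha
      have ha0 : 0 ≤ a := Real.sqrt_nonneg _
      have haa : α = a ^ 2 := (Real.sq_sqrt hα).symm
      have hse : Real.sqrt (e ^ 2) = e := Real.sqrt_sq he0.le
      have t1 : (α * e ^ 2) ^ hlf = a * e := by
        rw [← Real.sqrt_eq_rpow, Real.sqrt_mul hα, hse]
      have t2 : (α + e ^ 2) ^ hlf ≤ a + e := by
        rw [← Real.sqrt_eq_rpow]
        refine (sqrt_add_le' _ _ hα (by positivity)).trans ?_
        rw [hse]
      have t3 : Psi α (e ^ 2) π ≤ a * e ^ 2 + a ^ 2 * e + π * (a + e) := by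
        unfold Psi
        rw [← Real.sqrt_eq_rpow, ← Real.sqrt_eq_rpow, hse, ← ha, ← haa]
        gcongr
      have t4 : C * θ ^ (13 / 8 : ℝ) ≤ 1 / 4 := by
        have : θ ^ (13 / 8 : ℝ) ≤ θ := by
          calc θ ^ (13 / 8 : ℝ) ≤ θ ^ (1 : ℝ) := Real.rpow_le_rpow_of_exponent_ge hθ (by linarith) (by norm_num)
            _ = θ := Real.rpow_one θ
        exact (mul_le_mul_of_nonneg_left this hC.le).trans hθ4
      have u1 : C1 * θ ^ 2 ≤ 1 / 16 := by
        have : θ ^ 2 ≤ θ := by nlinarith only [hθ, hθ8]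
        exact (mul_le_mul_of_nonneg_left this hC1.le).trans hθ3
      have u0 := alg1 hc0 he0 he1 ha0 hπ hD u1 (by positivity : 0 ≤ C * θ ^ (13 / 8 : ℝ)) t4 t3 he2 he3 he4
      rw [t1]
      have u8 : hlf ^ (j + 1) * (α₀ + B * π₀ ^ 2) = (1 / 2) ^ j * (α₀ + B * π₀ ^ 2) / 2 := by ring
      rw [u8]
      rw [← haa, ← hB] at u0
      linarith only [u0, hy]
  have hlim : Tendsto (fun j : ℕ => hlf ^ j * (α₀ + B * π₀ ^ 2)) atTop (nhds 0) := by
    have := (tendsto_pow_atTop_nhds_zero_of_lt_one (by norm_num : (0:ℝ) ≤ 1 / 2) (by norm_num)).mul_const (α₀ + B * π₀ ^ 2)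
    simpa using this
  obtain ⟨j, hj⟩ := (hlim.eventually_lt_const hκ0).exists
  obtain ⟨α, π, hα, hπ, hVj, hPj, hy⟩ := key j
  have hr0 : 0 < θ ^ j * R := by positivity
  have hrR : θ ^ j * R ≤ R := mul_le_of_le_one_left hR.le (pow_le_one₀ hθ.le (by linarith))
  have hκ1 : 4 * κ ≤ m := by rw [hκ]; linarith [min_le_left m (B * m ^ 2)]
  have hκ2 : 4 * κ ≤ B * m ^ 2 := by rw [hκ]; linarith [min_le_right m (B * m ^ 2)]
  refine ⟨θ ^ j * R, hr0, hrR, hVj.mono hr0.le ?_, (hG _ hr0 hrR).mono hr0.le (by linarith), hPj.mono hr0.le hπ ?_⟩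
  · have : 0 ≤ B * π ^ 2 := by positivity
    linarith
  · have : B * π ^ 2 ≤ B * m ^ 2 := by linarith
    have := le_of_mul_le_mul_left this hB0
    exact le_of_sq_le_sq this hm.le
end
end

section
lemma shift : ∃ c : ℝ, 1 ≤ c ∧ ∀ {Ω K : Set E3} {T : ℝ} {v : ST → E3} {Dv : ST → Fin 3 → Fin 3 → ℝ} {p : ST → ℝ}
    (z₀ z : ST) (R m : ℝ), Hyp Ω K T v Dv p z₀ R → 0 ≤ m → z ∈ pcyl z₀ (R / 2) → VB v z₀ R m → GB Dv z₀ R m → PB p z₀ R m →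
    Hyp Ω K T v Dv p z (R / 2) ∧ VB v z (R / 2) (c * m) ∧ GB Dv z (R / 2) (c * m) ∧ PB p z (R / 2) (c * m) := by
  refine ⟨4, by norm_num, fun {Ω K T v Dv p} z₀ z R m hH hm hz hV hG hP => ?_⟩
  obtain ⟨h1, h2, hR, h4, h5, h6, h7, h8⟩ := hH
  have hR2 : 0 < R ^ 2 := by positivity
  have d1 : dist z.1 z₀.1 < R / 2 := hz.1
  have d2 : z₀.2 - (R / 2) ^ 2 < z.2 := hz.2.1
  have d3 : z.2 < z₀.2 := hz.2.2
  have e : (R / 2) ^ 2 = R ^ 2 / 4 := by ring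
  have hb : ball z.1 (R / 2) ⊆ ball z₀.1 R := ball_subset_ball' (by linarith)
  have hcb : closedBall z.1 (R / 2) ⊆ closedBall z₀.1 R := closedBall_subset_closedBall' (by linarith)
  have hTI : TI z (R / 2) ⊆ TI z₀ R := Ioo_subset_Ioo (by linarith) d3.le
  have hmR : m * R ≤ 4 * m * (R / 2) := by nlinarith [mul_nonneg hm hR.le]
  refine ⟨⟨h1, h2, by positivity, hcb.trans h4, h5, by linarith, by linarith, h8⟩, ?_, ?_, ?_⟩
  · filter_upwards [ae_restrict_of_ae_restrict_of_subset hTI hV] with t ht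
    exact (lintegral_mono_set hb).trans (ht.trans (ofReal_le_ofReal hmR))
  · refine (lintegral_mono_set hTI).trans ((lintegral_mono fun t => lintegral_mono_set hb).trans (hG.trans (ofReal_le_ofReal hmR)))
  · obtain ⟨w, hw, hw1, hw2⟩ := hP
    refine ⟨w, hw, (lintegral_mono_set hTI).trans (hw1.trans (ofReal_le_ofReal ?_)), ?_⟩
    · rw [Real.mul_rpow (by norm_num) hm, Real.div_rpow hR.le (by norm_num)]
      have : (2:ℝ) ^ (23 / 11 : ℝ) ≤ 4 ^ r16 := by
        rw [show (4:ℝ) = 2 ^ (2:ℝ) by norm_num, ← Real.rpow_mul (by norm_num)]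
        exact Real.rpow_le_rpow_of_exponent_le (by norm_num) (by norm_num)
      have hX : 0 ≤ m ^ r16 * R ^ (23 / 11 : ℝ) := by positivity
      have h2p : (0:ℝ) < 2 ^ (23 / 11 : ℝ) := by positivity
      rw [show 4 ^ r16 * m ^ r16 * (R ^ (23 / 11 : ℝ) / 2 ^ (23 / 11 : ℝ)) =
        (4 ^ r16 / 2 ^ (23 / 11 : ℝ)) * (m ^ r16 * R ^ (23 / 11 : ℝ)) by ring]
      exact le_mul_of_one_le_left hX ((one_le_div h2p).mpr this)
    · filter_upwards [ae_restrict_of_ae_restrict_of_subset hTI hw2] with t ⟨c, hc⟩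
      exact ⟨c, (lintegral_mono_set hb).trans hc⟩

lemma leb_bound {u : E3 → E3} (hu : Measurable u) {x₀ : E3} {R M θ : ℝ} (hR : 0 < R) (hM : 0 ≤ M) (hθ : 0 < θ) (hθ1 : θ < 1)
    (hfin : ∫⁻ x in ball x₀ R, ‖u x‖ₑ ^ 2 ≠ ∞)
    (h : ∀ x ∈ ball x₀ (R / 2), ∀ n : ℕ, ∫⁻ y in ball x (θ ^ (n + 1) * (R / 2)), ‖u y‖ₑ ^ 2 ≤ oR (M * (θ ^ (n + 1) * (R / 2)) ^ 3))
    {C : ℝ} (hC : 0 < C) (hCb : ∀ (x : E3) (r : ℝ), 0 < r → volume (ball x r) = oR (C * r ^ 3)) :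
    ∀ᵐ x ∂(volume.restrict (ball x₀ (R / 2))), ‖u x‖ ≤ Real.sqrt (8 * M / C) := by
  set g : E3 → ℝ := (ball x₀ R).indicator fun x => ‖u x‖ ^ 2 with hg
  have hgm : Measurable fun x => ‖u x‖ ^ 2 := by fun_prop
  have hgi : Integrable g := by
    rw [hg, integrable_indicator_iff measurableSet_ball]
    refine ⟨hgm.aestronglyMeasurable, lt_of_le_of_lt (le_of_eq (lintegral_congr fun x => ?_)) (lt_top_iff_ne_top.mpr hfin)⟩
    rw [enorm_pow, enorm_norm]
  have hg0 : ∀ x, 0 ≤ g x := fun x => indicator_nonneg (fun _ _ => by positivity) x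
  rw [ae_restrict_iff' measurableSet_ball]
  filter_upwards [IsUnifLocDoublingMeasure.ae_tendsto_average volume hgi.locallyIntegrable 1] with x hx hxb
  set δ : ℕ → ℝ := fun n => θ ^ (n + 1) * (R / 2) / 2 with hδ
  have hδ0 : ∀ n, 0 < δ n := fun n => by positivity
  have hδl : Tendsto δ atTop (nhdsWithin 0 (Ioi 0)) := by
    apply tendsto_nhdsWithin_of_tendsto_nhds_of_eventually_within
    · have := ((tendsto_pow_atTop_nhds_zero_of_lt_one hθ.le hθ1).comp (tendsto_add_atTop_nat 1)).mul_const (R / 2 / 2)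
      rw [zero_mul] at this
      refine this.congr fun n => ?_
      simp [hδ]; ring
    · exact Eventually.of_forall hδ0
  have hlim := hx (fun _ : ℕ => x) δ hδl (Eventually.of_forall fun n => mem_closedBall_self (by have := hδ0 n; positivity))
  have hbd : ∀ n, (⨍ y in closedBall x (δ n), g y) ≤ 8 * M / C := by
    intro n
    have hr0 : 0 < θ ^ (n + 1) * (R / 2) := by positivity
    rw [setAverage_eq, smul_eq_mul]
    have hvol : volume.real (closedBall x (δ n)) = C * δ n ^ 3 := by
      rw [Measure.real, Measure.addHaar_closedBall_eq_addHaar_ball, hCb x _ (hδ0 n), toReal_ofReal (by have := hδ0 n; positivity)]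
    rw [hvol]
    have hI : ∫ y in closedBall x (δ n), g y ≤ M * (θ ^ (n + 1) * (R / 2)) ^ 3 := by
      rw [← ofReal_le_ofReal_iff (by positivity)]
      refine (ofReal_int_le hgi.integrableOn).trans (le_trans ?_ (h x hxb n))
      refine (lintegral_mono_set (closedBall_subset_ball (?_ : δ n < θ ^ (n + 1) * (R / 2)))).trans (lintegral_mono fun y => ?_)
      · simp only [hδ]; linarith
      · rw [← ofReal_norm, ← ofReal_pow (norm_nonneg _)]
        apply ofReal_le_ofReal
        exact indicator_le_self' (fun _ _ => by positivity) y
    have hd : (θ ^ (n + 1) * (R / 2)) ^ 3 = 8 * δ n ^ 3 := by simp only [hδ]; ring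
    rw [hd] at hI
    have hδ3 : 0 < δ n ^ 3 := pow_pos (hδ0 n) 3
    calc _ ≤ (C * δ n ^ 3)⁻¹ * (M * (8 * δ n ^ 3)) := by gcongr
      _ = 8 * M / C := by have hδn := (hδ0 n).ne'; field_simp
  have hle : g x ≤ 8 * M / C := le_of_tendsto' hlim hbd
  have hgx : g x = ‖u x‖ ^ 2 := indicator_of_mem (ball_subset_ball (by linarith) hxb) _
  rw [hgx] at hle
  exact Real.le_sqrt_of_sq_le hle

lemma ae_prod_of {A : Set E3} {I : Set ℝ} {v : ST → E3} (hv : Measurable v) {M : ℝ}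
    (h : ∀ᵐ t ∂(volume.restrict I), ∀ᵐ x ∂(volume.restrict A), ‖v (x, t)‖ ≤ M) : ∀ᵐ w ∂(volume.restrict (A ×ˢ I)), ‖v w‖ ≤ M := by
  have hm : MeasurableSet {w | ¬ ‖v w‖ ≤ M} := (measurableSet_le hv.norm measurable_const).compl
  rw [ae_iff, ← lintegral_indicator_one hm, lfub (measurable_one.indicator hm)]
  rw [← lintegral_zero (μ := volume.restrict I)]
  refine lintegral_congr_ae ?_
  filter_upwards [h] with t ht
  rw [← lintegral_zero (μ := volume.restrict A)]
  refine lintegral_congr_ae ?_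
  filter_upwards [ht] with x hx
  apply indicator_of_notMem
  simpa using hx

lemma regular_of_small : ∃ m : ℝ, 0 < m ∧ ∀ {Ω K : Set E3} {T : ℝ} {v : ST → E3} {Dv : ST → Fin 3 → Fin 3 → ℝ} {p : ST → ℝ}
    (z : ST) (R : ℝ), Hyp Ω K T v Dv p z R → VB v z R m → GB Dv z R m → PB p z R m → RegularPoint Ω T v z := by
  obtain ⟨θ, hθ, hθ1, m, hm, A, hA, hdec⟩ := decay
  obtain ⟨c, hc, hsh⟩ := shift
  obtain ⟨C, hC, hCb⟩ := vol_ball'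
  have hc0 : 0 < c := by linarith
  refine ⟨m / c, by positivity, fun {Ω K T v Dv p} z R hH hV hG hP => ?_⟩
  have hs := fun w hw => hsh z w R (m / c) hH (by positivity) hw hV hG hP
  rw [mul_div_cancel₀ m hc0.ne'] at hs
  obtain ⟨h1, ⟨v₀, hsol⟩, hR, h4, h5, h6, h7, h8⟩ := hH
  have hR2 : 0 < R ^ 2 := by positivity
  have hTs : Ioo (z.2 - (R / 2) ^ 2) z.2 ⊆ Ioo 0 T := fun s hs => ⟨by nlinarith [hs.1], by linarith [hs.2]⟩
  refine ⟨R / 2, by positivity, prod_mono ?_ hTs, Real.sqrt (8 * (A * ((R / 2) ^ 2)⁻¹) / C), ae_prod_of hsol.meas_v ?_⟩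
  · exact (ball_subset_closedBall.trans (closedBall_subset_closedBall (by linarith))).trans (h4.trans h5)
  filter_upwards [ae_restrict_of_ae_restrict_of_subset hTs (ae_good hsol), ae_restrict_mem measurableSet_Ioo] with t ht htm
  have hv := hsol.meas_v
  refine leb_bound (u := fun x => v (x, t)) (by fun_prop) hR (by positivity) hθ hθ1 ?_ (fun x hx n => ?_) hC hCb
  · exact ne_top_of_le_ne_top ht.2.2 (lintegral_mono_set ((ball_subset_closedBall.trans h4).trans h5))
  · obtain ⟨k1, k2, k3, k4⟩ := hs (x, t) ⟨hx, htm⟩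
    exact hdec (x, t) (R / 2) k1 k2 k3 k4 ht n

lemma start {Ω : Set E3} {T : ℝ} {v : ST → E3} {Dv : ST → Fin 3 → Fin 3 → ℝ} {p : ST → ℝ} {v₀ : E3 → E3}
    (hsol : IsSuitableWeakSolution Ω T v Dv p v₀) (z : ST) (R : ℝ) (hR : 0 < R) (hb : ball z.1 R ⊆ Ω) (hT : TI z R ⊆ Ioo 0 T) :
    ∃ α π, 0 ≤ α ∧ 0 ≤ π ∧ VB v z R α ∧ PB p z R π := by
  obtain ⟨A, hA, hlin⟩ := linf hsol
  have hp := hsol.meas_p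
  have hpm : Measurable fun w => ‖p w‖ₑ ^ r16 := by fun_prop
  have hfin : ∫⁻ w in ball z.1 R ×ˢ TI z R, ‖p w‖ₑ ^ r16 ≠ ∞ := by
    have h1 : ∫⁻ w in ball z.1 R ×ˢ TI z R, (1 + ‖|p w| ^ (3 / 2 : ℝ)‖ₑ) ≠ ∞ := by
      rw [lintegral_add_left measurable_const]
      refine add_ne_top.mpr ⟨?_, ?_⟩
      · rw [setLIntegral_const, Measure.volume_eq_prod, Measure.prod_prod, vol_TI, one_mul]
        exact mul_ne_top measure_ball_lt_top.ne ofReal_ne_top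
      · exact (hsol.p_l32.mono_set (prod_mono hb hT)).2.ne
    refine ne_top_of_le_ne_top h1 (lintegral_mono fun w => ?_)
    rw [← ofReal_norm, ofReal_rpow_of_nonneg (norm_nonneg _) (by norm_num), Real.enorm_of_nonneg (by positivity), ← ofReal_one,
      ← ofReal_add (by norm_num) (by positivity)]
    apply ofReal_le_ofReal
    rw [Real.norm_eq_abs]
    have := le_one_rpow (|p w| ^ r16) (by positivity) (33 / 32) (by norm_num)
    rwa [← Real.rpow_mul (abs_nonneg _), show r16 * (33 / 32) = 3 / 2 by norm_num] at this
  set X := (∫⁻ w in ball z.1 R ×ˢ TI z R, ‖p w‖ₑ ^ r16).toReal with hX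
  have hX0 : 0 ≤ X := toReal_nonneg
  refine ⟨A / R, (X / R ^ (23 / 11 : ℝ)) ^ (11 / 16 : ℝ), by positivity, by positivity, ?_,
    fun t => ∫⁻ x in ball z.1 R, ‖p (x, t)‖ₑ ^ r16, hpm.lintegral_prod_left' (μ := volume.restrict (ball z.1 R)), ?_, ?_⟩
  · filter_upwards [ae_restrict_of_ae_restrict_of_subset hT hlin] with t ht
    rw [div_mul_cancel₀ _ hR.ne']
    exact (lintegral_mono_set hb).trans ht
  · rw [← lfub hpm, ← Real.rpow_mul (by positivity), show (11 / 16 : ℝ) * (16 / 11) = 1 by norm_num, Real.rpow_one,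
      div_mul_cancel₀ _ (by positivity), hX, ofReal_toReal hfin]
  · exact ae_of_all _ fun t => ⟨0, by simp⟩

theorem ckn_main
    (Ω : Set E3) (T : ℝ) (v : ST → E3) (Dv : ST → Fin 3 → Fin 3 → ℝ)
    (p : ST → ℝ) (v₀ : E3 → E3)
    (hΩ : IsOpen Ω)
    (hsol : IsSuitableWeakSolution Ω T v Dv p v₀) :
    μH[(1 : ℝ)] (toParabolic '' {z : ST | SingularPoint Ω T v z}) = 0 := by
  obtain ⟨m, hm, hreg⟩ := regular_of_small
  obtain ⟨ε, hε, hsm⟩ := small_scale m hm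
  have hmg : Measurable fun w => gn (Dv w) := measurable_gn.comp hsol.meas_Dv
  refine covering (fun w => gn (Dv w)) (Ω ×ˢ Ioo 0 T) ?_ _ ε hε fun z hz δ hδ => ?_
  · have := (D2_int hsol).2.ne
    refine ne_top_of_le_ne_top this (le_of_eq (lintegral_congr fun w => ?_))
    rw [Real.enorm_of_nonneg (by positivity), gn]
  obtain ⟨⟨hzΩ, hz0, hzT⟩, hnreg⟩ := hz
  by_contra hcon
  push Not at hcon
  apply hnreg
  obtain ⟨ρ, hρ, hρΩ⟩ := Metric.isOpen_iff.mp hΩ z.1 hzΩ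
  obtain ⟨R, hR, hRδ, hRρ, hR1, hR2⟩ : ∃ R : ℝ, 0 < R ∧ R < δ ∧ R < ρ ∧ R ^ 2 < z.2 ∧ R ^ 2 < T - z.2 := by
    have hT' : 0 < T - z.2 := sub_pos.mpr hzT
    have hq : 0 < min (min δ ρ) (min (Real.sqrt z.2) (Real.sqrt (T - z.2))) := by
      have := Real.sqrt_pos.mpr hz0
      have := Real.sqrt_pos.mpr hT'
      positivity
    obtain ⟨R, hR, hRm⟩ := exists_between hq
    rw [lt_min_iff, lt_min_iff, lt_min_iff] at hRm
    exact ⟨R, hR, hRm.1.1, hRm.1.2, (Real.lt_sqrt hR.le).mp hRm.2.1, (Real.lt_sqrt hR.le).mp hRm.2.2⟩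
  have hcb : closedBall z.1 R ⊆ Ω := (closedBall_subset_ball hRρ).trans hρΩ
  have hH : Hyp Ω (closedBall z.1 R) T v Dv p z R :=
    ⟨hΩ, ⟨v₀, hsol⟩, hR, subset_rfl, hcb, by linarith, by linarith, ae_slices hΩ hsol _ (isCompact_closedBall _ _) hcb⟩
  have hsub : ∀ r, 0 < r → r ≤ R → ball z.1 r ⊆ Ω ∧ TI z r ⊆ Ioo 0 T := by
    intro r hr hrR
    have : r ^ 2 ≤ R ^ 2 := by gcongr
    exact ⟨(ball_subset_closedBall.trans (closedBall_subset_closedBall hrR)).trans hcb,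
      fun s hs => ⟨by linarith [hs.1], by linarith [hs.2]⟩⟩
  obtain ⟨α, π, hα, hπ, hV, hP⟩ := start hsol z R hR (hsub R hR le_rfl).1 (hsub R hR le_rfl).2
  have hG : ∀ r, 0 < r → r ≤ R → GB Dv z r ε := by
    intro r hr hrR
    have := hcon r hr (hrR.trans_lt hRδ) (prod_mono (hsub r hr hrR).1 (hsub r hr hrR).2)
    rw [pcyl, lfub hmg] at this
    exact this.le
  obtain ⟨r, hr, hrR, k1, k2, k3⟩ := hsm z R α π hH hα hπ hV hP hG
  refine hreg z r ?_ k1 k2 k3 (K := closedBall z.1 R) (Ω := Ω) (T := T) (p := p) (Dv := Dv)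
  obtain ⟨q1, q2, q3, q4, q5, q6, q7, q8⟩ := hH
  have : r ^ 2 ≤ R ^ 2 := by gcongr
  exact ⟨q1, q2, hr, (closedBall_subset_closedBall hrR).trans q4, q5, by linarith, by linarith, q8⟩
end

/-- **Caffarelli–Kohn–Nirenberg partial regularity**: for a suitable weak
solution `(v,p)` of the Navier–Stokes equations in `Q_T = Ω × (0,T)`, the set
`S` of singular points of `v` has vanishing one-dimensional Hausdorff measure
with respect to the parabolic metric
`d((x,t),(x',t')) = max |x-x'| (|t-t'|^{1/2})`. -/
theorem singular_set_parabolic_hausdorff_measure_one_eq_zero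
    (Ω : Set E3) (T : ℝ) (v : E3 × ℝ → E3) (Dv : E3 × ℝ → Fin 3 → Fin 3 → ℝ)
    (p : E3 × ℝ → ℝ) (v₀ : E3 → E3)
    (hΩ : IsOpen Ω) (hT : 0 < T)
    (hsol : IsSuitableWeakSolution Ω T v Dv p v₀) :
    μH[(1 : ℝ)] (toParabolic '' {z : E3 × ℝ | SingularPoint Ω T v z}) = 0 := by
  exact ckn_main Ω T v Dv p v₀ hΩ hsol

end
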